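/- arXiv:2205.04184 — 2 statements merged into one kernel-verified Lean document; each statement's English description precedes it below -/
import Mathlib

section
/- Let n ≥ 2 and s ≥ n+3, and suppose L = L_{n,d}(m_1,…,m_s) is nonzero (effective) and m_1+⋯+m_s ≤ nd (equivalently k_C ≤ 0). Then dim L = Σ_{I ⊆ {1,…,s}} (−1)^{|I|} · C(n + k_I − |I|, n), where for I ⊆ {1,…,s} one sets k_I := Σ_{i∈I} m_i − (|I|−1)·d (so k_∅ = d). -/
open Finset

noncomputable section

/-- Binomial coefficient `C(a,k)` with integer arguments; zero if `k < 0` or `a < k`. -/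
def Cb (a k : ℤ) : ℤ := if 0 ≤ k ∧ k ≤ a then (Nat.choose a.toNat k.toNat : ℤ) else 0

/-- Iterated partial derivative along a list of coordinate directions, as a linear map. -/
def derivAlong {n : ℕ} (D : List (Fin (n+1))) :
    MvPolynomial (Fin (n+1)) ℂ →ₗ[ℂ] MvPolynomial (Fin (n+1)) ℂ :=
  D.foldr (fun j f => (MvPolynomial.pderiv j).toLinearMap.comp f) LinearMap.id

/-- The point `(1, u, u², …, uⁿ) ∈ ℂ^{n+1}` on the affine cone over the
rational normal curve of degree `n`. -/
def rncPoint (n : ℕ) (u : ℂ) : Fin (n+1) → ℂ := fun j => u ^ (j : ℕ)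

/-- The linear system `L_{n,d}(m_1,…,m_s)`: homogeneous polynomials of degree `d`
in `x_0,…,x_n` all of whose partial derivatives of total order `≤ m_i − 1`
vanish at the point `p_i = (1, t_i, …, t_iⁿ)`. -/
def linSys (n d s : ℕ) (m : Fin s → ℕ) (tp : Fin s → ℂ) :
    Submodule ℂ (MvPolynomial (Fin (n+1)) ℂ) :=
  MvPolynomial.homogeneousSubmodule (Fin (n+1)) ℂ d ⊓
    ⨅ (i : Fin s), ⨅ (D : List (Fin (n+1))), ⨅ (_ : D.length < m i),
      LinearMap.ker
        ((MvPolynomial.aeval (rncPoint n (tp i))).toLinearMap.comp (derivAlong D))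

/-- `k_C = ⌈(m_1+⋯+m_s − nd)/(s−n−2)⌉`. -/
def kC (n d s : ℕ) (m : Fin s → ℕ) : ℤ :=
  ⌈((∑ i, (m i : ℚ)) - (n : ℚ) * d) / ((s : ℚ) - n - 2)⌉


namespace RNC

set_option linter.unusedSectionVars false
set_option linter.unusedVariables false

open MvPolynomial

variable {σ : Type} [Fintype σ]

/-- vanishing to order at least `k` at `p`, recursive form -/
def Van (p : σ → ℂ) : ℕ → MvPolynomial σ ℂ → Prop
  | 0, _ => True
  | k + 1, P => eval p P = 0 ∧ ∀ i, Van p k (pderiv i P)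

lemma Van.of_succ (p : σ → ℂ) : ∀ (k : ℕ) (P : MvPolynomial σ ℂ), Van p (k + 1) P → Van p k P
  | 0, _, _ => trivial
  | k + 1, _, h => ⟨h.1, fun i => Van.of_succ p k _ (h.2 i)⟩

lemma Van.mono (p : σ → ℂ) {k l : ℕ} (hkl : k ≤ l) {P : MvPolynomial σ ℂ} (h : Van p l P) :
    Van p k P := by
  induction l, hkl using Nat.le_induction with
  | base => exact h
  | succ l _ ih => exact ih (Van.of_succ p l P h)

lemma Van.zero (p : σ → ℂ) (k : ℕ) : Van p k 0 := by
  induction k with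
  | zero => trivial
  | succ k ih => exact ⟨by simp, fun i => by simpa using ih⟩

lemma Van.add (p : σ → ℂ) (k : ℕ) {P Q : MvPolynomial σ ℂ} (hP : Van p k P) (hQ : Van p k Q) :
    Van p k (P + Q) := by
  induction k generalizing P Q with
  | zero => trivial
  | succ k ih =>
    refine ⟨by simp [hP.1, hQ.1], fun i => ?_⟩
    rw [map_add]
    exact ih (hP.2 i) (hQ.2 i)

lemma Van.smul (p : σ → ℂ) (k : ℕ) (c : ℂ) {P : MvPolynomial σ ℂ} (hP : Van p k P) :
    Van p k (c • P) := by
  induction k generalizing P with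
  | zero => trivial
  | succ k ih =>
    refine ⟨by simp [hP.1], fun i => ?_⟩
    rw [Derivation.map_smul]
    exact ih (hP.2 i)

lemma Van.sum (p : σ → ℂ) (k : ℕ) {α : Type} (s : Finset α) (f : α → MvPolynomial σ ℂ)
    (h : ∀ a ∈ s, Van p k (f a)) : Van p k (∑ a ∈ s, f a) := by
  classical
  induction s using Finset.induction_on with
  | empty => simpa using Van.zero p k
  | insert a s ha ih =>
    rw [Finset.sum_insert ha]
    exact Van.add p k (h a (by simp)) (ih fun b hb => h b (by simp [hb]))

lemma Van.mul (p : σ → ℂ) (k l : ℕ) {P Q : MvPolynomial σ ℂ} (hP : Van p k P) (hQ : Van p l Q) :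
    Van p (k + l) (P * Q) := by
  obtain ⟨N, hN⟩ : ∃ N, N = k + l := ⟨_, rfl⟩
  rw [← hN]
  induction N generalizing k l P Q with
  | zero => trivial
  | succ N ih =>
    refine ⟨?_, fun i => ?_⟩
    · rcases k with _ | k
      · rcases l with _ | l
        · omega
        · simp [hQ.1]
      · simp [hP.1]
    · rw [Derivation.leibniz]
      simp only [smul_eq_mul]
      apply Van.add
      · rcases l with _ | l
        · exact ih (k - 1) 0 (Van.mono p (by omega) hP) trivial (by omega)
        · exact ih k l hP (hQ.2 i) (by omega)
      · rcases k with _ | k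
        · exact ih (l - 1) 0 (Van.mono p (by omega) hQ) trivial (by omega)
        · exact ih l k hQ (hP.2 i) (by omega)

/-- derivative in direction `p` -/
def dd (p : σ → ℂ) : Derivation ℂ (MvPolynomial σ ℂ) (MvPolynomial σ ℂ) :=
  ∑ i, p i • pderiv i

lemma dd_apply (p : σ → ℂ) (P : MvPolynomial σ ℂ) : dd p P = ∑ i, p i • pderiv i P := by
  have h := map_sum (Derivation.coeFnAddMonoidHom (R := ℂ) (A := MvPolynomial σ ℂ)
    (M := MvPolynomial σ ℂ)) (fun i => p i • pderiv i) Finset.univ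
  have h2 := congrFun h P
  rw [Finset.sum_apply] at h2
  exact h2

lemma pderiv_comm' (i j : σ) (P : MvPolynomial σ ℂ) :
    pderiv i (pderiv j P) = pderiv j (pderiv i P) := by
  classical
  have h : ⁅(pderiv i : Derivation ℂ (MvPolynomial σ ℂ) (MvPolynomial σ ℂ)),
      (pderiv j : Derivation ℂ (MvPolynomial σ ℂ) (MvPolynomial σ ℂ))⁆ = 0 := by
    apply MvPolynomial.derivation_ext
    intro k
    rw [Derivation.commutator_apply]
    simp [pderiv_X, Pi.single_apply, apply_ite]
  have := congrArg (fun D => D P) h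
  simp only [Derivation.commutator_apply, Derivation.coe_zero, Pi.zero_apply] at this
  exact sub_eq_zero.mp this

lemma pderiv_dd (p : σ → ℂ) (i : σ) (P : MvPolynomial σ ℂ) :
    pderiv i (dd p P) = dd p (pderiv i P) := by
  simp only [dd_apply, map_sum, Derivation.map_smul]
  exact Finset.sum_congr rfl fun j _ => by rw [pderiv_comm']

lemma pderiv_dd_iter (p : σ → ℂ) (i : σ) (k : ℕ) (P : MvPolynomial σ ℂ) :
    pderiv i ((dd p)^[k] P) = (dd p)^[k] (pderiv i P) := by
  induction k generalizing P with
  | zero => rfl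
  | succ k ih => rw [Function.iterate_succ_apply, Function.iterate_succ_apply, ih, pderiv_dd]

lemma dd_hom (p : σ → ℂ) {d : ℕ} {P : MvPolynomial σ ℂ} (h : P.IsHomogeneous d) :
    (dd p P).IsHomogeneous (d - 1) := by
  rw [dd_apply]
  refine IsHomogeneous.sum _ _ _ fun i _ => ?_
  rw [smul_eq_C_mul]
  simpa using (isHomogeneous_C σ (p i)).mul (h.pderiv (i := i))

lemma dd_iter_hom (p : σ → ℂ) (k : ℕ) {d : ℕ} {P : MvPolynomial σ ℂ} (h : P.IsHomogeneous d) :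
    ((dd p)^[k] P).IsHomogeneous (d - k) := by
  induction k with
  | zero => exact h
  | succ k ih =>
    rw [Function.iterate_succ_apply', ← Nat.sub_sub]
    exact dd_hom p ih

lemma eval_dd (p : σ → ℂ) {d : ℕ} {P : MvPolynomial σ ℂ} (h : P.IsHomogeneous d) :
    eval p (dd p P) = d * eval p P := by
  have := congrArg (eval p) h.sum_X_mul_pderiv
  simp only [map_sum, map_mul, eval_X, map_nsmul] at this
  rw [dd_apply, map_sum]
  simpa [smul_eval] using this

lemma eval_dd_iter (p : σ → ℂ) (k : ℕ) {d : ℕ} {P : MvPolynomial σ ℂ} (h : P.IsHomogeneous d) :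
    eval p ((dd p)^[k] P) = d.descFactorial k * eval p P := by
  induction k with
  | zero => simp
  | succ k ih =>
    rw [Function.iterate_succ_apply', eval_dd p (dd_iter_hom p k h), ih, Nat.descFactorial_succ]
    push_cast
    ring

lemma Van.dd (p q : σ → ℂ) (k : ℕ) {P : MvPolynomial σ ℂ} (h : Van p k P) :
    Van p (k - 1) (dd q P) := by
  rcases k with _ | k
  · trivial
  · rw [dd_apply]
    exact Van.sum p _ _ _ fun i _ => Van.smul p _ _ (h.2 i)

lemma Van.dd_iter (p q : σ → ℂ) (k l : ℕ) {P : MvPolynomial σ ℂ} (h : Van p k P) :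
    Van p (k - l) ((RNC.dd q)^[l] P) := by
  induction l with
  | zero => exact h
  | succ l ih =>
    rw [Function.iterate_succ_apply', ← Nat.sub_sub]
    exact Van.dd p q _ ih

/-- order of vanishing `> d` of a form of degree `d` forces zero -/
lemma eq_zero_of_van (p : σ → ℂ) (d : ℕ) {P : MvPolynomial σ ℂ} (h : P.IsHomogeneous d)
    (hv : Van p (d + 1) P) : P = 0 := by
  induction d generalizing P with
  | zero =>
    have hc := (totalDegree_zero_iff_isHomogeneous σ).2 h
    rw [totalDegree_eq_zero_iff_eq_C] at hc
    have := hv.1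
    rw [hc] at this ⊢
    simp only [eval_C] at this
    rw [this, map_zero]
  | succ d ih =>
    have h0 : ∀ i, pderiv i P = 0 := fun i => ih (by simpa using h.pderiv (i := i)) (hv.2 i)
    have := h.sum_X_mul_pderiv
    simp only [h0, mul_zero, Finset.sum_const_zero] at this
    have h2 : ((d + 1 : ℕ) : ℂ) • P = 0 := by
      rw [Nat.cast_smul_eq_nsmul]; exact this.symm
    rcases smul_eq_zero.mp h2 with h3 | h3
    · exact absurd h3 (by exact_mod_cast Nat.succ_ne_zero d)
    · exact h3

/-- iterated derivatives along `p` keep the order of vanishing at `p` -/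
lemma Van.self (p : σ → ℂ) (k l : ℕ) {d : ℕ} {P : MvPolynomial σ ℂ} (h : P.IsHomogeneous d)
    (hv : Van p k P) : Van p k ((RNC.dd p)^[l] P) := by
  induction k generalizing P d with
  | zero => trivial
  | succ k ih =>
    refine ⟨by rw [eval_dd_iter p l h, hv.1, mul_zero], fun i => ?_⟩
    rw [pderiv_dd_iter]
    exact ih (h.pderiv (i := i)) (hv.2 i)

lemma Van.of_dd (p : σ → ℂ) (k l : ℕ) {P : MvPolynomial σ ℂ} (h : P.IsHomogeneous (k + l))
    (hv : (RNC.dd p)^[l] P = 0) : Van p (k + 1) P := by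
  induction k generalizing P with
  | zero =>
    refine ⟨?_, fun i => trivial⟩
    have := eval_dd_iter p l h
    rw [hv, map_zero, zero_add, Nat.descFactorial_self] at this
    rcases mul_eq_zero.mp this.symm with h3 | h3
    · exact absurd h3 (by exact_mod_cast Nat.factorial_ne_zero l)
    · exact h3
  | succ k ih =>
    refine ⟨?_, fun i => ?_⟩
    · have := eval_dd_iter p l h
      rw [hv, map_zero] at this
      rcases mul_eq_zero.mp this.symm with h3 | h3
      · exact absurd h3 (by
          have : (k + 1 + l).descFactorial l ≠ 0 := by
            rw [Ne, Nat.descFactorial_eq_zero_iff_lt]; omega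
          exact_mod_cast this)
      · exact h3
    · apply ih
      · have := h.pderiv (i := i)
        rwa [show k + 1 + l - 1 = k + l by omega] at this
      · rw [← pderiv_dd_iter, hv, map_zero]

lemma dd_iter_mul (p : σ → ℂ) (k : ℕ) {g : MvPolynomial σ ℂ} (hg : dd p g = 0)
    (h : MvPolynomial σ ℂ) : (dd p)^[k] (g * h) = g * (dd p)^[k] h := by
  induction k with
  | zero => rfl
  | succ k ih =>
    rw [Function.iterate_succ_apply', Function.iterate_succ_apply', ih, Derivation.leibniz, hg]
    simp

lemma dd_iter_const (p : σ → ℂ) (k : ℕ) {h : MvPolynomial σ ℂ} (hh : h.IsHomogeneous k) :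
    (dd p)^[k] h = C (k.factorial * eval p h) := by
  have h1 := dd_iter_hom p k hh
  rw [Nat.sub_self] at h1
  have hc := (totalDegree_zero_iff_isHomogeneous σ).2 h1
  rw [totalDegree_eq_zero_iff_eq_C] at hc
  have h2 := eval_dd_iter p k hh
  rw [hc, eval_C, Nat.descFactorial_self] at h2
  rw [hc, h2]

/-- iterated directional derivative as linear map -/
def ddl (p : σ → ℂ) (k : ℕ) : MvPolynomial σ ℂ →ₗ[ℂ] MvPolynomial σ ℂ :=
  ((dd p : Derivation ℂ (MvPolynomial σ ℂ) (MvPolynomial σ ℂ)) :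
    MvPolynomial σ ℂ →ₗ[ℂ] MvPolynomial σ ℂ) ^ k

lemma ddl_apply (p : σ → ℂ) (k : ℕ) (P : MvPolynomial σ ℂ) : ddl p k P = (dd p)^[k] P := by
  rw [ddl, Module.End.pow_apply]
  rfl

lemma dd_iter_eq_zero (p : σ → ℂ) (k l : ℕ) {P : MvPolynomial σ ℂ} (h : P.IsHomogeneous (k + l))
    (hv : Van p (k + 1) P) : (dd p)^[l] P = 0 := by
  apply eq_zero_of_van p k
  · have := dd_iter_hom p l h
    rwa [Nat.add_sub_cancel] at this
  · exact Van.self p _ l h hv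

lemma dd_eq_zero (p : σ → ℂ) (d : ℕ) {P : MvPolynomial σ ℂ} (h : P.IsHomogeneous d)
    (hv : Van p d P) : dd p P = 0 := by
  rcases d with _ | d
  · have hc := (totalDegree_zero_iff_isHomogeneous σ).2 h
    rw [totalDegree_eq_zero_iff_eq_C] at hc
    rw [hc]
    exact Derivation.map_algebraMap _ _
  · exact dd_iter_eq_zero p d 1 h hv

variable {ι : Type} [Fintype ι] [DecidableEq ι]

/-- the linear system -/
def LS (p : ι → σ → ℂ) (d : ℕ) (m : ι → ℕ) : Submodule ℂ (MvPolynomial σ ℂ) where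
  carrier := {P | P.IsHomogeneous d ∧ ∀ i, Van (p i) (m i) P}
  add_mem' := fun hP hQ => ⟨hP.1.add hQ.1, fun i => Van.add _ _ (hP.2 i) (hQ.2 i)⟩
  zero_mem' := ⟨isHomogeneous_zero _ _ _, fun i => Van.zero _ _⟩
  smul_mem' := fun c P hP => ⟨(homogeneousSubmodule σ ℂ d).smul_mem c hP.1,
    fun i => Van.smul _ _ c (hP.2 i)⟩

lemma mem_LS {p : ι → σ → ℂ} {d : ℕ} {m : ι → ℕ} {P : MvPolynomial σ ℂ} :
    P ∈ LS p d m ↔ P.IsHomogeneous d ∧ ∀ i, Van (p i) (m i) P := Iff.rfl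

lemma LS_mono (p : ι → σ → ℂ) (d : ℕ) {m m' : ι → ℕ} (h : ∀ i, m i ≤ m' i) :
    LS p d m' ≤ LS p d m := fun _ hP => ⟨hP.1, fun i => Van.mono _ (h i) (hP.2 i)⟩

lemma LS_eq_bot (p : ι → σ → ℂ) (d : ℕ) (m : ι → ℕ) (i : ι) (h : d < m i) : LS p d m = ⊥ := by
  rw [eq_bot_iff]
  intro P hP
  exact eq_zero_of_van (p i) d hP.1 (Van.mono _ h (hP.2 i))

/-- increase one multiplicity -/
def up (m : ι → ℕ) (i : ι) : ι → ℕ := Function.update m i (m i + 1)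

lemma up_self (m : ι → ℕ) (i : ι) : up m i i = m i + 1 := by simp [up]
lemma up_ne (m : ι → ℕ) {i j : ι} (h : j ≠ i) : up m i j = m j := by simp [up, h]
lemma le_up (m : ι → ℕ) (i j : ι) : m j ≤ up m i j := by
  by_cases h : j = i
  · subst h; simp [up_self]
  · simp [up_ne m h]
lemma sum_up (m : ι → ℕ) (i : ι) : ∑ j, up m i j = ∑ j, m j + 1 := by
  rw [up, Finset.sum_update_of_mem (Finset.mem_univ i),
    ← Finset.add_sum_erase Finset.univ m (Finset.mem_univ i), Finset.sdiff_singleton_eq_erase]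
  omega

/-- multiplicities of the leading form at `s` -/
def red (d : ℕ) (m : ι → ℕ) (s : ι) : ι → ℕ := fun i => if i = s then m s else m i - (d - m s)

lemma red_self (d : ℕ) (m : ι → ℕ) (s : ι) : red d m s s = m s := by simp [red]
lemma red_ne (d : ℕ) (m : ι → ℕ) {s i : ι} (h : i ≠ s) : red d m s i = m i - (d - m s) := by
  simp [red, h]

lemma ddl_mem (p : ι → σ → ℂ) (d : ℕ) (m : ι → ℕ) (s : ι) (hs : m s ≤ d)
    {P : MvPolynomial σ ℂ} (hP : P ∈ LS p d m) :
    ddl (p s) (d - m s) P ∈ LS p (m s) (red d m s) := by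
  rw [ddl_apply]
  refine ⟨?_, fun i => ?_⟩
  · have := dd_iter_hom (p s) (d - m s) hP.1
    rwa [show d - (d - m s) = m s by omega] at this
  · by_cases h : i = s
    · subst h
      rw [red_self]
      exact Van.self _ _ _ hP.1 (hP.2 i)
    · rw [red_ne d m h]
      exact Van.dd_iter _ _ _ _ (hP.2 i)

lemma mem_up_iff (p : ι → σ → ℂ) (d : ℕ) (m : ι → ℕ) (s : ι) (hs : m s ≤ d)
    {P : MvPolynomial σ ℂ} (hP : P ∈ LS p d m) :
    P ∈ LS p d (up m s) ↔ ddl (p s) (d - m s) P = 0 := by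
  have hd : P.IsHomogeneous (m s + (d - m s)) := by
    rw [show m s + (d - m s) = d by omega]; exact hP.1
  rw [ddl_apply]
  constructor
  · intro h
    refine dd_iter_eq_zero (p s) (m s) (d - m s) hd ?_
    have := h.2 s
    rwa [up_self] at this
  · intro h
    refine ⟨hP.1, fun i => ?_⟩
    by_cases hi : i = s
    · subst hi
      rw [up_self]
      exact Van.of_dd _ _ _ hd h
    · rw [up_ne m hi]; exact hP.2 i

/-- linearly general position -/
def GP (n : ℕ) (p : ι → σ → ℂ) : Prop :=
  ∀ (T : Finset ι) (j : ι), j ∉ T → T.card ≤ n →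
    ∃ h : MvPolynomial σ ℂ, h.IsHomogeneous 1 ∧ (∀ i ∈ T, eval (p i) h = 0) ∧ eval (p j) h ≠ 0

lemma prodHyp {n : ℕ} {p : ι → σ → ℂ} (hp : GP n p) (s : ι) (e : ℕ) (w : ι → ℕ) (hws : w s = 0)
    (hwe : ∀ i, w i ≤ e) (hsum : ∑ i, w i ≤ n * e) :
    ∃ h : MvPolynomial σ ℂ, h ∈ LS p e w ∧ eval (p s) h ≠ 0 := by
  induction e generalizing w with
  | zero =>
    refine ⟨1, ⟨isHomogeneous_one _ _, fun i => ?_⟩, by simp⟩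
    rw [Nat.le_zero.mp (hwe i)]; trivial
  | succ e ih =>
    -- choose `T`
    have key : ∃ T : Finset ι, T.card ≤ n ∧ (∀ i ∈ T, w i ≠ 0) ∧ (∀ i, w i = e + 1 → i ∈ T) ∧
        ∑ i, (w i - if i ∈ T then 1 else 0) ≤ n * e := by
      by_cases hc : (Finset.univ.filter fun i => w i ≠ 0).card ≤ n
      · refine ⟨Finset.univ.filter fun i => w i ≠ 0, hc, fun i hi => by simpa using hi,
          fun i hi => by simp [hi], ?_⟩
        calc ∑ i, (w i - if i ∈ (Finset.univ.filter fun i => w i ≠ 0) then 1 else 0)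
            ≤ ∑ i, if w i ≠ 0 then e else 0 := by
              refine Finset.sum_le_sum fun i _ => ?_
              have := hwe i
              by_cases h0 : w i = 0
              · simp [h0]
              · simp only [Finset.mem_filter, Finset.mem_univ, true_and, ne_eq, h0,
                  not_false_eq_true, if_true]
                omega
          _ = (Finset.univ.filter fun i => w i ≠ 0).card * e := by
              rw [← Finset.sum_filter, Finset.sum_const, smul_eq_mul]
          _ ≤ n * e := Nat.mul_le_mul_right _ hc
      · push Not at hc
        have h1 : (Finset.univ.filter fun i => w i = e + 1) ⊆
            (Finset.univ.filter fun i => w i ≠ 0) := by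
          intro i hi
          simp only [Finset.mem_filter, Finset.mem_univ, true_and] at hi ⊢
          omega
        have h2 : (Finset.univ.filter fun i => w i = e + 1).card ≤ n := by
          by_contra hcon
          push Not at hcon
          have : (Finset.univ.filter fun i => w i = e + 1).card * (e + 1) ≤ ∑ i, w i := by
            rw [← smul_eq_mul, ← Finset.sum_const]
            calc ∑ i ∈ Finset.univ.filter (fun i => w i = e + 1), (e + 1)
                = ∑ i ∈ Finset.univ.filter (fun i => w i = e + 1), w i :=
                  Finset.sum_congr rfl fun i hi => by simpa using (Finset.mem_filter.mp hi).2.symm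
              _ ≤ _ := Finset.sum_le_sum_of_subset (Finset.filter_subset _ _)
          have h3 : (n + 1) * (e + 1) ≤ n * (e + 1) :=
            (Nat.mul_le_mul_right _ hcon).trans (this.trans hsum)
          nlinarith
        obtain ⟨T, hT1, hT2, hT3⟩ := Finset.exists_subsuperset_card_eq h1 h2 hc.le
        have hT0 : ∀ i ∈ T, w i ≠ 0 := fun i hi => by simpa using hT2 hi
        refine ⟨T, hT3.le, hT0, fun i hi => hT1 (by simp [hi]), ?_⟩
        have h4 : ∑ i, (w i - if i ∈ T then 1 else 0) + ∑ i, (if i ∈ T then 1 else 0) = ∑ i, w i := by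
          rw [← Finset.sum_add_distrib]
          refine Finset.sum_congr rfl fun i _ => ?_
          by_cases hi : i ∈ T
          · have := hT0 i hi
            simp only [hi, if_true]; omega
          · simp [hi]
        have h5 : ∑ i, (if i ∈ T then 1 else 0) = n := by
          rw [← hT3]; simp
        rw [h5] at h4
        rw [mul_add, mul_one] at hsum
        omega
    obtain ⟨T, hT1, hT2, hT3, hT4⟩ := key
    have hsT : s ∉ T := fun h => hT2 s h hws
    obtain ⟨l, hl1, hl2, hl3⟩ := hp T s hsT hT1
    obtain ⟨h, hh1, hh2⟩ := ih (fun i => w i - if i ∈ T then 1 else 0) (by simp [hws])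
      (fun i => by
        have h1 := hwe i
        have h2 := hT3 i
        by_cases hi : i ∈ T
        · simp only [hi, if_true]; omega
        · simp only [hi, if_false]
          have : w i ≠ e + 1 := fun h => hi (h2 h)
          omega) hT4
    refine ⟨h * l, ⟨hh1.1.mul hl1, fun i => ?_⟩, by simp [hh2, hl3]⟩
    have h1 := hh1.2 i
    by_cases hi : i ∈ T
    · have h2 := Van.mul (p i) _ 1 h1 (show Van (p i) 1 l from ⟨hl2 i hi, fun _ => trivial⟩)
      refine Van.mono _ ?_ h2
      simp only [hi, if_true]; omega
    · have h2 := Van.mul (p i) _ 0 h1 (show Van (p i) 0 l from trivial)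
      refine Van.mono _ ?_ h2
      simp [hi]

/-- raising statement in degree `d` -/
def GG (n : ℕ) (p : ι → σ → ℂ) (d : ℕ) : Prop :=
  ∀ (m : ι → ℕ) (J : Finset ι), n + 2 ≤ J.card → ∑ i, m i < n * d →
    LS p d m ≤ ⨆ i ∈ J, LS p d (up m i)

lemma raise {n : ℕ} {p : ι → σ → ℂ} (hp : GP n p) (D e : ℕ) (hG : e ≠ 0 → GG n p D) (m : ι → ℕ)
    (s : ι) (hms : m s = D) (hsum : ∑ i, m i ≤ n * (D + e)) (N : ℕ) (c : ι → ℕ)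
    (hN : ∑ i, (m i - c i) = N) (hcm : ∀ i, c i ≤ m i) (hce : ∀ i, m i - c i ≤ e)
    (hcs : c s = D) : LS p D c ≤ (LS p (D + e) m).map (ddl (p s) e) := by
  induction N using Nat.strong_induction_on generalizing c with
  | _ N ih =>
  by_cases hle : N ≤ n * e
  · intro Q hQ
    obtain ⟨h, hh1, hh2⟩ := prodHyp hp s e (fun i => m i - c i) (by simp [hms, hcs]) hce
      (by rw [hN]; exact hle)
    have hk : ((e.factorial : ℂ) * eval (p s) h) ≠ 0 :=
      mul_ne_zero (by exact_mod_cast Nat.factorial_ne_zero e) hh2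
    refine ⟨((e.factorial : ℂ) * eval (p s) h)⁻¹ • (Q * h), ?_, ?_⟩
    · refine Submodule.smul_mem _ _ ⟨hQ.1.mul hh1.1, fun i => ?_⟩
      refine Van.mono _ ?_ (Van.mul (p i) _ _ (hQ.2 i) (hh1.2 i))
      have := hcm i
      show m i ≤ c i + (m i - c i)
      omega
    · rw [map_smul, ddl_apply, dd_iter_mul (p s) e, dd_iter_const (p s) e hh1.1, mul_comm Q,
        ← smul_eq_C_mul, smul_smul, inv_mul_cancel₀ hk, one_smul]
      refine dd_eq_zero (p s) D hQ.1 ?_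
      have := hQ.2 s
      rwa [hcs] at this
  · push Not at hle
    have he : e ≠ 0 := by
      rintro rfl
      have : ∑ i, (m i - c i) = 0 := Finset.sum_eq_zero fun i _ => Nat.le_zero.mp (hce i)
      omega
    set A : Finset ι := Finset.univ.filter fun i => c i < m i with hA
    have hsA : s ∉ A := by simp [hA, hms, hcs]
    have hAcard : n + 1 ≤ A.card := by
      by_contra hcon
      push Not at hcon
      have h1 : ∑ i, (m i - c i) ≤ ∑ i, if i ∈ A then e else 0 := by
        refine Finset.sum_le_sum fun i _ => ?_
        by_cases hi : i ∈ A
        · simp only [hi, if_true]; exact hce i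
        · simp only [hi, if_false]
          have : ¬ c i < m i := by simpa [hA] using hi
          omega
      rw [Finset.sum_ite_mem, Finset.univ_inter, Finset.sum_const, smul_eq_mul] at h1
      have h2 : A.card * e ≤ n * e := Nat.mul_le_mul_right _ (by omega)
      omega
    have hcsum : ∑ i, c i < n * D := by
      have h1 : ∑ i, (m i - c i) + ∑ i, c i = ∑ i, m i := by
        rw [← Finset.sum_add_distrib]
        exact Finset.sum_congr rfl fun i _ => Nat.sub_add_cancel (hcm i)
      rw [mul_add] at hsum
      omega
    refine (hG he c (insert s A) (by rw [Finset.card_insert_of_notMem hsA]; omega) hcsum).trans ?_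
    refine iSup₂_le fun i hi => ?_
    by_cases his : i = s
    · subst his
      rw [LS_eq_bot p D _ i (by rw [up_self, hcs]; omega)]
      exact bot_le
    · have hiA : i ∈ A := by
        rcases Finset.mem_insert.mp hi with h | h
        · exact absurd h his
        · exact h
      have hlt : c i < m i := by simpa [hA] using hiA
      have hup : ∀ j, c j ≤ up c i j := le_up c i
      have hupm : ∀ j, up c i j ≤ m j := fun j => by
        by_cases hj : j = i
        · subst hj; rw [up_self]; omega
        · rw [up_ne c hj]; exact hcm j
      refine ih (∑ j, (m j - up c i j)) ?_ (up c i) rfl hupm ?_ ?_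
      · rw [← hN]
        refine Finset.sum_lt_sum (fun j _ => by have := hup j; omega) ⟨i, Finset.mem_univ i, ?_⟩
        rw [up_self]; omega
      · intro j
        have := hup j
        have := hce j
        omega
      · rw [up_ne c (fun h => his h.symm), hcs]

lemma surj_of_GG {n : ℕ} {p : ι → σ → ℂ} (hp : GP n p) (d : ℕ) (m : ι → ℕ) (s : ι)
    (hG : m s < d → GG n p (m s)) (hs : m s ≤ d) (hsum : ∑ i, m i ≤ n * d) :
    LS p (m s) (red d m s) ≤ (LS p d m).map (ddl (p s) (d - m s)) := by
  have hd : m s + (d - m s) = d := by omega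
  have := raise hp (m s) (d - m s) (fun h => hG (by omega)) m s rfl (by rw [hd]; exact hsum) _
    (red d m s) rfl (fun i => ?_) (fun i => ?_) (red_self d m s)
  · rwa [hd] at this
  · by_cases h : i = s
    · subst h; simp [red_self]
    · rw [red_ne d m h]; omega
  · by_cases h : i = s
    · subst h; simp [red_self]
    · rw [red_ne d m h]; omega

lemma red_sum (d : ℕ) (m : ι → ℕ) (s : ι) (A : Finset ι) (hsA : s ∉ A)
    (hA : ∀ i ∈ A, d - m s ≤ m i) :
    ∑ i, red d m s i + A.card * (d - m s) ≤ ∑ i, m i := by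
  have : A.card * (d - m s) = ∑ i, if i ∈ A then (d - m s) else 0 := by
    rw [Finset.sum_ite_mem, Finset.univ_inter, Finset.sum_const, smul_eq_mul]
  rw [this, ← Finset.sum_add_distrib]
  refine Finset.sum_le_sum fun i _ => ?_
  by_cases hi : i = s
  · subst hi; simp [red_self, hsA]
  · rw [red_ne d m hi]
    by_cases hiA : i ∈ A
    · have := hA i hiA
      simp only [hiA, if_true]; omega
    · simp [hiA]

lemma GG_all {n : ℕ} {p : ι → σ → ℂ} (hp : GP n p) (d : ℕ) : GG n p d := by
  induction d using Nat.strong_induction_on with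
  | _ d ih =>
  intro m J hJ hsum
  obtain ⟨j, hjJ, hjd⟩ : ∃ j ∈ J, m j < d := by
    by_contra hcon
    push Not at hcon
    have h1 : J.card * d ≤ ∑ i ∈ J, m i := by
      rw [← smul_eq_mul, ← Finset.sum_const]
      exact Finset.sum_le_sum hcon
    have h2 : ∑ i ∈ J, m i ≤ ∑ i, m i := Finset.sum_le_sum_of_subset (Finset.subset_univ _)
    have h3 : n * d ≤ J.card * d := Nat.mul_le_mul_right _ (by omega)
    omega
  have hS : ∀ i, i ≠ j → LS p (m j) (red d (up m i) j) ≤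
      (LS p d (up m i)).map (ddl (p j) (d - m j)) := by
    intro i hij
    have hj : up m i j = m j := up_ne m (fun h => hij h.symm)
    have := surj_of_GG hp d (up m i) j (fun _ => by rw [hj]; exact ih _ hjd) (by rw [hj]; exact hjd.le)
      (by rw [sum_up]; omega)
    rwa [hj] at this
  have hup_le : ∀ i ∈ J, LS p d (up m i) ≤ ⨆ i ∈ J, LS p d (up m i) :=
    fun i hi => le_iSup₂_of_le i hi le_rfl
  have key : LS p (m j) (red d m j) ≤
      (⨆ i ∈ J, LS p d (up m i)).map (ddl (p j) (d - m j)) := by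
    by_cases hex : ∃ i ∈ J, i ≠ j ∧ m i + m j < d
    · obtain ⟨i, hiJ, hij, hlt⟩ := hex
      have hr : red d (up m i) j = red d m j := by
        funext k
        have hj : up m i j = m j := up_ne m (fun h => hij h.symm)
        by_cases hk : k = j
        · subst hk; rw [red_self, red_self, hj]
        · rw [red_ne _ _ hk, red_ne _ _ hk, hj]
          by_cases hki : k = i
          · subst hki; rw [up_self]; omega
          · rw [up_ne m hki]
      rw [← hr]
      exact (hS i hij).trans (Submodule.map_mono (hup_le i hiJ))
    · push Not at hex
      have hcard : (J.erase j).card = J.card - 1 := Finset.card_erase_of_mem hjJ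
      have h1 := red_sum d m j (J.erase j) (by simp) (fun i hi => by
        have := hex i (Finset.mem_of_mem_erase hi) (Finset.ne_of_mem_erase hi)
        omega)
      have h2 : n * (d - m j) ≤ (J.erase j).card * (d - m j) := Nat.mul_le_mul_right _ (by omega)
      have h3 : n * d = n * m j + n * (d - m j) := by rw [← mul_add]; congr 1; omega
      refine (ih (m j) hjd (red d m j) J hJ (by omega)).trans ?_
      refine iSup₂_le fun i hi => ?_
      by_cases hij : i = j
      · subst hij
        rw [LS_eq_bot p (m i) _ i (by rw [up_self, red_self]; omega)]
        exact bot_le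
      · have hr : up (red d m j) i = red d (up m i) j := by
          funext k
          have hj : up m i j = m j := up_ne m (fun h => hij h.symm)
          by_cases hk : k = j
          · subst hk; rw [red_self, hj, up_ne _ (fun h => hij h.symm), red_self]
          · rw [red_ne _ _ hk, hj]
            by_cases hki : k = i
            · subst hki
              have := hex k hi hij
              rw [up_self, up_self, red_ne _ _ hk]; omega
            · rw [up_ne _ hki, up_ne _ hki, red_ne _ _ hk]
        rw [hr]
        exact (hS i hij).trans (Submodule.map_mono (hup_le i hi))
  intro P hP
  obtain ⟨Q, hQ, hQP⟩ := key (ddl_mem p d m j hjd.le hP)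
  have hQm : Q ∈ LS p d m := by
    have : (⨆ i ∈ J, LS p d (up m i)) ≤ LS p d m := iSup₂_le fun i _ => LS_mono p d (le_up m i)
    exact this hQ
  have hPQ : P - Q ∈ LS p d (up m j) := by
    rw [mem_up_iff p d m j hjd.le (Submodule.sub_mem _ hP hQm), map_sub, hQP, sub_self]
  have : P = (P - Q) + Q := by ring
  rw [this]
  exact Submodule.add_mem _ (hup_le j hjJ hPQ) hQ

lemma surj {n : ℕ} {p : ι → σ → ℂ} (hp : GP n p) (d : ℕ) (m : ι → ℕ) (s : ι)
    (hs : m s ≤ d) (hsum : ∑ i, m i ≤ n * d) :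
    LS p (m s) (red d m s) ≤ (LS p d m).map (ddl (p s) (d - m s)) :=
  surj_of_GG hp d m s (fun _ => GG_all hp _) hs hsum

instance LS_fin (p : ι → σ → ℂ) (d : ℕ) (m : ι → ℕ) : FiniteDimensional ℂ (LS p d m) := by
  have h : FiniteDimensional ℂ (homogeneousSubmodule σ ℂ d) :=
    Module.Finite.iff_fg.mpr (homogeneousSubmodule_fg σ ℂ d)
  exact Submodule.finiteDimensional_of_le (S₂ := homogeneousSubmodule σ ℂ d) (fun P hP => hP.1)

lemma finrank_rec {n : ℕ} {p : ι → σ → ℂ} (hp : GP n p) (d : ℕ) (m : ι → ℕ) (s : ι)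
    (hs : m s ≤ d) (hsum : ∑ i, m i ≤ n * d) :
    Module.finrank ℂ (LS p d m) = Module.finrank ℂ (LS p d (up m s)) +
      Module.finrank ℂ (LS p (m s) (red d m s)) := by
  set f := (ddl (p s) (d - m s)).domRestrict (LS p d m) with hf
  have h1 : LinearMap.range f = LS p (m s) (red d m s) := by
    rw [hf, LinearMap.range_domRestrict]
    refine le_antisymm ?_ (surj hp d m s hs hsum)
    rintro _ ⟨P, hP, rfl⟩
    exact ddl_mem p d m s hs hP
  have h2 : (LinearMap.ker f).map (LS p d m).subtype = LS p d (up m s) := by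
    ext P
    constructor
    · rintro ⟨⟨Q, hQ⟩, hQ0, rfl⟩
      exact (mem_up_iff p d m s hs hQ).2 hQ0
    · intro hP
      have hPm := LS_mono p d (le_up m s) hP
      exact ⟨⟨P, hPm⟩, (mem_up_iff p d m s hs hPm).1 hP, rfl⟩
  have h3 := LinearMap.finrank_range_add_finrank_ker f
  rw [h1] at h3
  have h4 : Module.finrank ℂ (LinearMap.ker f) = Module.finrank ℂ (LS p d (up m s)) := by
    rw [← h2]
    exact (LinearEquiv.finrank_eq (Submodule.equivMapOfInjective _
      (Submodule.injective_subtype _) _))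
  omega

lemma Cb_zero {n x : ℤ} (h : x < n) : Cb x n = 0 := by
  unfold Cb
  rw [if_neg]
  omega

/-- the expected formula in terms of the exponents `a` -/
def BB (n : ℕ) (d : ℤ) (a : ι → ℤ) : ℤ :=
  ∑ I : Finset ι, (-1 : ℤ) ^ I.card * Cb ((n : ℤ) + d - ∑ i ∈ I, a i) n

lemma BB_split (n : ℕ) (d : ℤ) (a : ι → ℤ) (s : ι) :
    BB n d a = ∑ I ∈ (Finset.univ.erase s).powerset, (-1 : ℤ) ^ I.card *
      (Cb ((n : ℤ) + d - ∑ i ∈ I, a i) n - Cb ((n : ℤ) + d - a s - ∑ i ∈ I, a i) n) := by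
  have h := Finset.sum_powerset_insert (Finset.notMem_erase s Finset.univ)
    (fun I : Finset ι => (-1 : ℤ) ^ I.card * Cb ((n : ℤ) + d - ∑ i ∈ I, a i) n)
  rw [Finset.insert_erase (Finset.mem_univ s), Finset.powerset_univ] at h
  rw [BB, h, ← Finset.sum_add_distrib]
  refine Finset.sum_congr rfl fun I hI => ?_
  have hsI : s ∉ I := fun hs => Finset.notMem_erase s _ (Finset.mem_powerset.mp hI hs)
  rw [Finset.card_insert_of_notMem hsI, Finset.sum_insert hsI, pow_succ,
    show (n : ℤ) + d - (a s + ∑ i ∈ I, a i) = (n : ℤ) + d - a s - ∑ i ∈ I, a i by ring]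
  ring

lemma BB_rec (n : ℕ) (d : ℕ) (m : ι → ℕ) (s : ι) (hm : ∀ i, m i ≤ d) :
    BB n d (fun i => (d : ℤ) + 1 - m i) = BB n d (fun i => (d : ℤ) + 1 - up m s i) +
      BB n (m s) (fun i => (m s : ℤ) + 1 - red d m s i) := by
  rw [BB_split _ _ _ s, BB_split _ _ _ s, BB_split _ _ _ s, ← Finset.sum_add_distrib]
  refine Finset.sum_congr rfl fun I hI => ?_
  have hsI : s ∉ I := fun hs => Finset.notMem_erase s _ (Finset.mem_powerset.mp hI hs)
  rw [← mul_add]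
  congr 1
  have hs := hm s
  have h1 : ∑ i ∈ I, ((d : ℤ) + 1 - up m s i) = ∑ i ∈ I, ((d : ℤ) + 1 - m i) :=
    Finset.sum_congr rfl fun i hi => by
      have his : i ≠ s := fun h => hsI (h ▸ hi)
      rw [up_ne m his]
  rw [h1, up_self, red_self]
  set A := ∑ i ∈ I, ((d : ℤ) + 1 - m i) with hA
  set A' := ∑ i ∈ I, ((m s : ℤ) + 1 - red d m s i) with hA'
  have hred : ∀ i ∈ I, red d m s i = m i - (d - m s) := fun i hi =>
    red_ne d m (fun h => hsI (h ▸ hi))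
  have key : A = A' ∨ ((m s : ℤ) + 1 ≤ A ∧ (m s : ℤ) + 1 ≤ A') := by
    by_cases hall : ∀ i ∈ I, d - m s ≤ m i
    · left
      refine Finset.sum_congr rfl fun i hi => ?_
      rw [hred i hi]
      have := hall i hi
      omega
    · right
      push Not at hall
      obtain ⟨j, hj, hjlt⟩ := hall
      constructor
      · have h2 : ((d : ℤ) + 1 - m j) ≤ A :=
          Finset.single_le_sum (f := fun i => ((d : ℤ) + 1 - m i))
            (fun i _ => by have := hm i; show (0 : ℤ) ≤ _; omega) hj
        omega
      · have h2 : ((m s : ℤ) + 1 - red d m s j) ≤ A' :=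
          Finset.single_le_sum (f := fun i => ((m s : ℤ) + 1 - red d m s i))
            (fun i hi => by have := hm i; show (0 : ℤ) ≤ _; rw [hred i hi]; omega) hj
        rw [hred j hj] at h2
        omega
  push_cast
  rw [show (n : ℤ) + d - ((d : ℤ) + 1 - (m s + 1)) - A = n + m s - A by ring,
    show (n : ℤ) + d - ((d : ℤ) + 1 - m s) - A = n + m s - 1 - A by ring,
    show (n : ℤ) + m s - ((m s : ℤ) + 1 - m s) - A' = n + m s - 1 - A' by ring]
  rcases key with h | ⟨h2, h3⟩
  · rw [h]; ring
  · rw [Cb_zero (x := n + m s - A) (by omega), Cb_zero (x := n + m s - A') (by omega),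
      Cb_zero (x := n + m s - 1 - A) (by omega), Cb_zero (x := n + m s - 1 - A') (by omega)]
    ring

lemma BB_base (n d : ℕ) : BB n d (fun _ : ι => (d : ℤ) + 1) = ((n + d).choose n : ℤ) := by
  rw [BB, Finset.sum_eq_single ∅]
  · simp only [Finset.card_empty, pow_zero, Finset.sum_empty, sub_zero, one_mul, Cb]
    rw [if_pos (by omega)]
    congr 2
  · intro I _ hI
    have h1 : 1 ≤ I.card := Finset.card_pos.mpr (Finset.nonempty_iff_ne_empty.mpr hI)
    rw [Finset.sum_const, nsmul_eq_mul, Cb_zero, mul_zero]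
    have : (1 : ℤ) * ((d : ℤ) + 1) ≤ (I.card : ℤ) * ((d : ℤ) + 1) :=
      mul_le_mul_of_nonneg_right (by exact_mod_cast h1) (by omega)
    omega
  · intro h; exact absurd (Finset.mem_univ _) h

lemma finrank_hom (n d : ℕ) :
    Module.finrank ℂ (homogeneousSubmodule (Fin (n + 1)) ℂ d) = (n + d).choose n := by
  rw [homogeneousSubmodule_eq_finsupp_supported,
    LinearEquiv.finrank_eq (AddMonoidAlgebra.supportedEquivFinsupp (R := ℂ) (S := ℂ)
      {f : Fin (n + 1) →₀ ℕ | f.degree = d})]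
  have hset : {f : Fin (n + 1) →₀ ℕ | f.degree = d} =
      ((Finset.univ : Finset (Fin (n + 1))).finsuppAntidiag d : Set (Fin (n + 1) →₀ ℕ)) := by
    ext f
    simp [Finset.mem_finsuppAntidiag, Finsupp.degree_eq_sum]
  rw [hset]
  rw [Module.finrank_finsupp_self]
  simp only [Finset.coe_sort_coe, Fintype.card_coe]
  rw [Finset.card_finsuppAntidiag_nat_eq_choose, Finset.card_univ, Fintype.card_fin,
    show n + 1 + d - 1 = n + d by omega]
  exact (Nat.choose_symm_add).symm

lemma LS_zero (p : ι → σ → ℂ) (d : ℕ) :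
    LS p d (fun _ => 0) = homogeneousSubmodule σ ℂ d := by
  ext P
  exact ⟨fun h => h.1, fun h => ⟨h, fun _ => trivial⟩⟩

lemma red_le (d : ℕ) (m : ι → ℕ) (s : ι) (hm : ∀ i, m i ≤ d) (i : ι) : red d m s i ≤ m s := by
  by_cases h : i = s
  · subst h; simp [red_self]
  · rw [red_ne d m h]
    have := hm i
    have := hm s
    omega

lemma red_sum_le (n d : ℕ) (m : ι → ℕ) (s : ι) (hm : ∀ i, m i ≤ d) (hsum : ∑ i, m i ≤ n * d)
    (hn : 1 ≤ n) : ∑ i, red d m s i ≤ n * m s := by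
  set A : Finset ι := (Finset.univ.erase s).filter fun i => d - m s ≤ m i with hA
  have hsA : s ∉ A := by simp [hA]
  by_cases hc : n ≤ A.card
  · have h1 := red_sum d m s A hsA (fun i hi => (Finset.mem_filter.mp hi).2)
    have h2 : n * (d - m s) ≤ A.card * (d - m s) := Nat.mul_le_mul_right _ hc
    have h3 : n * d = n * m s + n * (d - m s) := by
      rw [← mul_add]; congr 1; have := hm s; omega
    omega
  · have h1 : ∑ i, red d m s i ≤ ∑ i, if i ∈ insert s A then m s else 0 := by
      refine Finset.sum_le_sum fun i _ => ?_
      by_cases hi : i ∈ insert s A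
      · rw [if_pos hi]; exact red_le d m s hm i
      · rw [if_neg hi]
        have his : i ≠ s := fun h => hi (by simp [h])
        have : ¬ (d - m s ≤ m i) := fun h => hi (Finset.mem_insert_of_mem (by
          rw [hA]; exact Finset.mem_filter.mpr ⟨Finset.mem_erase.mpr ⟨his, Finset.mem_univ _⟩, h⟩))
        rw [red_ne d m his]; omega
    rw [Finset.sum_ite_mem, Finset.univ_inter, Finset.sum_const, smul_eq_mul,
      Finset.card_insert_of_notMem hsA] at h1
    exact h1.trans (Nat.mul_le_mul_right _ (by omega))

theorem dim_formula {n : ℕ} (hn : 1 ≤ n) {p : ι → Fin (n + 1) → ℂ} (hp : GP n p) (d : ℕ) :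
    ∀ (N : ℕ) (m : ι → ℕ), ∑ i, m i = N → (∀ i, m i ≤ d) → ∑ i, m i ≤ n * d →
      (Module.finrank ℂ (LS p d m) : ℤ) = BB n d (fun i => (d : ℤ) + 1 - m i) := by
  induction d using Nat.strong_induction_on with
  | _ d ihd =>
  intro N
  induction N with
  | zero =>
    intro m hm0 _ _
    have hm : m = fun _ => 0 := by
      funext i
      exact (Finset.sum_eq_zero_iff.mp hm0) i (Finset.mem_univ i)
    subst hm
    rw [LS_zero, finrank_hom]
    simpa using (BB_base n d).symm
  | succ N ih =>
    intro m hmN hmd hsum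
    obtain ⟨s, hs⟩ : ∃ s, m s ≠ 0 := by
      by_contra hcon
      push Not at hcon
      simp [hcon] at hmN
    set m0 : ι → ℕ := Function.update m s (m s - 1) with hm0
    have hup : up m0 s = m := by
      funext i
      by_cases h : i = s
      · subst h; rw [up_self, hm0, Function.update_self]; omega
      · rw [up_ne _ h, hm0, Function.update_of_ne h]
    have hsum0 : ∑ i, m0 i + 1 = ∑ i, m i := by rw [← hup, sum_up]
    have hle0 : ∀ i, m0 i ≤ d := fun i => by
      have h1 := le_up m0 s i
      rw [hup] at h1
      exact h1.trans (hmd i)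
    have hs0 : m0 s < d := by
      have := hmd s
      rw [hm0, Function.update_self]; omega
    have h1 := finrank_rec hp d m0 s hs0.le (by omega)
    have h2 := BB_rec n d m0 s hle0
    rw [hup] at h1 h2
    have h3 := ih m0 (by omega) hle0 (by omega)
    have h4 := ihd (m0 s) hs0 _ (red d m0 s) rfl (red_le d m0 s hle0)
      (red_sum_le n d m0 s hle0 (by omega) hn)
    rw [h2, ← h4, h1] at h3
    push_cast at h3
    linarith

lemma derivAlong_cons {n : ℕ} (j : Fin (n + 1)) (D : List (Fin (n + 1)))
    (P : MvPolynomial (Fin (n + 1)) ℂ) :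
    derivAlong (j :: D) P = pderiv j (derivAlong D P) := rfl

lemma derivAlong_pderiv {n : ℕ} (j : Fin (n + 1)) (D : List (Fin (n + 1)))
    (P : MvPolynomial (Fin (n + 1)) ℂ) :
    derivAlong D (pderiv j P) = pderiv j (derivAlong D P) := by
  induction D with
  | nil => rfl
  | cons k D ih => rw [derivAlong_cons, derivAlong_cons, ih, pderiv_comm']

lemma van_iff {n : ℕ} (p : Fin (n + 1) → ℂ) (k : ℕ) (P : MvPolynomial (Fin (n + 1)) ℂ) :
    Van p k P ↔ ∀ D : List (Fin (n + 1)), D.length < k → eval p (derivAlong D P) = 0 := by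
  induction k generalizing P with
  | zero => simp [Van]
  | succ k ih =>
    constructor
    · rintro ⟨h1, h2⟩ D hD
      rcases D with _ | ⟨j, D⟩
      · exact h1
      · rw [derivAlong_cons, ← derivAlong_pderiv]
        exact (ih _).1 (h2 j) D (by simpa using hD)
    · intro h
      refine ⟨h [] (by simp), fun j => (ih _).2 fun D hD => ?_⟩
      rw [derivAlong_pderiv, ← derivAlong_cons]
      exact h _ (by simpa using hD)

lemma linSys_eq (n d s : ℕ) (m : Fin s → ℕ) (tp : Fin s → ℂ) :
    linSys n d s m tp = LS (fun i => rncPoint n (tp i)) d m := by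
  ext P
  rw [mem_LS]
  simp only [linSys, Submodule.mem_inf, mem_homogeneousSubmodule, Submodule.mem_iInf,
    LinearMap.mem_ker, van_iff]
  rfl

lemma rnc_GP (n s : ℕ) (tp : Fin s → ℂ) (htp : Function.Injective tp) :
    GP n (fun i => rncPoint n (tp i)) := by
  intro T j hj hT
  set f : Polynomial ℂ := ∏ i ∈ T, (Polynomial.X - Polynomial.C (tp i)) with hf
  have hdeg : f.natDegree < n + 1 := by
    rw [hf, Polynomial.natDegree_prod_of_monic _ _ (fun i _ => Polynomial.monic_X_sub_C _)]
    simp; omega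
  have hev : ∀ u : ℂ, eval (rncPoint n u) (∑ k : Fin (n + 1), C (f.coeff k) * X k) =
      f.eval u := by
    intro u
    rw [Polynomial.eval_eq_sum_range' hdeg, map_sum,
      ← Fin.sum_univ_eq_sum_range (fun k => f.coeff k * u ^ k)]
    refine Finset.sum_congr rfl fun k _ => ?_
    simp [rncPoint]
  refine ⟨∑ k : Fin (n + 1), C (f.coeff k) * X k, ?_, fun i hi => ?_, ?_⟩
  · refine IsHomogeneous.sum _ _ _ fun k _ => ?_
    simpa using (isHomogeneous_C _ (f.coeff k)).mul (isHomogeneous_X ℂ k)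
  · rw [hev, hf, Polynomial.eval_prod]
    exact Finset.prod_eq_zero hi (by simp)
  · rw [hev, hf, Polynomial.eval_prod]
    refine Finset.prod_ne_zero_iff.mpr fun i hi => ?_
    simp only [Polynomial.eval_sub, Polynomial.eval_X, Polynomial.eval_C]
    intro h
    have := htp (sub_eq_zero.mp h)
    exact hj (this ▸ hi)

end RNC

/-- **The case `k_C ≤ 0` (Proposition B).** If `L = L_{n,d}(m_1,…,m_s)` is effective
with `s ≥ n+3` points on a rational normal curve and `m_1+⋯+m_s ≤ nd`, then
`dim L = Σ_{I ⊆ {1,…,s}} (−1)^{|I|} C(n + k_I − |I|, n)` where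
`k_I = Σ_{i∈I} m_i − (|I|−1)d`. -/
theorem stmt_2 (n d s : ℕ) (hn : 2 ≤ n) (hs : n + 3 ≤ s)
    (m : Fin s → ℕ) (tp : Fin s → ℂ) (htp : Function.Injective tp)
    (heff : linSys n d s m tp ≠ ⊥)
    (hkc : (∑ i, m i) ≤ n * d) :
    (Module.finrank ℂ (linSys n d s m tp) : ℤ) =
      ∑ I : Finset (Fin s),
        (-1 : ℤ) ^ I.card *
          Cb ((n : ℤ) + ((∑ i ∈ I, (m i : ℤ)) - ((I.card : ℤ) - 1) * d) - I.card) n := by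
  have hmd : ∀ i, m i ≤ d := by
    intro i
    by_contra hcon
    push Not at hcon
    exact heff (by rw [RNC.linSys_eq]; exact RNC.LS_eq_bot _ d m i hcon)
  rw [RNC.linSys_eq, RNC.dim_formula (by omega) (RNC.rnc_GP n s tp htp) d _ m rfl hmd hkc, RNC.BB]
  refine Finset.sum_congr rfl fun I _ => ?_
  congr 2
  rw [Finset.sum_sub_distrib, Finset.sum_const, nsmul_eq_mul]
  ring

end
end

section
/- Let n ≥ 2 and s ≥ n+3, and suppose L = L_{n,d}(m_1,…,m_s) is nonzero (effective), non-redundant (m_i ≥ k_C for every i), has exceeding number ε = s−n−3, and k_C ≥ 1. Then dim L = Σ (−1)^{|I|} · F_t(n + k_{I,t} − r_{I,t} − 1, s, s−n−3, n), where the sum ranges over all integers t with 0 ≤ 2t ≤ n and all subsets I ⊆ {1,…,s} with |I| ≤ n − 2t. -/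
open Finset

noncomputable section

/-- The recursively defined function `F_t(a, s, ε, n)`. -/
def Fb : ℕ → ℤ → ℕ → ℕ → ℤ → ℤ
  | 0, a, _, _, n => Cb a n
  | (t+1), a, s, e, n =>
      if n < 0 then 0 else
      Cb a n
        + ∑ j ∈ Finset.range (t+1), Cb ((s : ℤ) - n - 4 + (j+1)) (j+1) * Cb (a + (j+1)) n
        - ∑ j ∈ Finset.range (t+1), Cb (e : ℤ) (j+1) * Fb (t - j) a s e (n - (j+1))
  termination_by t _ _ _ _ => t
  decreasing_by omega

/-- The linear form `∑ u^j X_j`. -/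
def ell (n : ℕ) (u : ℂ) : MvPolynomial (Fin (n+1)) ℂ :=
  ∑ j : Fin (n+1), MvPolynomial.C (u ^ (j : ℕ)) * MvPolynomial.X j

/-- The generic linear form `∑ X_j T^j`. -/
def ellX (n : ℕ) : Polynomial (MvPolynomial (Fin (n+1)) ℂ) :=
  ∑ j : Fin (n+1), Polynomial.C (MvPolynomial.X j) * Polynomial.X ^ (j : ℕ)

/-- Functionals of degree `d` killing the powers `ell (tp i) ^ e i`. -/
def KK {ι : Type} (n d : ℕ) (tp : ι → ℂ) (S : Finset ι) (e : ι → ℕ) :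
    Submodule ℂ (MvPolynomial (Fin (n+1)) ℂ →ₗ[ℂ] ℂ) where
  carrier := {f | (∀ q k, MvPolynomial.IsHomogeneous q k → k ≠ d → f q = 0) ∧
    ∀ i ∈ S, ∀ q, f (ell n (tp i) ^ (e i) * q) = 0}
  zero_mem' := by simp
  add_mem' := by
    rintro f g ⟨h1, h2⟩ ⟨h3, h4⟩
    refine ⟨fun q k hq hk => ?_, fun i hi q => ?_⟩
    · simp [h1 q k hq hk, h3 q k hq hk]
    · simp [h2 i hi q, h4 i hi q]
  smul_mem' := by
    rintro c f ⟨h1, h2⟩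
    refine ⟨fun q k hq hk => ?_, fun i hi q => ?_⟩
    · simp [h1 q k hq hk]
    · simp [h2 i hi q]

lemma ellX_eval (n : ℕ) (u : ℂ) : (ellX n).eval (MvPolynomial.C u) = ell n u := by
  simp only [ellX, ell, Polynomial.eval_finset_sum, Polynomial.eval_mul, Polynomial.eval_C,
    Polynomial.eval_pow, Polynomial.eval_X, map_pow]
  exact Finset.sum_congr rfl fun j _ => mul_comm _ _

lemma ellX_coeff (n : ℕ) (k : Fin (n+1)) : (ellX n).coeff k = MvPolynomial.X k := by
  simp only [ellX, Polynomial.finset_sum_coeff, Polynomial.coeff_C_mul, Polynomial.coeff_X_pow]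
  rw [Finset.sum_eq_single k]
  · simp
  · intro b _ hb
    have : (k : ℕ) ≠ b := fun h => hb (Fin.ext h.symm)
    simp [this]
  · simp

lemma ellX_natDegree (n : ℕ) : (ellX n).natDegree ≤ n := by
  refine Polynomial.natDegree_sum_le_of_forall_le _ _ fun j _ => ?_
  refine (Polynomial.natDegree_C_mul_X_pow_le _ _).trans ?_
  omega

lemma ell_homog (n : ℕ) (u : ℂ) : (ell n u).IsHomogeneous 1 := by
  refine MvPolynomial.IsHomogeneous.sum _ _ _ fun j _ => ?_
  exact MvPolynomial.isHomogeneous_C_mul_X _ _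

lemma ell_pow_homog (n : ℕ) (u : ℂ) (a : ℕ) : (ell n u ^ a).IsHomogeneous a := by
  simpa using (ell_homog n u).pow a

section lift
variable {A : Type} [CommRing A] [Algebra ℂ A]

/-- Coefficientwise application of a functional. -/
def plift (f : A →ₗ[ℂ] ℂ) (p : Polynomial A) : Polynomial ℂ :=
  p.sum fun i a => Polynomial.monomial i (f a)

lemma plift_coeff (f : A →ₗ[ℂ] ℂ) (p : Polynomial A) (i : ℕ) :
    (plift f p).coeff i = f (p.coeff i) := by
  simp only [plift, Polynomial.sum_def, Polynomial.finset_sum_coeff, Polynomial.coeff_monomial]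
  rw [Finset.sum_ite_eq' p.support i]
  split_ifs with h
  · rfl
  · rw [Polynomial.notMem_support_iff.mp h, map_zero]

lemma plift_add (f : A →ₗ[ℂ] ℂ) (p q : Polynomial A) :
    plift f (p + q) = plift f p + plift f q := by
  ext i; simp [plift_coeff]

lemma plift_zero (f : A →ₗ[ℂ] ℂ) : plift f 0 = 0 := by
  ext i; simp [plift_coeff]

lemma plift_sum {κ : Type} (f : A →ₗ[ℂ] ℂ) (s : Finset κ) (p : κ → Polynomial A) :
    plift f (∑ k ∈ s, p k) = ∑ k ∈ s, plift f (p k) := by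
  ext i; simp [plift_coeff]

lemma plift_nsmul (f : A →ₗ[ℂ] ℂ) (k : ℕ) (p : Polynomial A) :
    plift f ((k : Polynomial A) * p) = (k : Polynomial ℂ) * plift f p := by
  ext i
  rw [← nsmul_eq_mul, ← nsmul_eq_mul]
  simp [plift_coeff, -nsmul_eq_mul]

lemma plift_X_sub_mul (f : A →ₗ[ℂ] ℂ) (v : ℂ) (p : Polynomial A) :
    plift f ((Polynomial.X - Polynomial.C (algebraMap ℂ A v)) * p) =
      (Polynomial.X - Polynomial.C v) * plift f p := by
  ext i
  rw [plift_coeff, sub_mul, sub_mul, Polynomial.coeff_sub, Polynomial.coeff_sub, map_sub,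
    Polynomial.coeff_C_mul, Polynomial.coeff_C_mul, plift_coeff, ← Algebra.smul_def, map_smul,
    smul_eq_mul]
  cases i with
  | zero => simp
  | succ i => rw [Polynomial.coeff_X_mul, Polynomial.coeff_X_mul, plift_coeff]

lemma plift_X_sub_pow_mul (f : A →ₗ[ℂ] ℂ) (v : ℂ) (k : ℕ) (p : Polynomial A) :
    plift f ((Polynomial.X - Polynomial.C (algebraMap ℂ A v)) ^ k * p) =
      (Polynomial.X - Polynomial.C v) ^ k * plift f p := by
  induction k with
  | zero => simp
  | succ k ih => rw [pow_succ', mul_assoc, plift_X_sub_mul, ih, pow_succ', mul_assoc]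

lemma plift_eval (f : A →ₗ[ℂ] ℂ) (p : Polynomial A) (c : ℂ) :
    (plift f p).eval c = f (p.eval (algebraMap ℂ A c)) := by
  induction p using Polynomial.induction_on' with
  | add p q hp hq => rw [plift_add, Polynomial.eval_add, hp, hq, Polynomial.eval_add, map_add]
  | monomial k a =>
    have : plift f (Polynomial.monomial k a) = Polynomial.monomial k (f a) := by
      ext i
      rw [plift_coeff, Polynomial.coeff_monomial, Polynomial.coeff_monomial]
      split_ifs <;> simp
    rw [this, Polynomial.eval_monomial, Polynomial.eval_monomial, ← map_pow, mul_comm a,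
      ← Algebra.smul_def, map_smul, smul_eq_mul, mul_comm]

lemma plift_derivative (f : A →ₗ[ℂ] ℂ) (p : Polynomial A) :
    Polynomial.derivative (plift f p) = plift f (Polynomial.derivative p) := by
  ext i
  rw [Polynomial.coeff_derivative, plift_coeff, plift_coeff, Polynomial.coeff_derivative]
  have : p.coeff (i+1) * ((i : A) + 1) = ((i : ℂ) + 1) • p.coeff (i+1) := by
    rw [Algebra.smul_def]; simp [mul_comm]
  rw [this, map_smul, smul_eq_mul, mul_comm]

lemma plift_natDegree (f : A →ₗ[ℂ] ℂ) (p : Polynomial A) :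
    (plift f p).natDegree ≤ p.natDegree := by
  rw [Polynomial.natDegree_le_iff_coeff_eq_zero]
  intro N hN
  rw [plift_coeff, Polynomial.coeff_eq_zero_of_natDegree_lt hN, map_zero]

lemma plift_eq_zero_of_infinite (f : A →ₗ[ℂ] ℂ) (p : Polynomial A) (B : Set ℂ) (hB : B.Infinite)
    (h : ∀ c ∈ B, f (p.eval (algebraMap ℂ A c)) = 0) : plift f p = 0 := by
  refine Polynomial.eq_zero_of_infinite_isRoot _ (hB.mono fun c hc => ?_)
  show (plift f p).eval c = 0
  rw [plift_eval, h c hc]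

/-- a power of `p` times anything is divisible to the expected order -/
lemma plift_dvd (f : A →ₗ[ℂ] ℂ) (p : Polynomial A) (t : ℂ) (e a r : ℕ)
    (h : ∀ q, f ((p.eval (algebraMap ℂ A t)) ^ e * q) = 0) (har : e + r ≤ a + 1)
    (q : Polynomial A) :
    (Polynomial.X - Polynomial.C t) ^ r ∣ plift f (p ^ a * q) := by
  obtain ⟨g, hg⟩ := Polynomial.X_sub_C_dvd_sub_C_eval (a := algebraMap ℂ A t) (p := p)
  have hp : p = Polynomial.C (p.eval (algebraMap ℂ A t)) +
      (Polynomial.X - Polynomial.C (algebraMap ℂ A t)) * g := by rw [← hg]; ring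
  set w := p.eval (algebraMap ℂ A t) with hw
  rw [hp, add_pow, Finset.sum_mul, plift_sum]
  refine Finset.dvd_sum fun b hb => ?_
  have hb' : b ≤ a := by simpa [Nat.lt_succ_iff] using hb
  by_cases hbe : e ≤ b
  · have : plift f (Polynomial.C w ^ b * ((Polynomial.X - Polynomial.C (algebraMap ℂ A t)) * g)
        ^ (a - b) * ((a.choose b : ℕ) : Polynomial A) * q) = 0 := by
      ext i
      obtain ⟨b', rfl⟩ := Nat.exists_eq_add_of_le hbe
      rw [plift_coeff, pow_add, ← map_pow, mul_assoc, mul_assoc, mul_assoc,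
        Polynomial.coeff_C_mul, h]
      simp
    rw [this]; exact dvd_zero _
  · have hr : r ≤ a - b := by omega
    obtain ⟨r', hr'⟩ := Nat.exists_eq_add_of_le hr
    have : Polynomial.C w ^ b * ((Polynomial.X - Polynomial.C (algebraMap ℂ A t)) * g)
        ^ (a - b) * ((a.choose b : ℕ) : Polynomial A) * q =
        (Polynomial.X - Polynomial.C (algebraMap ℂ A t)) ^ r *
        (Polynomial.C w ^ b * (Polynomial.X - Polynomial.C (algebraMap ℂ A t)) ^ r' * g ^ (a - b) *
          ((a.choose b : ℕ) : Polynomial A) * q) := by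
      rw [mul_pow, hr', pow_add]; ring
    rw [this, plift_X_sub_pow_mul]
    exact dvd_mul_right _ _

/-- Counting roots. -/
lemma poly_eq_zero_of_roots {κ : Type} (s : Finset κ) (x : κ → ℂ) (hx : Set.InjOn x s)
    (μ : κ → ℕ) (p : Polynomial ℂ) (h : ∀ k ∈ s, (Polynomial.X - Polynomial.C (x k)) ^ μ k ∣ p)
    (N : ℕ) (hN : p.natDegree ≤ N) (hs : N < ∑ k ∈ s, μ k) : p = 0 := by
  by_contra hp
  have hd : (∏ k ∈ s, (Polynomial.X - Polynomial.C (x k)) ^ μ k) ∣ p := by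
    refine Finset.prod_dvd_of_coprime (fun i hi j hj hij => ?_) h
    refine IsCoprime.pow ?_
    refine Polynomial.isCoprime_X_sub_C_of_isUnit_sub ?_
    rw [isUnit_iff_ne_zero, sub_ne_zero]
    exact fun hh => hij (hx hi hj hh)
  have := Polynomial.natDegree_le_of_dvd hd hp
  rw [Polynomial.natDegree_prod_of_monic _ _ fun k _ => (Polynomial.monic_X_sub_C _).pow _] at this
  simp at this
  omega

end lift

lemma functional_X_eq_zero {n : ℕ} (f : MvPolynomial (Fin (n+1)) ℂ →ₗ[ℂ] ℂ) (B : Set ℂ)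
    (hB : B.Infinite) (h : ∀ v ∈ B, f (ell n v) = 0) (k : Fin (n+1)) :
    f (MvPolynomial.X k) = 0 := by
  have := plift_eq_zero_of_infinite f (ellX n) B hB (fun c hc => by
    rw [MvPolynomial.algebraMap_eq, ellX_eval, h c hc])
  rw [← ellX_coeff, ← plift_coeff, this, Polynomial.coeff_zero]


lemma deg_gt {n d : ℕ} (f : MvPolynomial (Fin (n+1)) ℂ →ₗ[ℂ] ℂ)
    (hd : ∀ q k, MvPolynomial.IsHomogeneous q k → k ≠ d → f q = 0)
    (p : MvPolynomial (Fin (n+1)) ℂ) (a : ℕ) (hp : p.IsHomogeneous a) (ha : d < a)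
    (q : MvPolynomial (Fin (n+1)) ℂ) : f (p * q) = 0 := by
  rw [← MvPolynomial.sum_homogeneousComponent q, Finset.mul_sum, map_sum]
  refine Finset.sum_eq_zero fun i _ => ?_
  exact hd _ (a + i) (hp.mul (MvPolynomial.homogeneousComponent_isHomogeneous i q)) (by omega)

lemma func_zero {n : ℕ} (f : MvPolynomial (Fin (n+1)) ℂ →ₗ[ℂ] ℂ) (B : Set ℂ)
    (hB : B.Infinite) (h1 : f 1 = 0) (h : ∀ v ∈ B, ∀ q, f (ell n v * q) = 0)
    (q : MvPolynomial (Fin (n+1)) ℂ) : f q = 0 := by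
  induction q using MvPolynomial.induction_on with
  | C c =>
    rw [← mul_one (MvPolynomial.C c), ← MvPolynomial.smul_eq_C_mul, map_smul, h1, smul_zero]
  | add p q hp hq => rw [map_add, hp, hq, add_zero]
  | mul_X p k _ =>
    have := functional_X_eq_zero (f ∘ₗ LinearMap.mulLeft ℂ p) B hB (fun v hv => by
      simp only [LinearMap.comp_apply, LinearMap.mulLeft_apply]
      rw [mul_comm, h v hv]) k
    simpa using this

lemma poly_taylor {A : Type} [CommRing A] (p : Polynomial A) (c : A) :
    ∃ h : Polynomial A, Polynomial.C (p.eval c) = p +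
      Polynomial.derivative p * (Polynomial.C c - Polynomial.X) +
      h * (Polynomial.C c - Polynomial.X) ^ 2 := by
  obtain ⟨k, hk⟩ := Polynomial.binomExpansion (p.map Polynomial.C) Polynomial.X
    (Polynomial.C c - Polynomial.X)
  refine ⟨k, ?_⟩
  rw [add_sub_cancel, Polynomial.derivative_map] at hk
  simp only [Polynomial.eval_map, Polynomial.eval₂_C_X, Polynomial.eval₂_at_apply] at hk
  exact hk

lemma plift_deriv_zero {A : Type} [CommRing A] [Algebra ℂ A] (f : A →ₗ[ℂ] ℂ) (L : Polynomial A)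
    (a : ℕ) (h : ∀ p, plift f (L ^ (a+1) * p) = 0) (p : Polynomial A) :
    plift f (L ^ a * Polynomial.derivative L * p) = 0 := by
  have h1 := plift_derivative f (L ^ (a+1) * p)
  rw [h, Polynomial.derivative_zero, Polynomial.derivative_mul, plift_add, h, add_zero,
    Polynomial.derivative_pow] at h1
  have h2 : (Polynomial.C ((a + 1 : ℕ) : A)) * L ^ (a + 1 - 1) * Polynomial.derivative L * p
    = ((a + 1 : ℕ) : Polynomial A) * (L ^ a * Polynomial.derivative L * p) := by
    simp; ring
  rw [h2, plift_nsmul] at h1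
  have h3 : ((a + 1 : ℕ) : Polynomial ℂ) ≠ 0 := by exact_mod_cast Nat.succ_ne_zero a
  exact (mul_eq_zero.mp h1.symm).resolve_left h3

lemma plift_sq_dvd {n : ℕ} (f : MvPolynomial (Fin (n+1)) ℂ →ₗ[ℂ] ℂ) (a : ℕ)
    (h : ∀ u q, f (ell n u ^ (a+1) * q) = 0) (v : ℂ) (Q : MvPolynomial (Fin (n+1)) ℂ) :
    (Polynomial.X - Polynomial.C v) ^ 2 ∣ plift f (ellX n ^ a * Polynomial.C (ell n v * Q)) := by
  have h1 : ∀ p, plift f (ellX n ^ (a+1) * p) = 0 := fun p =>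
    plift_eq_zero_of_infinite f _ Set.univ Set.infinite_univ fun c _ => by
      rw [Polynomial.eval_mul, Polynomial.eval_pow, MvPolynomial.algebraMap_eq, ellX_eval, h]
  have h2 := plift_deriv_zero f (ellX n) a h1
  obtain ⟨k, hk⟩ := poly_taylor (ellX n) (MvPolynomial.C v)
  rw [ellX_eval] at hk
  have h3 : ellX n ^ a * Polynomial.C (ell n v * Q) =
      ellX n ^ (a+1) * Polynomial.C Q + (ellX n ^ a * Polynomial.derivative (ellX n) *
        ((Polynomial.C (MvPolynomial.C v) - Polynomial.X) * Polynomial.C Q) +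
      (Polynomial.X - Polynomial.C (algebraMap ℂ _ v)) ^ 2 * (ellX n ^ a * k * Polynomial.C Q)) := by
    rw [map_mul, hk, MvPolynomial.algebraMap_eq]; ring
  rw [h3, plift_add, plift_add, h1, h2, zero_add, zero_add, plift_X_sub_pow_mul]
  exact dvd_mul_right _ _

lemma KL {ι : Type} {n d : ℕ} {tp : ι → ℂ} (htp : Function.Injective tp) {S : Finset ι} {e : ι → ℕ}
    {f : MvPolynomial (Fin (n+1)) ℂ →ₗ[ℂ] ℂ} (hf : f ∈ KK n d tp S e) (F : ℕ)
    (hF : ∀ a, F ≤ a → a ≤ d → n * a < 2 * (d - a) + ∑ i ∈ S, (a + 1 - e i)) :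
    ∀ a, F ≤ a → ∀ u q, f (ell n u ^ a * q) = 0 := by
  obtain ⟨hd, hS⟩ := hf
  have hgt : ∀ a, d < a → ∀ u q, f (ell n u ^ a * q) = 0 := fun a ha u q =>
    deg_gt f hd _ a (ell_pow_homog n u a) ha q
  have main : ∀ b a, F ≤ a → a + b = d + 1 → ∀ u q, f (ell n u ^ a * q) = 0 := by
    intro b
    induction b with
    | zero => intro a _ hb; exact hgt a (by omega)
    | succ b ih =>
      intro a ha hab
      have H := ih (a+1) (by omega) (by omega)
      classical
      have P : ∀ k r, r + k = d - a → ∀ Vs : Finset ℂ, Disjoint Vs (S.image tp) → Vs.card = r →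
          ∀ u q, f (ell n u ^ a * ((∏ v ∈ Vs, ell n v) * q)) = 0 := by
        intro k
        induction k with
        | zero =>
          intro r hr Vs hV hc u q
          have hz : plift f (ellX n ^ a * Polynomial.C ((∏ v ∈ Vs, ell n v) * q)) = 0 := by
            refine poly_eq_zero_of_roots (Finset.disjSum Vs S) (Sum.elim id tp) ?_
              (Sum.elim (fun _ => 2) (fun i => a + 1 - e i)) _ ?_ (n * a) ?_ ?_
            · rintro (v | i) hx (w | j) hy hxy
              · simpa using hxy
              · simp at hx hy hxy
                exact absurd (Finset.mem_image_of_mem tp hy)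
                  (Finset.disjoint_left.mp hV (hxy ▸ hx))
              · simp at hx hy hxy
                exact absurd (Finset.mem_image_of_mem tp hx)
                  (Finset.disjoint_left.mp hV (hxy ▸ hy))
              · simp at hxy
                rw [htp hxy]
            · rintro (v | i) hx
              · simp at hx
                simp only [Sum.elim_inl, id]
                rw [← Finset.mul_prod_erase Vs _ hx, mul_assoc]
                exact plift_sq_dvd f a H v _
              · simp at hx
                simp only [Sum.elim_inr]
                by_cases hle : e i ≤ a + 1
                · refine plift_dvd f (ellX n) (tp i) (e i) a (a + 1 - e i) ?_ (by omega) _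
                  intro q
                  rw [MvPolynomial.algebraMap_eq, ellX_eval]
                  exact hS i hx q
                · rw [Nat.sub_eq_zero_of_le (by omega), pow_zero]
                  exact one_dvd _
            · refine (plift_natDegree _ _).trans ?_
              refine Polynomial.natDegree_mul_le.trans ?_
              rw [Polynomial.natDegree_C, add_zero]
              refine Polynomial.natDegree_pow_le.trans ?_
              rw [mul_comm n a]
              exact Nat.mul_le_mul_left _ (ellX_natDegree n)
            · rw [Finset.sum_disjSum]
              simp only [Sum.elim_inl, Sum.elim_inr, Finset.sum_const, hc, smul_eq_mul]
              have := hF a ha (by omega)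
              have : r = d - a := by omega
              subst this
              omega
          have := plift_eval f (ellX n ^ a * Polynomial.C ((∏ v ∈ Vs, ell n v) * q)) u
          rw [hz, Polynomial.eval_zero, Polynomial.eval_mul, Polynomial.eval_pow,
            Polynomial.eval_C, MvPolynomial.algebraMap_eq, ellX_eval] at this
          exact this.symm
        | succ k ihk =>
          intro r hr Vs hV hc u q
          have := func_zero (f ∘ₗ LinearMap.mulLeft ℂ (ell n u ^ a * ∏ v ∈ Vs, ell n v))
            (↑(Vs ∪ S.image tp))ᶜ (Finset.finite_toSet _).infinite_compl ?_ ?_ q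
          · simpa [mul_assoc] using this
          · simp only [LinearMap.comp_apply, LinearMap.mulLeft_apply, mul_one]
            refine hd _ (a + r) ((ell_pow_homog n u a).mul ?_) (by omega)
            have := MvPolynomial.IsHomogeneous.prod Vs (fun v => ell n v) (fun _ => 1)
              (fun v _ => ell_homog n v)
            simpa [hc] using this
          · intro v hv q
            simp only [Finset.coe_union, Set.mem_compl_iff, Set.mem_union, not_or,
              Finset.mem_coe] at hv
            have := ihk (r+1) (by omega) (insert v Vs)
              (by rw [Finset.disjoint_insert_left]; exact ⟨hv.2, hV⟩)
              (by rw [Finset.card_insert_of_notMem hv.1, hc]) u q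
            rw [Finset.prod_insert hv.1] at this
            simp only [LinearMap.comp_apply, LinearMap.mulLeft_apply]
            rw [← this]; congr 1; ring
      intro u q
      have := P (d - a) 0 (by omega) ∅ (by simp) rfl u q
      simpa using this
  intro a ha
  by_cases h : a ≤ d
  · exact main (d + 1 - a) a ha (by omega)
  · exact hgt a (by omega)

/-- The numerical hypothesis. -/
lemma KL_num {ι : Type} {n d D F η : ℕ} {S : Finset ι} {e : ι → ℕ} (hc : S.card = D + n + 2)
    (hs : ∑ i ∈ S, e i + η = D * (F + 1) + 2 * d + n + 1) :
    ∀ a, F ≤ a → a ≤ d → n * a < 2 * (d - a) + ∑ i ∈ S, (a + 1 - e i) := by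
  intro a ha had
  have h1 : ∑ i ∈ S, (a + 1) ≤ ∑ i ∈ S, (a + 1 - e i) + ∑ i ∈ S, e i := by
    rw [← Finset.sum_add_distrib]
    exact Finset.sum_le_sum fun i _ => by omega
  rw [Finset.sum_const, hc, smul_eq_mul] at h1
  obtain ⟨b, rfl⟩ := Nat.exists_eq_add_of_le had
  obtain ⟨g, rfl⟩ := Nat.exists_eq_add_of_le ha
  rw [Nat.add_sub_cancel_left]
  have : 0 ≤ D * g := Nat.zero_le _
  nlinarith

lemma KL' {ι : Type} {n d D F η : ℕ} {tp : ι → ℂ} (htp : Function.Injective tp) {S : Finset ι}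
    {e : ι → ℕ} (hc : S.card = D + n + 2)
    (hs : ∑ i ∈ S, e i + η = D * (F + 1) + 2 * d + n + 1)
    {f : MvPolynomial (Fin (n+1)) ℂ →ₗ[ℂ] ℂ} (hf : f ∈ KK n d tp S e) :
    ∀ u q, f (ell n u ^ F * q) = 0 := KL htp hf F (KL_num hc hs) F le_rfl

lemma KK_bot {ι : Type} {n d : ℕ} {tp : ι → ℂ} (htp : Function.Injective tp) {S : Finset ι}
    {e : ι → ℕ} (hc : S.card = n + 2)
    (hs : ∑ i ∈ S, e i = 2 * d + n + 1) : KK n d tp S e = ⊥ := by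
  rw [eq_bot_iff]
  intro f hf
  have := KL' (D := 0) (F := 0) (η := 0) htp (by omega) (by omega) hf 0
  rw [Submodule.mem_bot]
  exact LinearMap.ext fun q => by simpa using this q


lemma func_eq_zero {n d : ℕ} (f : MvPolynomial (Fin (n+1)) ℂ →ₗ[ℂ] ℂ)
    (hd : ∀ q k, MvPolynomial.IsHomogeneous q k → k ≠ d → f q = 0)
    (h : ∀ q, MvPolynomial.IsHomogeneous q d → f q = 0) : f = 0 := by
  refine LinearMap.ext fun q => ?_
  rw [← MvPolynomial.sum_homogeneousComponent q, map_sum]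
  refine Finset.sum_eq_zero fun i _ => ?_
  by_cases hi : i = d
  · subst hi
    exact h _ (MvPolynomial.homogeneousComponent_isHomogeneous i q)
  · exact hd _ i (MvPolynomial.homogeneousComponent_isHomogeneous i q) hi

instance KK_finite {ι : Type} (n d : ℕ) (tp : ι → ℂ) (S : Finset ι) (e : ι → ℕ) :
    Module.Finite ℂ (KK n d tp S e) := by
  have hfg : Module.Finite ℂ (MvPolynomial.homogeneousSubmodule (Fin (n+1)) ℂ d) :=
    Module.Finite.iff_fg.mpr (MvPolynomial.homogeneousSubmodule_fg ..)
  let T : KK n d tp S e →ₗ[ℂ] Module.Dual ℂ (MvPolynomial.homogeneousSubmodule (Fin (n+1)) ℂ d) :=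
    (LinearMap.lcomp ℂ ℂ (MvPolynomial.homogeneousSubmodule (Fin (n+1)) ℂ d).subtype) ∘ₗ
      (KK n d tp S e).subtype
  refine Module.Finite.of_injective T ?_
  rw [← LinearMap.ker_eq_bot, eq_bot_iff]
  rintro ⟨f, hf⟩ h
  rw [Submodule.mem_bot, Submodule.mk_eq_zero]
  refine func_eq_zero f hf.1 fun q hq => ?_
  have := LinearMap.congr_fun (LinearMap.mem_ker.mp h) ⟨q, hq⟩
  simpa [T] using this

/-- The algebra map adjoint to projection from the point with parameter `t`. -/
def sig (n : ℕ) (t : ℂ) : MvPolynomial (Fin (n+1)) ℂ →ₐ[ℂ] MvPolynomial (Fin (n+1+1)) ℂ :=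
  MvPolynomial.aeval fun j => ∑ k : Fin (n+2), if (j : ℕ) < k then
    MvPolynomial.C (t ^ ((k : ℕ) - 1 - j)) * MvPolynomial.X k else 0

lemma sig_homog (n : ℕ) (t : ℂ) (q : MvPolynomial (Fin (n+1)) ℂ) (k : ℕ)
    (hq : q.IsHomogeneous k) : (sig n t q).IsHomogeneous k := by
  have := MvPolynomial.IsHomogeneous.aeval hq (fun j : Fin (n+1) => ∑ k : Fin (n+2),
    if (j : ℕ) < k then
    MvPolynomial.C (t ^ ((k : ℕ) - 1 - j)) * (MvPolynomial.X k : MvPolynomial (Fin (n+2)) ℂ) else 0)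
    (n := 1) ?_
  · simpa [sig] using this
  · intro j
    refine MvPolynomial.IsHomogeneous.sum _ _ _ fun k _ => ?_
    split_ifs
    · exact MvPolynomial.isHomogeneous_C_mul_X _ _
    · exact MvPolynomial.isHomogeneous_zero _ _ _

lemma ellX_step (n : ℕ) (t : ℂ) : ellX (n+1) = Polynomial.C (ell (n+1) t) +
    (Polynomial.X - Polynomial.C (MvPolynomial.C t)) *
      (ellX n).map (sig n t : MvPolynomial (Fin (n+1)) ℂ →+* MvPolynomial (Fin (n+1+1)) ℂ) := by
  have h1 : (ellX n).map (sig n t : MvPolynomial (Fin (n+1)) ℂ →+* MvPolynomial (Fin (n+1+1)) ℂ) =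
      ∑ k : Fin (n+2), Polynomial.C (MvPolynomial.X k) *
        ∑ j ∈ Finset.range k, Polynomial.X ^ j *
          (Polynomial.C (MvPolynomial.C t)) ^ ((k : ℕ) - 1 - j) := by
    have h2 : ∀ k : Fin (n+2), ∑ j ∈ Finset.range k, (Polynomial.X ^ j *
          (Polynomial.C (MvPolynomial.C t)) ^ ((k : ℕ) - 1 - j) :
            Polynomial (MvPolynomial (Fin (n+2)) ℂ)) =
        ∑ j : Fin (n+1), if (j : ℕ) < k then (Polynomial.X ^ (j : ℕ) *
          (Polynomial.C (MvPolynomial.C t)) ^ ((k : ℕ) - 1 - j)) else 0 := by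
      intro k
      rw [Fin.sum_univ_eq_sum_range (fun j => if j < (k : ℕ) then (Polynomial.X ^ j *
          (Polynomial.C (MvPolynomial.C t)) ^ ((k : ℕ) - 1 - j) :
            Polynomial (MvPolynomial (Fin (n+2)) ℂ)) else 0) (n+1), ← Finset.sum_filter]
      refine Finset.sum_congr ?_ fun _ _ => rfl
      ext j; simp only [Finset.mem_range, Finset.mem_filter]; have := k.2; omega
    simp only [h2, Finset.mul_sum]
    rw [Finset.sum_comm]
    rw [ellX, Polynomial.map_sum]
    refine Finset.sum_congr rfl fun j _ => ?_
    rw [Polynomial.map_mul, Polynomial.map_C, Polynomial.map_pow, Polynomial.map_X]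
    simp only [sig, RingHom.coe_coe, MvPolynomial.aeval_X, map_sum, Finset.sum_mul]
    refine Finset.sum_congr rfl fun k _ => ?_
    split_ifs
    · simp only [map_mul, map_pow]; ring
    · simp
  rw [h1, Finset.mul_sum]
  have h3 : ∀ k : Fin (n+2), (Polynomial.X - Polynomial.C (MvPolynomial.C t)) *
      (Polynomial.C (MvPolynomial.X k) *
        ∑ j ∈ Finset.range k, Polynomial.X ^ j *
          (Polynomial.C (MvPolynomial.C t)) ^ ((k : ℕ) - 1 - j)) =
      Polynomial.C (MvPolynomial.X k) * Polynomial.X ^ (k : ℕ) -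
      (Polynomial.C (MvPolynomial.C (t ^ (k : ℕ)) * MvPolynomial.X k) :
            Polynomial (MvPolynomial (Fin (n+2)) ℂ)) := by
    intro k
    have := geom_sum₂_mul (Polynomial.X : Polynomial (MvPolynomial (Fin (n+2)) ℂ))
      (Polynomial.C (MvPolynomial.C t)) k
    calc _ = Polynomial.C (MvPolynomial.X k) * ((∑ j ∈ Finset.range k, Polynomial.X ^ j *
          (Polynomial.C (MvPolynomial.C t)) ^ ((k : ℕ) - 1 - j)) *
            (Polynomial.X - Polynomial.C (MvPolynomial.C t))) := by ring
      _ = _ := by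
        rw [this]; simp only [map_mul, map_pow]; ring
  simp only [h3, Finset.sum_sub_distrib]
  rw [ell, map_sum, ellX]
  ring

lemma sig_C (n : ℕ) (t c : ℂ) : sig n t (MvPolynomial.C c) = MvPolynomial.C c := by
  simp [sig]

lemma ellX_map_eval (n : ℕ) (t u : ℂ) :
    ((ellX n).map (sig n t : MvPolynomial (Fin (n+1)) ℂ →+* MvPolynomial (Fin (n+1+1)) ℂ)).eval
      (MvPolynomial.C u) = sig n t (ell n u) := by
  rw [← ellX_eval, Polynomial.eval_map, ← sig_C n t u]
  exact Polynomial.eval₂_at_apply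
    (sig n t : MvPolynomial (Fin (n+1)) ℂ →+* MvPolynomial (Fin (n+1+1)) ℂ) _

lemma ell_step (n : ℕ) (t u : ℂ) : MvPolynomial.C (u - t) * sig n t (ell n u) =
    ell (n+1) u - ell (n+1) t := by
  have := congrArg (Polynomial.eval (MvPolynomial.C u)) (ellX_step n t)
  rw [Polynomial.eval_add, Polynomial.eval_mul, ellX_map_eval, ellX_eval] at this
  rw [this]
  simp

lemma sig_surj (n : ℕ) (t : ℂ) (q : MvPolynomial (Fin (n+1+1)) ℂ) :
    ∃ q1 q2, q = sig n t q1 + ell (n+1) t * q2 := by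
  induction q using MvPolynomial.induction_on with
  | C c => exact ⟨MvPolynomial.C c, 0, by rw [sig_C]; simp⟩
  | add p q hp hq =>
    obtain ⟨a, b, rfl⟩ := hp
    obtain ⟨a', b', rfl⟩ := hq
    exact ⟨a + a', b + b', by rw [map_add]; ring⟩
  | mul_X p k hp =>
    obtain ⟨a, b, rfl⟩ := hp
    have hk : ∃ y c, (MvPolynomial.X k : MvPolynomial (Fin (n+1+1)) ℂ) =
        sig n t y + ell (n+1) t * c := by
      have h := congrArg (fun p => Polynomial.coeff p (k : ℕ)) (ellX_step n t)
      simp only [ellX_coeff] at h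
      rw [Polynomial.coeff_add, sub_mul, Polynomial.coeff_sub, Polynomial.coeff_C_mul,
        Polynomial.coeff_map] at h
      rcases hk : (k : ℕ) with _ | j
      · rw [hk] at h
        refine ⟨- (MvPolynomial.C t * (ellX n).coeff 0), 1, ?_⟩
        rw [h, map_neg, map_mul, sig_C]
        simp
        ring
      · rw [hk, Polynomial.coeff_X_mul, Polynomial.coeff_map, Polynomial.coeff_C_ne_zero (by omega)] at h
        refine ⟨(ellX n).coeff j - MvPolynomial.C t * (ellX n).coeff (j+1), 0, ?_⟩
        rw [h, map_sub, map_mul, sig_C]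
        simp
    obtain ⟨y, c, hyc⟩ := hk
    refine ⟨a * y, b * MvPolynomial.X k + sig n t a * c, ?_⟩
    rw [map_mul]
    linear_combination (sig n t a) * hyc

lemma plift_extract {A : Type} [CommRing A] [Algebra ℂ A] (f : A →ₗ[ℂ] ℂ) (w q : A)
    (g : Polynomial A) (t : ℂ) (e F : ℕ) (heF : e ≤ F) (h : ∀ q, f (w ^ (e+1) * q) = 0)
    (hz : plift f ((Polynomial.C w + (Polynomial.X - Polynomial.C (algebraMap ℂ A t)) * g) ^ F *
      Polynomial.C q) = 0) :
    f (w ^ e * ((g.eval (algebraMap ℂ A t)) ^ (F - e) * q)) = 0 := by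
  rw [add_pow, Finset.sum_mul, plift_sum] at hz
  have h1 : ∀ b ∈ Finset.range (F+1), b ∉ Finset.range (e+1) →
      plift f (Polynomial.C w ^ b * ((Polynomial.X - Polynomial.C (algebraMap ℂ A t)) * g)
        ^ (F - b) * ((F.choose b : ℕ) : Polynomial A) * Polynomial.C q) = 0 := by
    intro b _ hb
    have hb' : e + 1 ≤ b := by simpa using hb
    ext i
    obtain ⟨b', rfl⟩ := Nat.exists_eq_add_of_le hb'
    rw [plift_coeff, pow_add, ← map_pow, mul_assoc, mul_assoc, mul_assoc,
      Polynomial.coeff_C_mul, h]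
    simp
  rw [← Finset.sum_subset (Finset.range_mono (by omega)) h1] at hz
  have h2 : ∀ b ∈ Finset.range (e+1),
      plift f (Polynomial.C w ^ b * ((Polynomial.X - Polynomial.C (algebraMap ℂ A t)) * g)
        ^ (F - b) * ((F.choose b : ℕ) : Polynomial A) * Polynomial.C q) =
      (Polynomial.X - Polynomial.C t) ^ (F - e) * ((Polynomial.X - Polynomial.C t) ^ (e - b) *
        plift f ((F.choose b : ℕ) * (Polynomial.C w ^ b * g ^ (F - b) * Polynomial.C q))) := by
    intro b hb
    have hb' : b ≤ e := by simpa [Nat.lt_succ_iff] using hb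
    rw [← mul_assoc, ← pow_add, ← plift_X_sub_pow_mul]
    congr 1
    rw [mul_pow, show F - e + (e - b) = F - b by omega]
    ring
  rw [Finset.sum_congr rfl h2, ← Finset.mul_sum] at hz
  have h3 := (mul_eq_zero.mp hz).resolve_left (pow_ne_zero _ (Polynomial.X_sub_C_ne_zero t))
  have h4 := congrArg (Polynomial.eval t) h3
  rw [Polynomial.eval_finset_sum, Finset.sum_range_succ, Finset.sum_eq_zero] at h4
  · rw [Nat.sub_self, pow_zero, one_mul, plift_nsmul, zero_add, Polynomial.eval_mul, plift_eval,
      Polynomial.eval_zero] at h4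
    have h5 : (((F.choose e : ℕ) : Polynomial ℂ).eval t) ≠ 0 := by
      simp [(Nat.choose_pos heF).ne']
    have := (mul_eq_zero.mp h4).resolve_left h5
    simpa [mul_assoc] using this
  · intro b hb
    have : 0 < e - b := by simp at hb; omega
    simp [zero_pow this.ne']

lemma STEP {ι : Type} [DecidableEq ι] {n d d' F : ℕ} {tp : ι → ℂ} (htp : Function.Injective tp)
    {S : Finset ι} {e : ι → ℕ} {s : ι} (hs : s ∈ S) (h1 : 1 ≤ e s) (h2 : e s ≤ F + 1)
    (hd' : d' + e s = d + 1)
    (hF : ∀ f ∈ KK (n+1) d tp S e, ∀ u q, f (ell (n+1) u ^ F * q) = 0) :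
    Module.finrank ℂ (KK (n+1) d tp S e) ≤
      Module.finrank ℂ (KK (n+1) d tp S (Function.update e s (e s - 1))) +
      Module.finrank ℂ (KK n d' tp S (Function.update e s (F + 1 - e s))) := by
  let T : (MvPolynomial (Fin (n+1+1)) ℂ →ₗ[ℂ] ℂ) →ₗ[ℂ] (MvPolynomial (Fin (n+1)) ℂ →ₗ[ℂ] ℂ) :=
    LinearMap.lcomp ℂ ℂ ((LinearMap.mulLeft ℂ (ell (n+1) (tp s) ^ (e s - 1))) ∘ₗ
      (sig n (tp s)).toLinearMap)
  have hT : ∀ f q, T f q = f (ell (n+1) (tp s) ^ (e s - 1) * sig n (tp s) q) := fun f q => rfl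
  let T' := T.domRestrict (KK (n+1) d tp S e)
  have hkey : ∀ f ∈ KK (n+1) d tp S e, ∀ q, f (ell (n+1) (tp s) ^ e s * q) = 0 :=
    fun f hf q => hf.2 s hs q
  rw [← LinearMap.finrank_range_add_finrank_ker T', add_comm]
  refine Nat.add_le_add ?_ ?_
  · rw [← Submodule.finrank_map_subtype_eq]
    refine Submodule.finrank_mono ?_
    rintro _ ⟨⟨f, hf⟩, hk, rfl⟩
    have hk0 : T f = 0 := hk
    refine ⟨hf.1, fun i hi q => ?_⟩
    simp only [Submodule.subtype_apply]
    by_cases his : i = s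
    · subst his
      rw [Function.update_self]
      obtain ⟨q1, q2, rfl⟩ := sig_surj n (tp i) q
      rw [mul_add, map_add, ← hT, hk0, ← mul_assoc, ← pow_succ,
        show e i - 1 + 1 = e i by omega, hkey f hf]
      simp
    · rw [Function.update_of_ne his]
      exact hf.2 i hi q
  · refine Submodule.finrank_mono ?_
    rintro _ ⟨⟨f, hf⟩, rfl⟩
    show T f ∈ _
    refine ⟨fun q k hq hk => ?_, fun i hi q => ?_⟩
    · rw [hT]
      exact hf.1 _ (e s - 1 + k) ((ell_pow_homog _ _ _).mul (sig_homog _ _ _ _ hq)) (by omega)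
    · rw [hT, map_mul (sig n (tp s)), map_pow (sig n (tp s))]
      by_cases his : i = s
      · subst his
        rw [Function.update_self]
        have hz : plift f (ellX (n+1) ^ F * Polynomial.C (sig n (tp i) q)) = 0 :=
          plift_eq_zero_of_infinite f _ Set.univ Set.infinite_univ fun c _ => by
            rw [Polynomial.eval_mul, Polynomial.eval_pow, MvPolynomial.algebraMap_eq, ellX_eval,
              hF f hf]
        rw [ellX_step n (tp i)] at hz
        have := plift_extract f (ell (n+1) (tp i)) (sig n (tp i) q) _ (tp i) (e i - 1) F (by omega)
          (by rw [show e i - 1 + 1 = e i by omega]; exact hkey f hf) hz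
        rw [MvPolynomial.algebraMap_eq, ellX_map_eval] at this
        rw [← this, show F + 1 - e i = F - (e i - 1) by omega]
      · rw [Function.update_of_ne his]
        have hne : tp i - tp s ≠ 0 := sub_ne_zero.mpr fun h => his (htp h)
        have hst := ell_step n (tp s) (tp i)
        obtain ⟨b, hb⟩ := sub_dvd_pow_sub_pow (ell (n+1) (tp i) - ell (n+1) (tp s))
          (ell (n+1) (tp i)) (e i)
        have hp : MvPolynomial.C ((tp i - tp s) ^ e i) * sig n (tp s) (ell n (tp i)) ^ e i =
            ell (n+1) (tp i) ^ e i + ell (n+1) (tp s) * (-b) := by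
          rw [map_pow, ← mul_pow, hst]
          linear_combination hb
        have h0 : f (ell (n+1) (tp s) ^ (e s - 1) * ((MvPolynomial.C ((tp i - tp s) ^ e i) *
            sig n (tp s) (ell n (tp i)) ^ e i) * sig n (tp s) q)) = 0 := by
          rw [hp]
          have : ell (n+1) (tp s) ^ (e s - 1) * ((ell (n+1) (tp i) ^ e i + ell (n+1) (tp s) * (-b))
              * sig n (tp s) q) = ell (n+1) (tp i) ^ e i * (ell (n+1) (tp s) ^ (e s - 1) *
                sig n (tp s) q) + ell (n+1) (tp s) ^ e s * ((-b) * sig n (tp s) q) := by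
            rw [show ell (n+1) (tp s) ^ e s = ell (n+1) (tp s) ^ (e s - 1) * ell (n+1) (tp s) by
              rw [← pow_succ, Nat.sub_add_cancel h1]]
            ring
          rw [this, map_add, hf.2 i hi, hkey f hf, add_zero]
        rw [mul_assoc, mul_left_comm, ← MvPolynomial.smul_eq_C_mul, map_smul, smul_eq_zero] at h0
        exact h0.resolve_left (pow_ne_zero _ hne)


/-- Product of factorials of a multi-index. -/
def mfac {n : ℕ} (α : Fin (n+1) →₀ ℕ) : ℂ := ∏ i, ((α i).factorial : ℂ)

lemma mfac_ne {n : ℕ} (α : Fin (n+1) →₀ ℕ) : mfac α ≠ 0 :=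
  Finset.prod_ne_zero_iff.mpr fun i _ => by exact_mod_cast (Nat.factorial_pos _).ne'

/-- The apolarity pairing. -/
def lam (n : ℕ) : MvPolynomial (Fin (n+1)) ℂ →ₗ[ℂ] (MvPolynomial (Fin (n+1)) ℂ →ₗ[ℂ] ℂ) :=
  (MvPolynomial.basisMonomials (Fin (n+1)) ℂ).constr ℂ
    fun α => mfac α • MvPolynomial.lcoeff ℂ α

lemma lam_monomial (n : ℕ) (α : Fin (n+1) →₀ ℕ) (c : ℂ) (q : MvPolynomial (Fin (n+1)) ℂ) :
    lam n (MvPolynomial.monomial α c) q = c * (mfac α * q.coeff α) := by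
  have h : (MvPolynomial.monomial α c : MvPolynomial (Fin (n+1)) ℂ) =
      c • MvPolynomial.basisMonomials (Fin (n+1)) ℂ α := by
    rw [MvPolynomial.coe_basisMonomials, MvPolynomial.smul_monomial, smul_eq_mul, mul_one]
  rw [h, map_smul, lam, Module.Basis.constr_basis]
  simp [MvPolynomial.lcoeff]

lemma mfac_sub {n : ℕ} (α : Fin (n+1) →₀ ℕ) (k : Fin (n+1)) (hk : α k ≠ 0) :
    mfac α = α k * mfac (α - Finsupp.single k 1) := by
  have h2 : ∀ β : Fin (n+1) →₀ ℕ, mfac β = ((β k).factorial : ℂ) *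
      ∏ i ∈ Finset.univ.erase k, ((β i).factorial : ℂ) := fun β =>
    (Finset.mul_prod_erase _ _ (Finset.mem_univ k)).symm
  rw [h2, h2, ← mul_assoc]
  congr 1
  · simp only [Finsupp.coe_tsub, Pi.sub_apply, Finsupp.single_eq_same]
    exact_mod_cast (Nat.mul_factorial_pred hk).symm
  · refine Finset.prod_congr rfl fun i hi => ?_
    have : i ≠ k := Finset.ne_of_mem_erase hi
    simp [Finsupp.single_apply, this.symm]

lemma lam_X_mul (n : ℕ) (k : Fin (n+1)) (P q : MvPolynomial (Fin (n+1)) ℂ) :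
    lam n P (MvPolynomial.X k * q) = lam n (MvPolynomial.pderiv k P) q := by
  classical
  induction P using MvPolynomial.induction_on' with
  | add p q hp hq => simp only [map_add, LinearMap.add_apply, hp, hq]
  | monomial α c =>
    rw [lam_monomial, MvPolynomial.pderiv_monomial, lam_monomial, MvPolynomial.coeff_X_mul']
    by_cases hk : α k = 0
    · simp [hk]
    · rw [if_pos (by simpa using hk), mfac_sub α k hk]
      ring

lemma lam_apply_monomial (n : ℕ) (P : MvPolynomial (Fin (n+1)) ℂ) (β : Fin (n+1) →₀ ℕ) (c : ℂ) :
    lam n P (MvPolynomial.monomial β c) = c * (mfac β * P.coeff β) := by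
  classical
  induction P using MvPolynomial.induction_on' with
  | add p q hp hq =>
    rw [map_add, LinearMap.add_apply, hp, hq, MvPolynomial.coeff_add]; ring
  | monomial α b =>
    rw [lam_monomial, MvPolynomial.coeff_monomial, MvPolynomial.coeff_monomial]
    by_cases h : α = β
    · subst h; simp; ring
    · have h' : ¬ β = α := fun h2 => h h2.symm
      simp [h, h']

lemma lam_inj (n : ℕ) : Function.Injective (lam n) := by
  rw [← LinearMap.ker_eq_bot, eq_bot_iff]
  intro P hP
  rw [Submodule.mem_bot]
  ext β
  have := lam_apply_monomial n P β 1
  rw [LinearMap.mem_ker.mp hP] at this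
  simpa [mfac_ne] using this.symm

lemma lam_deg {n d : ℕ} {P : MvPolynomial (Fin (n+1)) ℂ} (hP : P.IsHomogeneous d) (q) (k : ℕ)
    (hq : MvPolynomial.IsHomogeneous q k) (hk : k ≠ d) : lam n P q = 0 := by
  rw [MvPolynomial.as_sum q, map_sum]
  refine Finset.sum_eq_zero fun β hβ => ?_
  rw [lam_apply_monomial, hP.coeff_eq_zero, mul_zero, mul_zero]
  intro h
  have := hq (MvPolynomial.mem_support_iff.mp hβ)
  rw [Finsupp.degree_eq_weight_one] at h
  exact hk (this.symm.trans h)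

lemma lam_surj {n d : ℕ} (f : MvPolynomial (Fin (n+1)) ℂ →ₗ[ℂ] ℂ)
    (hd : ∀ q k, MvPolynomial.IsHomogeneous q k → k ≠ d → f q = 0) :
    ∃ P, MvPolynomial.IsHomogeneous P d ∧ lam n P = f := by
  classical
  refine ⟨∑ α ∈ Finset.finsuppAntidiag (Finset.univ : Finset (Fin (n+1))) d,
    MvPolynomial.monomial α (f (MvPolynomial.monomial α 1) / mfac α), ?_, ?_⟩
  · refine MvPolynomial.IsHomogeneous.sum _ _ _ fun α hα => ?_
    refine MvPolynomial.isHomogeneous_monomial _ ?_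
    rw [Finset.mem_finsuppAntidiag] at hα
    rw [Finsupp.degree_eq_sum]
    exact hα.1
  · refine (MvPolynomial.basisMonomials (Fin (n+1)) ℂ).ext fun β => ?_
    rw [MvPolynomial.coe_basisMonomials, lam_apply_monomial, one_mul, MvPolynomial.coeff_sum]
    simp only [MvPolynomial.coeff_monomial]
    rw [Finset.sum_ite_eq']
    split_ifs with h
    · field_simp [mfac_ne]
    · rw [mul_zero]
      refine (hd _ β.degree (MvPolynomial.isHomogeneous_monomial _ rfl) ?_).symm
      intro h2
      apply h
      rw [Finset.mem_finsuppAntidiag]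
      rw [Finsupp.degree_eq_sum] at h2
      exact ⟨h2, Finset.subset_univ _⟩

lemma lam_ell_pow {n : ℕ} (u : ℂ) (a : ℕ) : ∀ G : MvPolynomial (Fin (n+1)) ℂ,
    G.IsHomogeneous a → lam n G (ell n u ^ a) =
      a.factorial * MvPolynomial.aeval (rncPoint n u) G := by
  induction a with
  | zero =>
    intro G hG
    rw [← MvPolynomial.totalDegree_zero_iff_isHomogeneous] at hG
    rw [MvPolynomial.totalDegree_eq_zero_iff_eq_C.mp hG, MvPolynomial.C_apply, lam_monomial]
    simp [mfac]
  | succ a ih =>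
    intro G hG
    have h1 := hG.sum_X_mul_pderiv
    have h2 : ell n u ^ (a+1) = ∑ j : Fin (n+1), (u ^ (j : ℕ)) • (MvPolynomial.X j * ell n u ^ a) := by
      rw [pow_succ']
      nth_rw 1 [ell]
      rw [Finset.sum_mul]
      refine Finset.sum_congr rfl fun j _ => ?_
      rw [MvPolynomial.smul_eq_C_mul, mul_assoc]
    rw [h2, map_sum]
    have h3 : ∀ j : Fin (n+1), lam n G ((u ^ (j : ℕ)) • (MvPolynomial.X j * ell n u ^ a)) =
        a.factorial * MvPolynomial.aeval (rncPoint n u)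
          (MvPolynomial.X j * MvPolynomial.pderiv j G) := by
      intro j
      rw [map_smul, lam_X_mul, ih _ (by simpa using hG.pderiv), map_mul, MvPolynomial.aeval_X]
      simp only [rncPoint, smul_eq_mul]; ring
    simp only [h3]
    rw [← Finset.mul_sum, ← map_sum, h1, map_nsmul, Nat.factorial_succ]
    simp only [nsmul_eq_mul]
    push_cast
    ring

lemma lam_derivAlong {n : ℕ} (D : List (Fin (n+1))) : ∀ P q : MvPolynomial (Fin (n+1)) ℂ,
    lam n (derivAlong D P) q = lam n P ((D.map MvPolynomial.X).prod * q) := by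
  induction D with
  | nil => intro P q; simp [derivAlong]
  | cons j D ih =>
    intro P q
    have : derivAlong (j :: D) P = MvPolynomial.pderiv j (derivAlong D P) := rfl
    rw [this, ← lam_X_mul, ih, List.map_cons, List.prod_cons]
    congr 1; ring

lemma derivAlong_homog {n : ℕ} (D : List (Fin (n+1))) (d : ℕ) (P : MvPolynomial (Fin (n+1)) ℂ)
    (hP : P.IsHomogeneous d) : (derivAlong D P).IsHomogeneous (d - D.length) := by
  induction D with
  | nil => simpa [derivAlong] using hP
  | cons j D ih =>
    have : derivAlong (j :: D) P = MvPolynomial.pderiv j (derivAlong D P) := rfl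
    rw [this, List.length_cons, ← Nat.sub_sub]
    exact ih.pderiv

lemma listX_homog {n : ℕ} (D : List (Fin (n+1))) :
    ((D.map MvPolynomial.X).prod : MvPolynomial (Fin (n+1)) ℂ).IsHomogeneous D.length := by
  induction D with
  | nil => simpa using MvPolynomial.isHomogeneous_one _ _
  | cons j D ih =>
    rw [List.map_cons, List.prod_cons, List.length_cons, add_comm D.length]
    exact (MvPolynomial.isHomogeneous_X _ _).mul ih

lemma func_list_zero {n : ℕ} (f : MvPolynomial (Fin (n+1)) ℂ →ₗ[ℂ] ℂ)
    (h : ∀ D : List (Fin (n+1)), f (D.map MvPolynomial.X).prod = 0) (q) : f q = 0 := by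
  suffices H : ∀ D : List (Fin (n+1)), f ((D.map MvPolynomial.X).prod * q) = 0 by
    simpa using H []
  induction q using MvPolynomial.induction_on with
  | C c =>
    intro D
    rw [mul_comm, ← MvPolynomial.smul_eq_C_mul, map_smul, h, smul_zero]
  | add p q hp hq => intro D; rw [mul_add, map_add, hp, hq, add_zero]
  | mul_X p k hp =>
    intro D
    have := hp (k :: D)
    rw [List.map_cons, List.prod_cons] at this
    rw [← this]; congr 1; ring

lemma lam_vanish {n d m : ℕ} {P : MvPolynomial (Fin (n+1)) ℂ} (hP : P.IsHomogeneous d) (u : ℂ) :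
    (∀ D : List (Fin (n+1)), D.length < m →
      MvPolynomial.aeval (rncPoint n u) (derivAlong D P) = 0) ↔
    ∀ q, lam n P (ell n u ^ (d + 1 - m) * q) = 0 := by
  constructor
  · intro h q
    refine func_list_zero (lam n P ∘ₗ LinearMap.mulLeft ℂ (ell n u ^ (d + 1 - m))) (fun D => ?_) q
    simp only [LinearMap.comp_apply, LinearMap.mulLeft_apply]
    by_cases hD : d + 1 - m + D.length = d
    · rw [mul_comm, ← lam_derivAlong]
      have := derivAlong_homog D d P hP
      rw [show d - D.length = d + 1 - m by omega] at this
      rw [lam_ell_pow u _ _ this, h D (by omega), mul_zero]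
    · exact lam_deg hP _ _ ((ell_pow_homog _ _ _).mul (listX_homog D)) hD
  · intro h D hD
    by_cases hDd : D.length ≤ d
    · have := lam_ell_pow u _ _ (derivAlong_homog D d P hP)
      obtain ⟨c, hc⟩ := Nat.exists_eq_add_of_le (show d + 1 - m ≤ d - D.length by omega)
      rw [lam_derivAlong] at this
      nth_rw 1 [hc] at this
      rw [pow_add, mul_left_comm, h] at this
      have hne : ((d - D.length).factorial : ℂ) ≠ 0 := by
        exact_mod_cast (Nat.factorial_pos _).ne'
      exact (mul_eq_zero.mp this.symm).resolve_left hne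
    · have : lam n (derivAlong D P) = 0 := by
        refine LinearMap.ext fun q => ?_
        rw [lam_derivAlong]
        exact deg_gt _ (fun q k => lam_deg hP q k) _ _ (listX_homog D) (by omega) q
      rw [lam_inj n (this.trans (map_zero _).symm), map_zero]

lemma linSys_map (n d s : ℕ) (m : Fin s → ℕ) (tp : Fin s → ℂ) :
    (linSys n d s m tp).map (lam n) = KK n d tp Finset.univ (fun i => d + 1 - m i) := by
  have hmem : ∀ P, P ∈ linSys n d s m tp ↔ P.IsHomogeneous d ∧ ∀ i, ∀ D : List (Fin (n+1)),
      D.length < m i → MvPolynomial.aeval (rncPoint n (tp i)) (derivAlong D P) = 0 := by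
    intro P
    simp only [linSys, Submodule.mem_inf, Submodule.mem_iInf, LinearMap.mem_ker,
      MvPolynomial.mem_homogeneousSubmodule]
    rfl
  ext f
  constructor
  · rintro ⟨P, hP, rfl⟩
    have hP := (hmem P).mp hP
    exact ⟨fun q k => lam_deg hP.1 q k, fun i _ => (lam_vanish hP.1 (tp i)).mp (hP.2 i)⟩
  · rintro ⟨h1, h2⟩
    obtain ⟨P, hP, rfl⟩ := lam_surj f h1
    exact ⟨P, (hmem P).mpr ⟨hP, fun i => (lam_vanish hP (tp i)).mpr (h2 i (Finset.mem_univ i))⟩, rfl⟩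

lemma finrank_map_lam (n : ℕ) (V : Submodule ℂ (MvPolynomial (Fin (n+1)) ℂ)) :
    Module.finrank ℂ (V.map (lam n)) = Module.finrank ℂ V :=
  (Submodule.equivMapOfInjective (lam n) (lam_inj n) V).finrank_eq.symm

lemma finrank_linSys (n d s : ℕ) (m : Fin s → ℕ) (tp : Fin s → ℂ) :
    Module.finrank ℂ (linSys n d s m tp) =
      Module.finrank ℂ (KK n d tp Finset.univ (fun i => d + 1 - m i)) := by
  rw [← linSys_map, finrank_map_lam]

lemma finrank_homog (n d : ℕ) :
    Module.finrank ℂ (MvPolynomial.homogeneousSubmodule (Fin (n+1)) ℂ d) = (n + d).choose n := by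
  classical
  rw [MvPolynomial.homogeneousSubmodule_eq_finsupp_supported]
  rw [(AddMonoidAlgebra.supportedEquivFinsupp (R := ℂ) (S := ℂ)
    {α : Fin (n+1) →₀ ℕ | α.degree = d}).finrank_eq]
  have hs : {α : Fin (n+1) →₀ ℕ | α.degree = d} =
      ↑(Finset.finsuppAntidiag (Finset.univ : Finset (Fin (n+1))) d) := by
    ext α
    simp [Finsupp.degree_eq_sum]
  rw [hs]
  rw [Module.finrank_finsupp_self]
  simp only [Finset.coe_sort_coe, Fintype.card_coe]
  rw [Finset.card_finsuppAntidiag_nat_eq_choose, Finset.card_univ, Fintype.card_fin,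
    show n + 1 + d - 1 = n + d by omega, Nat.choose_symm_add]

lemma finrank_KK_big {ι : Type} (n d : ℕ) (tp : ι → ℂ) (S : Finset ι) (e : ι → ℕ)
    (h : ∀ i ∈ S, d + 1 ≤ e i) : Module.finrank ℂ (KK n d tp S e) = (n + d).choose n := by
  rw [← finrank_homog n d, ← finrank_map_lam]
  have : KK n d tp S e = (MvPolynomial.homogeneousSubmodule (Fin (n+1)) ℂ d).map (lam n) := by
    ext f
    constructor
    · rintro ⟨h1, -⟩
      obtain ⟨P, hP, rfl⟩ := lam_surj f h1
      exact ⟨P, hP, rfl⟩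
    · rintro ⟨P, hP, rfl⟩
      exact ⟨fun q k => lam_deg hP q k, fun i hi q =>
        deg_gt _ (fun q k => lam_deg hP q k) _ (e i) (ell_pow_homog _ _ _) (h i hi) q⟩
  rw [this]


/-- The power series `1/(1-X^k)`. -/
def Wp (k : ℕ) : PowerSeries ℚ := (1 - PowerSeries.X ^ k)⁻¹

lemma Wp_mul (k : ℕ) (hk : 1 ≤ k) : Wp k * (1 - PowerSeries.X ^ k) = 1 := by
  refine PowerSeries.inv_mul_cancel _ ?_
  simp [zero_pow (show k ≠ 0 by omega)]

/-- The generating series. -/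
def Hs {ι : Type} (n D η F : ℕ) (S : Finset ι) (e : ι → ℕ) : PowerSeries ℚ :=
  (∏ i ∈ S, (1 - PowerSeries.X ^ e i)) * Wp 1 ^ (n+1) * Wp (F+1) ^ (D - η) * Wp F ^ η

lemma Hs_ID {ι : Type} [DecidableEq ι] (n D η F : ℕ) (S : Finset ι) (e : ι → ℕ) (i : ι) (hi : i ∈ S)
    (hF : 1 ≤ F) (h1 : 1 ≤ e i) (h2 : e i ≤ F + 1) (hη : η < D) :
    Hs (n+1) D η F S e = Hs (n+1) D (η+1) F S (Function.update e i (e i - 1)) +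
      PowerSeries.X ^ (e i - 1) * Hs n (D+1) (η+1) F S (Function.update e i (F + 1 - e i)) := by
  have hup : ∀ b, ∏ j ∈ S, (1 - PowerSeries.X ^ (Function.update e i b j) : PowerSeries ℚ) =
      (1 - PowerSeries.X ^ b) * ∏ j ∈ S.erase i, (1 - PowerSeries.X ^ e j) := by
    intro b
    rw [← Finset.mul_prod_erase _ _ hi, Function.update_self]
    congr 1
    refine Finset.prod_congr rfl fun j hj => ?_
    rw [Function.update_of_ne (Finset.ne_of_mem_erase hj)]
  have hup0 : ∏ j ∈ S, (1 - PowerSeries.X ^ (e j) : PowerSeries ℚ) =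
      (1 - PowerSeries.X ^ e i) * ∏ j ∈ S.erase i, (1 - PowerSeries.X ^ e j) :=
    (Finset.mul_prod_erase _ _ hi).symm
  obtain ⟨c, rfl⟩ := Nat.exists_eq_add_of_le (show η + 1 ≤ D by omega)
  obtain ⟨b, hb⟩ := Nat.exists_eq_add_of_le h1
  obtain ⟨g, rfl⟩ := Nat.exists_eq_add_of_le (show b ≤ F by omega)
  rw [Hs, Hs, Hs, hup, hup, hup0, show η + 1 + c - η = c + 1 by omega,
    show η + 1 + c - (η + 1) = c by omega, show η + 1 + c + 1 - (η + 1) = c + 1 by omega,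
    hb, show 1 + b - 1 = b by omega, show b + g + 1 - (1 + b) = g by omega]
  have hY := Wp_mul 1 le_rfl
  have h0 := Wp_mul _ hF
  have h1 := Wp_mul (b + g + 1) (by omega)
  set x := (PowerSeries.X : PowerSeries ℚ) ^ b
  set P := ∏ j ∈ S.erase i, (1 - PowerSeries.X ^ e j : PowerSeries ℚ)
  rw [show (PowerSeries.X : PowerSeries ℚ) ^ (b + g) = x * PowerSeries.X ^ g from pow_add _ _ _] at h0
  rw [show (PowerSeries.X : PowerSeries ℚ) ^ (b + g + 1) = x * PowerSeries.X ^ g * PowerSeries.X by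
    rw [pow_succ, pow_add]] at h1
  rw [show (PowerSeries.X : PowerSeries ℚ) ^ (1 + b) = x * PowerSeries.X by
    rw [add_comm, pow_succ]]
  rw [pow_one] at hY
  set z := (PowerSeries.X : PowerSeries ℚ) ^ g
  set X := (PowerSeries.X : PowerSeries ℚ)
  set Y := Wp 1
  set W0 := Wp (b + g)
  set W1 := Wp (b + g + 1)
  have key : (1 - x * X) * Y * W1 = (1 - x) * Y * W0 + x * (1 - z) * W0 * W1 := by
    linear_combination -(1 - x * X) * Y * W1 * h0 + (1 - x) * Y * W0 * h1 + x * (1 - z) * W0 * W1 * hY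
  linear_combination P * Y ^ (n+1) * W1 ^ c * W0 ^ η * key

/-- congruent to 1 modulo `X^(d+1)` -/
def T1 (d : ℕ) (p : PowerSeries ℚ) : Prop := ∃ h, p = 1 + PowerSeries.X ^ (d+1) * h

lemma T1.mul {d : ℕ} {p q : PowerSeries ℚ} (hp : T1 d p) (hq : T1 d q) : T1 d (p * q) := by
  obtain ⟨h, rfl⟩ := hp
  obtain ⟨k, rfl⟩ := hq
  exact ⟨h + k + PowerSeries.X ^ (d+1) * h * k, by ring⟩

lemma T1.one (d : ℕ) : T1 d 1 := ⟨0, by simp⟩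

lemma T1.pow {d : ℕ} {p : PowerSeries ℚ} (hp : T1 d p) (k : ℕ) : T1 d (p ^ k) := by
  induction k with
  | zero => simpa using T1.one d
  | succ k ih => rw [pow_succ]; exact ih.mul hp

lemma T1.prod {ι : Type} {d : ℕ} (S : Finset ι) (p : ι → PowerSeries ℚ) (h : ∀ i ∈ S, T1 d (p i)) :
    T1 d (∏ i ∈ S, p i) := Finset.prod_induction p (T1 d) (fun _ _ => T1.mul) (T1.one d) h

lemma T1.one_sub {d k : ℕ} (hk : d + 1 ≤ k) : T1 d (1 - PowerSeries.X ^ k) := by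
  obtain ⟨c, rfl⟩ := Nat.exists_eq_add_of_le hk
  exact ⟨-PowerSeries.X ^ c, by rw [pow_add]; ring⟩

lemma T1.Wp {d k : ℕ} (hk : d + 1 ≤ k) : T1 d (Wp k) := by
  obtain ⟨c, rfl⟩ := Nat.exists_eq_add_of_le hk
  have := Wp_mul (d + 1 + c) (by omega)
  refine ⟨PowerSeries.X ^ c * _root_.Wp (d + 1 + c), ?_⟩
  rw [pow_add] at this
  linear_combination this

lemma T1.coeff {d : ℕ} {p : PowerSeries ℚ} (hp : T1 d p) (q : PowerSeries ℚ) :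
    PowerSeries.coeff d (q * p) = PowerSeries.coeff d q := by
  obtain ⟨h, rfl⟩ := hp
  rw [mul_add, mul_one, map_add, mul_left_comm, PowerSeries.coeff_X_pow_mul']
  simp

lemma Wp_one_pow (n d : ℕ) : PowerSeries.coeff d (Wp 1 ^ (n+1)) = ((n + d).choose n : ℚ) := by
  have h1 : Wp 1 ^ (n+1) = PowerSeries.mk fun d => ((n + d).choose n : ℚ) := by
    have h2 := PowerSeries.mk_add_choose_mul_one_sub_pow_eq_one (S := ℚ) n
    have h3 : Wp 1 ^ (n+1) * (1 - PowerSeries.X) ^ (n+1) = 1 := by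
      rw [← mul_pow]
      have := Wp_mul 1 le_rfl
      rw [pow_one] at this
      rw [this, one_pow]
    have hne : (1 - PowerSeries.X : PowerSeries ℚ) ^ (n+1) ≠ 0 := right_ne_zero_of_mul_eq_one h3
    exact mul_right_cancel₀ hne (h3.trans h2.symm)
  rw [h1, PowerSeries.coeff_mk]

lemma Hs_big {ι : Type} (n D η F d : ℕ) (S : Finset ι) (e : ι → ℕ) (hF : d + 1 ≤ F)
    (h : ∀ i ∈ S, d + 1 ≤ e i) :
    PowerSeries.coeff d (Hs n D η F S e) = ((n + d).choose n : ℚ) := by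
  rw [Hs, (T1.Wp hF |>.pow _).coeff, (T1.Wp (show d + 1 ≤ F + 1 by omega) |>.pow _).coeff, mul_comm,
    (T1.prod S _ fun i hi => T1.one_sub (h i hi)).coeff, Wp_one_pow]

lemma Hs_zero {ι : Type} [DecidableEq ι] (n D η F : ℕ) (S : Finset ι) (e : ι → ℕ) (i : ι) (hi : i ∈ S)
    (h : e i = 0) : Hs n D η F S e = 0 := by
  rw [Hs, Finset.prod_eq_zero hi (by simp [h])]
  simp

lemma KK_zero {ι : Type} (n d : ℕ) (tp : ι → ℂ) (S : Finset ι) (e : ι → ℕ) (i : ι) (hi : i ∈ S)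
    (h : e i = 0) : Module.finrank ℂ (KK n d tp S e) = 0 := by
  have : KK n d tp S e = ⊥ := by
    rw [eq_bot_iff]
    intro f hf
    rw [Submodule.mem_bot]
    refine LinearMap.ext fun q => ?_
    have := hf.2 i hi q
    simpa [h] using this
  rw [this, finrank_bot]

/-- geometric sum -/
def gs (e : ℕ) : Polynomial ℚ := ∑ i ∈ Finset.range e, Polynomial.X ^ i

lemma gs_coe (e : ℕ) : ((gs e : Polynomial ℚ) : PowerSeries ℚ) = (1 - PowerSeries.X ^ e) * Wp 1 := by
  have h := Wp_mul 1 le_rfl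
  have h2 : ((gs e : Polynomial ℚ) : PowerSeries ℚ) * (1 - PowerSeries.X) = 1 - PowerSeries.X ^ e := by
    have := geom_sum_mul_neg (Polynomial.X : Polynomial ℚ) e
    have := congrArg (fun p : Polynomial ℚ => (p : PowerSeries ℚ)) this
    simpa [gs] using this
  rw [pow_one] at h
  linear_combination (-(gs e : PowerSeries ℚ)) * h + Wp 1 * h2

lemma gs_coeff (e i : ℕ) : (gs e).coeff i = if i < e then 1 else 0 := by
  simp [gs, Polynomial.coeff_X_pow]

lemma gs_deg (e : ℕ) : (gs e).natDegree ≤ e - 1 := by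
  rw [Polynomial.natDegree_le_iff_coeff_eq_zero]
  intro N hN
  rw [gs_coeff, if_neg (by omega)]

lemma gs_refl (e : ℕ) (he : 1 ≤ e) : Polynomial.reflect (e - 1) (gs e) = gs e := by
  ext i
  rw [Polynomial.coeff_reflect, gs_coeff, gs_coeff]
  by_cases h : i < e
  · rw [Polynomial.revAt_le (by omega), if_pos (by omega), if_pos h]
  · rw [Polynomial.revAt_eq_self_of_lt (by omega)]

lemma gs_prod {ι : Type} [DecidableEq ι] (S : Finset ι) (e : ι → ℕ) (he : ∀ i ∈ S, 1 ≤ e i) :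
    (∏ i ∈ S, gs (e i)).natDegree ≤ ∑ i ∈ S, (e i - 1) ∧
    Polynomial.reflect (∑ i ∈ S, (e i - 1)) (∏ i ∈ S, gs (e i)) = ∏ i ∈ S, gs (e i) := by
  induction S using Finset.induction_on with
  | empty => simp
  | insert a S ha ih =>
    obtain ⟨h1, h2⟩ := ih fun i hi => he i (Finset.mem_insert_of_mem hi)
    rw [Finset.prod_insert ha, Finset.sum_insert ha]
    refine ⟨Polynomial.natDegree_mul_le.trans (Nat.add_le_add (gs_deg _) h1), ?_⟩
    rw [Polynomial.reflect_mul _ _ (gs_deg _) h1, h2, gs_refl _ (he a (Finset.mem_insert_self _ _))]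

lemma coeff_bot {ι : Type} [DecidableEq ι] (n d F : ℕ) (S : Finset ι) (e : ι → ℕ)
    (hc : S.card = n + 2) (hs : ∑ i ∈ S, e i = 2 * d + n + 1) :
    PowerSeries.coeff d (Hs n 0 0 F S e) = 0 := by
  by_cases h0 : ∃ i ∈ S, e i = 0
  · obtain ⟨i, hi, h⟩ := h0
    rw [Hs_zero n 0 0 F S e i hi h, map_zero]
  · have he : ∀ i ∈ S, 1 ≤ e i := fun i hi => Nat.one_le_iff_ne_zero.mpr fun h => h0 ⟨i, hi, h⟩
    obtain ⟨h1, h2⟩ := gs_prod S e he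
    have hsum : ∑ i ∈ S, (e i - 1) + (n + 2) = 2 * d + n + 1 := by
      rw [← hs, ← hc, Finset.card_eq_sum_ones, ← Finset.sum_add_distrib]
      exact Finset.sum_congr rfl fun i hi => by have := he i hi; omega
    obtain ⟨c, rfl⟩ := Nat.exists_eq_add_of_le' (show 1 ≤ d by omega)
    have hH : Hs n 0 0 F S e = (1 - PowerSeries.X) * ((∏ i ∈ S, gs (e i) : Polynomial ℚ) : PowerSeries ℚ) := by
      have : ((∏ i ∈ S, gs (e i) : Polynomial ℚ) : PowerSeries ℚ) =
          (∏ i ∈ S, (1 - PowerSeries.X ^ e i)) * Wp 1 ^ (n+2) := by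
        rw [← hc, ← Finset.prod_const, ← Finset.prod_mul_distrib]
        simp only [← gs_coe]
        exact map_prod (Polynomial.coeToPowerSeries.ringHom (R := ℚ)) _ _
      rw [this, Hs]
      have h := Wp_mul 1 le_rfl
      rw [pow_one] at h
      simp only [Nat.sub_zero, pow_zero, mul_one]
      linear_combination (-(∏ i ∈ S, (1 - PowerSeries.X ^ e i)) * Wp 1 ^ (n+1)) * h
    rw [hH, sub_mul, one_mul, map_sub, PowerSeries.coeff_succ_X_mul, Polynomial.coeff_coe,
      Polynomial.coeff_coe, sub_eq_zero]
    conv_rhs => rw [← h2]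
    rw [Polynomial.coeff_reflect, Polynomial.revAt_le (by omega)]
    congr 1
    omega


/-- Numerical configuration. -/
def Cfg {ι : Type} (n D η F d : ℕ) (S : Finset ι) (e : ι → ℕ) : Prop :=
  S.card = D + n + 2 ∧ η + 1 ≤ D ∧ ∑ i ∈ S, e i + η = D * (F + 1) + 2 * d + n + 1 ∧
    ∀ i ∈ S, e i ≤ F

lemma sum_upd {ι : Type} [DecidableEq ι] (S : Finset ι) (e : ι → ℕ) (i : ι) (hi : i ∈ S) (b : ℕ) :
    ∑ j ∈ S, Function.update e i b j + e i = ∑ j ∈ S, e j + b := by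
  have h1 : e i + ∑ j ∈ S.erase i, e j = ∑ j ∈ S, e j := Finset.add_sum_erase S e hi
  have h2 : Function.update e i b i + ∑ j ∈ S.erase i, Function.update e i b j
      = ∑ j ∈ S, Function.update e i b j := Finset.add_sum_erase S (Function.update e i b) hi
  have h3 : ∑ j ∈ S.erase i, Function.update e i b j = ∑ j ∈ S.erase i, e j :=
    Finset.sum_congr rfl fun j hj => Function.update_of_ne (Finset.ne_of_mem_erase hj) b e
  rw [Function.update_self] at h2
  omega

lemma KK_mono_of_le {ι : Type} {n d : ℕ} {tp : ι → ℂ} {S S' : Finset ι} {e e' : ι → ℕ}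
    (h : KK n d tp S e ≤ KK n d tp S' e') :
    Module.finrank ℂ (KK n d tp S e) ≤ Module.finrank ℂ (KK n d tp S' e') :=
  Submodule.finrank_mono h

lemma upper_base {ι : Type} [DecidableEq ι] {D η F d : ℕ} {tp : ι → ℂ}
    {S : Finset ι} {e : ι → ℕ} (hC : Cfg 0 D η F d S e) :
    (Module.finrank ℂ (KK 0 d tp S e) : ℚ) ≤ PowerSeries.coeff d (Hs 0 D η F S e) := by
  obtain ⟨hc, hη, hs, hle⟩ := hC
  by_cases h : ∀ i ∈ S, d + 1 ≤ e i
  · have hF : d + 1 ≤ F := by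
      have : S.Nonempty := Finset.card_pos.mp (by omega)
      obtain ⟨i, hi⟩ := this
      exact (h i hi).trans (hle i hi)
    rw [Hs_big _ _ _ _ _ _ _ hF h, finrank_KK_big 0 d tp S e h]
  · push Not at h
    obtain ⟨i, hi, hid⟩ := h
    have hbot : KK 0 d tp S e = ⊥ := by
      rw [eq_bot_iff]
      intro f hf
      rw [Submodule.mem_bot]
      have hell : ∀ u, ell 0 u = MvPolynomial.X 0 := by intro u; simp [ell]
      refine func_eq_zero f hf.1 fun q hq => ?_
      refine func_list_zero (f := f) (fun L => ?_) q
      have hL : (L.map (MvPolynomial.X (R := ℂ) (σ := Fin (0+1)))).prod =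
          MvPolynomial.X 0 ^ L.length := by
        induction L with
        | nil => simp
        | cons j L ih =>
          rw [List.map_cons, List.prod_cons, ih, List.length_cons, pow_succ']
          congr 2
          exact Fin.ext (by omega)
      by_cases hLd : L.length = d
      · rw [hL, hLd, ← Nat.add_sub_cancel' (show e i ≤ d by omega), pow_add, ← hell (tp i)]
        exact hf.2 i hi _
      · exact hf.1 _ _ (listX_homog L) hLd
    have hj : ∀ j ∈ S.erase i, d + 1 ≤ e j := by
      intro j hj
      have h1 := Finset.add_sum_erase S e hi
      have h2 := Finset.add_sum_erase _ e hj
      have h3 : ∑ x ∈ (S.erase i).erase j, e x ≤ ((S.erase i).erase j).card * F := by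
        rw [← smul_eq_mul]
        exact Finset.sum_le_card_nsmul _ _ _ fun x hx =>
          hle x (Finset.mem_of_mem_erase (Finset.mem_of_mem_erase hx))
      rw [Finset.card_erase_of_mem hj, Finset.card_erase_of_mem hi, hc,
        show D + 0 + 2 - 1 - 1 = D by omega] at h3
      have : D * (F + 1) = D * F + D := by ring
      omega
    have hF : d + 1 ≤ F := by
      have : (S.erase i).Nonempty := Finset.card_pos.mp (by
        rw [Finset.card_erase_of_mem hi]; omega)
      obtain ⟨j, hj'⟩ := this
      exact (hj j hj').trans (hle j (Finset.mem_of_mem_erase hj'))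
    rw [hbot, finrank_bot, Hs, (T1.Wp hF |>.pow _).coeff,
      (T1.Wp (show d + 1 ≤ F + 1 by omega) |>.pow _).coeff, ← Finset.mul_prod_erase _ _ hi,
      mul_right_comm, (T1.prod _ _ fun j hj' => T1.one_sub (hj j hj')).coeff, zero_add, pow_one,
      ← gs_coe, Polynomial.coeff_coe, gs_coeff]
    split_ifs <;> simp

lemma Cfg_step {ι : Type} [DecidableEq ι] {n D η F d d' : ℕ}
    {S : Finset ι} {e : ι → ℕ} (hC : S.card = D + (n+1) + 2) (hη : η + 1 ≤ D)
    (hs : ∑ i ∈ S, e i + η = D * (F + 1) + 2 * d + (n + 1) + 1) {i : ι} (hi : i ∈ S)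
    (h1 : 1 ≤ e i) (h2 : e i ≤ F + 1) (hle : ∀ j ∈ S, j ≠ i → e j ≤ F)
    (hd' : d' + e i = d + 1) :
    Cfg n (D+1) (η+1) F d' S (Function.update e i (F + 1 - e i)) := by
  refine ⟨by omega, by omega, ?_, ?_⟩
  · have := sum_upd S e i hi (F + 1 - e i)
    have h3 : (D + 1) * (F + 1) = D * (F + 1) + (F + 1) := by ring
    omega
  · intro j hj
    by_cases hji : j = i
    · subst hji; rw [Function.update_self]; omega
    · rw [Function.update_of_ne hji]; exact hle j hj hji

lemma upper_aux {ι : Type} [DecidableEq ι] {n : ℕ} {tp : ι → ℂ} (htp : Function.Injective tp)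
    (ihn : ∀ (D η F d : ℕ) (S : Finset ι) (e : ι → ℕ), Cfg n D η F d S e →
      (Module.finrank ℂ (KK n d tp S e) : ℚ) ≤ PowerSeries.coeff d (Hs n D η F S e)) :
    ∀ (N D η F d : ℕ) (S : Finset ι) (e : ι → ℕ), ∑ i ∈ S, e i = N → Cfg (n+1) D η F d S e →
      (Module.finrank ℂ (KK (n+1) d tp S e) : ℚ) ≤
        PowerSeries.coeff d (Hs (n+1) D η F S e) := by
  intro N
  induction N using Nat.strong_induction_on with
  | _ N ih =>
  intro D η F d S e hN hC
  have hC0 := hC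
  obtain ⟨hc, hη, hs, hle⟩ := hC
  by_cases h0 : ∃ i ∈ S, e i = 0
  · obtain ⟨i, hi, h⟩ := h0
    rw [Hs_zero _ _ _ _ S e i hi h, KK_zero _ d tp S e i hi h, map_zero, Nat.cast_zero]
  have he : ∀ i ∈ S, 1 ≤ e i := fun i hi => Nat.one_le_iff_ne_zero.mpr fun h => h0 ⟨i, hi, h⟩
  obtain ⟨i, hi⟩ : S.Nonempty := Finset.card_pos.mp (by omega)
  have hei := he i hi
  have hFi := hle i hi
  rw [Hs_ID n D η F S e i hi (by omega) hei (by omega) (by omega), map_add]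
  set e' := Function.update e i (e i - 1) with he'
  have hsum' : ∑ j ∈ S, e' j + 1 = ∑ j ∈ S, e j := by
    have := sum_upd S e i hi (e i - 1); rw [← he'] at this; omega
  have hle' : ∀ j ∈ S, e' j ≤ F := by
    intro j hj
    by_cases hji : j = i
    · subst hji; rw [he', Function.update_self]; omega
    · rw [he', Function.update_of_ne hji]; exact hle j hj
  have hmain : (Module.finrank ℂ (KK (n+1) d tp S e') : ℚ) ≤
      PowerSeries.coeff d (Hs (n+1) D (η+1) F S e') := by
    by_cases hηD : η + 1 < D
    · exact ih (N - 1) (by omega) D (η+1) F d S e' (by omega) ⟨hc, by omega, by omega, hle'⟩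
    · have hηD : η + 1 = D := by omega
      obtain ⟨G, rfl⟩ := Nat.exists_eq_add_of_le' (show 1 ≤ F by omega)
      set R := S.filter (fun j => e' j = G + 1) with hR
      have hsumR : ∑ j ∈ S, e' j = D * (G + 1) + 2 * d + n + 2 := by
        have : D * (G + 1 + 1) = D * (G + 1) + D := by ring
        omega
      have drop : ∀ R' ⊆ R, ∀ r, R'.card = r → r ≤ D →
          (Module.finrank ℂ (KK (n+1) d tp S e') ≤ Module.finrank ℂ (KK (n+1) d tp (S \ R') e')) ∧
          (S \ R').card = (D - r) + (n + 1) + 2 ∧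
          ∑ j ∈ S \ R', e' j = (D - r) * (G + 1) + 2 * d + (n + 1) + 1 ∧
          Hs (n+1) D (η+1) (G+1) S e' = Hs (n+1) (D - r) 0 G (S \ R') e' := by
        intro R' hR' r hr hrD
        have hR'S : R' ⊆ S := hR'.trans (Finset.filter_subset _ _)
        have hR'e : ∀ j ∈ R', e' j = G + 1 := fun j hj => (Finset.mem_filter.mp (hR' hj)).2
        obtain ⟨c, rfl⟩ := Nat.exists_eq_add_of_le hrD
        refine ⟨?_, ?_, ?_, ?_⟩
        · refine KK_mono_of_le ?_
          intro f hf
          exact ⟨hf.1, fun j hj => hf.2 j (Finset.sdiff_subset hj)⟩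
        · rw [Finset.card_sdiff_of_subset hR'S]; omega
        · have h1 := Finset.sum_sdiff hR'S (f := e')
          rw [Finset.sum_congr rfl hR'e, Finset.sum_const, hr, smul_eq_mul] at h1
          rw [Nat.add_sub_cancel_left]
          have : (r + c) * (G + 1) = r * (G + 1) + c * (G + 1) := by ring
          omega
        · have hp : ∏ x ∈ R', ((1 : PowerSeries ℚ) - PowerSeries.X ^ e' x) =
              (1 - PowerSeries.X ^ (G+1)) ^ r := by
            rw [← hr, ← Finset.prod_const]
            exact Finset.prod_congr rfl fun j hj => by rw [hR'e j hj]
          rw [Hs, Hs, ← Finset.prod_sdiff hR'S, hηD, Nat.sub_self, Nat.sub_zero,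
            Nat.add_sub_cancel_left, hp]
          have hW := Wp_mul (G+1) (by omega)
          have hWr : Wp (G+1) ^ r * (1 - PowerSeries.X ^ (G+1)) ^ r = 1 := by
            rw [← mul_pow, hW, one_pow]
          rw [pow_add]
          simp only [pow_zero, mul_one]
          linear_combination (∏ x ∈ S \ R', (1 - PowerSeries.X ^ e' x)) * Wp 1 ^ (n+1+1) *
            Wp (G+1) ^ c * hWr
      by_cases hRD : R.card < D
      · obtain ⟨h1, h2, h3, h4⟩ := drop R (Finset.Subset.refl _) R.card rfl hRD.le
        rw [h4]
        refine le_trans (Nat.cast_le.mpr h1) ?_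
        have hle2 : ∑ j ∈ S \ R, e' j ≤ ∑ j ∈ S, e' j :=
          Finset.sum_le_sum_of_subset Finset.sdiff_subset
        refine ih (∑ j ∈ S \ R, e' j) (by omega) (D - R.card) 0 G d (S \ R) e' rfl
          ⟨h2, by omega, by omega, ?_⟩
        intro j hj
        rw [Finset.mem_sdiff, hR, Finset.mem_filter] at hj
        have := hle' j hj.1
        have h5 : e' j ≠ G + 1 := fun h => hj.2 ⟨hj.1, h⟩
        omega
      · obtain ⟨R', hR', hcard⟩ := Finset.exists_subset_card_eq (show D ≤ R.card by omega)
        obtain ⟨h1, h2, h3, h4⟩ := drop R' hR' D hcard le_rfl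
        rw [h4, Nat.sub_self]
        rw [Nat.sub_self] at h2 h3
        rw [Nat.zero_mul] at h3
        rw [coeff_bot (n+1) d G _ _ (by omega) (by omega)]
        rw [KK_bot (n := n+1) (d := d) (tp := tp) (S := S \ R') (e := e') htp (by omega) (by omega),
          finrank_bot] at h1
        exact_mod_cast h1
  by_cases hbig : d + 1 < e i
  · rw [PowerSeries.coeff_X_pow_mul', if_neg (by omega), add_zero]
    refine le_trans ?_ hmain
    have : Module.finrank ℂ (KK (n+1) d tp S e) ≤ Module.finrank ℂ (KK (n+1) d tp S e') := by
      refine KK_mono_of_le ?_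
      intro f hf
      refine ⟨hf.1, fun j hj q => ?_⟩
      by_cases hji : j = i
      · subst hji
        rw [he', Function.update_self]
        exact deg_gt f hf.1 _ _ (ell_pow_homog _ _ _) (by omega) q
      · rw [he', Function.update_of_ne hji]; exact hf.2 j hj q
    exact_mod_cast this
  · have hst := STEP (d' := d + 1 - e i) htp hi hei (show e i ≤ F + 1 by omega) (by omega)
      (fun f hf => KL' htp hc hs hf)
    have hn := ihn (D+1) (η+1) F (d + 1 - e i) S _
      (Cfg_step hc hη hs hi hei (by omega) (fun j hj _ => hle j hj) (by omega))
    rw [PowerSeries.coeff_X_pow_mul', if_pos (by omega), show d - (e i - 1) = d + 1 - e i by omega]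
    have hst' : (Module.finrank ℂ (KK (n+1) d tp S e) : ℚ) ≤
      Module.finrank ℂ (KK (n+1) d tp S e') +
      Module.finrank ℂ (KK n (d + 1 - e i) tp S (Function.update e i (F + 1 - e i))) := by
      exact_mod_cast hst
    linarith

lemma upper {ι : Type} [DecidableEq ι] {tp : ι → ℂ} (htp : Function.Injective tp) (n : ℕ) :
    ∀ (D η F d : ℕ) (S : Finset ι) (e : ι → ℕ), Cfg n D η F d S e →
      (Module.finrank ℂ (KK n d tp S e) : ℚ) ≤ PowerSeries.coeff d (Hs n D η F S e) := by
  induction n with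
  | zero => intro D η F d S e h; exact upper_base h
  | succ n ih => intro D η F d S e h; exact upper_aux htp ih _ D η F d S e rfl h

lemma lower {ι : Type} [DecidableEq ι] {tp : ι → ℂ} (htp : Function.Injective tp) (n d : ℕ) :
    ∀ (c M D η F : ℕ) (S : Finset ι) (e : ι → ℕ), S.card = c → ∑ i ∈ S, (d + 1 - e i) = M →
      Cfg (n+1) D η F d S e →
      PowerSeries.coeff d (Hs (n+1) D η F S e) ≤ (Module.finrank ℂ (KK (n+1) d tp S e) : ℚ) := by
  intro c
  induction c using Nat.strong_induction_on with
  | _ c ihc =>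
  intro M
  induction M using Nat.strong_induction_on with
  | _ M ihM =>
  intro D η F S e hcc hM hC
  obtain ⟨hc, hη, hs, hle⟩ := hC
  by_cases h0 : ∃ i ∈ S, e i = 0
  · obtain ⟨i, hi, h⟩ := h0
    rw [Hs_zero _ _ _ _ S e i hi h, KK_zero _ d tp S e i hi h, map_zero, Nat.cast_zero]
  have he : ∀ i ∈ S, 1 ≤ e i := fun i hi => Nat.one_le_iff_ne_zero.mpr fun h => h0 ⟨i, hi, h⟩
  obtain ⟨i0, hi0⟩ : S.Nonempty := Finset.card_pos.mp (by omega)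
  have hF1 : 1 ≤ F := (he i0 hi0).trans (hle i0 hi0)
  by_cases hall : ∀ i ∈ S, d + 1 ≤ e i
  · rw [Hs_big _ _ _ _ _ _ _ ((hall i0 hi0).trans (hle i0 hi0)) hall,
      finrank_KK_big _ d tp S e hall]
  by_cases hex : ∃ i ∈ S, e i ≤ d ∧ (e i < F ∨ η = 0)
  · obtain ⟨i, hi, hid, hor⟩ := hex
    obtain ⟨F', η', hη', hs', hle', hHs⟩ : ∃ F' η', η' + 1 ≤ D ∧
        ∑ j ∈ S, e j + 1 + η' = D * (F' + 1) + 2 * d + (n+1) + 1 ∧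
        (F ≤ F' ∧ e i + 1 ≤ F') ∧
        Hs (n+1) D (η'+1) F' S e = Hs (n+1) D η F S e := by
      by_cases hz : η = 0
      · subst hz
        refine ⟨F + 1, D - 1, by omega, ?_, ⟨by omega, ?_⟩, ?_⟩
        · have : D * (F + 1 + 1) = D * (F + 1) + D := by ring
          omega
        · have := hle i hi; omega
        · rw [Hs, Hs, show D - 1 + 1 = D by omega, Nat.sub_self, Nat.sub_zero]
          simp
      · refine ⟨F, η - 1, by omega, by omega, ⟨le_rfl, by omega⟩, ?_⟩
        rw [show η - 1 + 1 = η by omega]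
    set e1 := Function.update e i (e i + 1) with he1
    have he1i : e1 i = e i + 1 := Function.update_self ..
    have hsum1 : ∑ j ∈ S, e1 j = ∑ j ∈ S, e j + 1 := by
      have := sum_upd S e i hi (e i + 1); rw [← he1] at this; omega
    have hle1 : ∀ j ∈ S, e1 j ≤ F' := by
      intro j hj
      by_cases hji : j = i
      · subst hji; omega
      · rw [he1, Function.update_of_ne hji]; exact (hle j hj).trans hle'.1
    have hback : Function.update e1 i (e1 i - 1) = e := by
      rw [he1i, he1, Function.update_idem, Nat.add_sub_cancel, Function.update_eq_self]
    have hmeas : ∑ j ∈ S, (d + 1 - e1 j) < M := by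
      rw [← hM]
      refine Finset.sum_lt_sum (fun j hj => ?_) ⟨i, hi, by omega⟩
      by_cases hji : j = i
      · subst hji; omega
      · rw [he1, Function.update_of_ne hji]
    have hIH := ihM _ hmeas D η' F' S e1 hcc rfl ⟨hc, hη', by omega, hle1⟩
    have hID := Hs_ID n D η' F' S e1 i hi (by omega) (by omega) (by omega) (by omega)
    rw [hback, hHs] at hID
    rw [hID, map_add, PowerSeries.coeff_X_pow_mul', if_pos (by omega)] at hIH
    have hst := STEP (d' := d + 1 - e1 i) (F := F') (n := n) (d := d) (e := e1) htp hi (by omega)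
      (by omega) (by omega)
      (fun f hf => KL' (D := D) (η := η') htp hc (by omega) hf)
    rw [hback] at hst
    have hn := upper htp n (D+1) (η'+1) F' (d + 1 - e1 i) S _
      (Cfg_step (e := e1) (d := d) hc hη' (by omega) hi (by omega) (by omega)
        (fun j hj _ => hle1 j hj) (by omega))
    rw [show d - (e1 i - 1) = d + 1 - e1 i by omega] at hIH
    have hst' : (Module.finrank ℂ (KK (n+1) d tp S e1) : ℚ) ≤
      Module.finrank ℂ (KK (n+1) d tp S e) +
      Module.finrank ℂ (KK n (d + 1 - e1 i) tp S (Function.update e1 i (F' + 1 - e1 i))) := by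
      exact_mod_cast hst
    linarith
  · push Not at hall hex
    obtain ⟨i, hi, hid⟩ := hall
    obtain ⟨hFi, hη0⟩ := hex i hi (by omega)
    have hei : e i = F := le_antisymm (hle i hi) hFi
    have hcard : (S.erase i).card = c - 1 := by rw [Finset.card_erase_of_mem hi, hcc]
    have hsumE := Finset.add_sum_erase S e hi
    have hD2 : (D - 1) * (F + 1) + (F + 1) = D * (F + 1) := by
      obtain ⟨b, rfl⟩ := Nat.exists_eq_add_of_le' (show 1 ≤ D by omega)
      rw [Nat.add_sub_cancel]; ring
    have hC1 : Cfg (n+1) (D-1) (η-1) F d (S.erase i) e :=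
      ⟨by omega, by omega, by omega, fun j hj => hle j (Finset.mem_of_mem_erase hj)⟩
    have hIH := ihc (c - 1) (by omega) _ (D-1) (η-1) F (S.erase i) e hcard rfl hC1
    have hHs : Hs (n+1) D η F S e = Hs (n+1) (D-1) (η-1) F (S.erase i) e := by
      rw [Hs, Hs, ← Finset.mul_prod_erase _ _ hi, hei, show D - 1 - (η - 1) = D - η by omega]
      obtain ⟨b, rfl⟩ := Nat.exists_eq_add_of_le' (show 1 ≤ η by omega)
      rw [Nat.add_sub_cancel, pow_succ (Wp F)]
      have hW := Wp_mul F hF1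
      linear_combination (∏ x ∈ S.erase i, (1 - PowerSeries.X ^ e x)) * Wp 1 ^ (n+1+1) *
        Wp (F+1) ^ (D - (b+1)) * Wp F ^ b * hW
    rw [hHs]
    refine hIH.trans ?_
    have : Module.finrank ℂ (KK (n+1) d tp (S.erase i) e) ≤ Module.finrank ℂ (KK (n+1) d tp S e) := by
      refine KK_mono_of_le ?_
      intro f hf
      refine ⟨hf.1, fun j hj q => ?_⟩
      by_cases hji : j = i
      · subst hji
        rw [hei]
        exact KL' htp hC1.1 hC1.2.2.1 hf _ q
      · exact hf.2 j (Finset.mem_erase.mpr ⟨hji, hj⟩) q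
    exact_mod_cast this

lemma MAIN {ι : Type} [DecidableEq ι] {tp : ι → ℂ} (htp : Function.Injective tp) {n d D η F : ℕ}
    {S : Finset ι} {e : ι → ℕ} (h : Cfg (n+1) D η F d S e) :
    (Module.finrank ℂ (KK (n+1) d tp S e) : ℚ) = PowerSeries.coeff d (Hs (n+1) D η F S e) :=
  le_antisymm (upper htp _ _ _ _ _ _ _ h) (lower htp n d _ _ _ _ _ _ _ rfl rfl h)


lemma sq_dvd_of_roots (p : Polynomial ℂ) (v : ℂ) (h1 : p.eval v = 0)
    (h2 : (Polynomial.derivative p).eval v = 0) : (Polynomial.X - Polynomial.C v) ^ 2 ∣ p := by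
  by_cases hp : p = 0
  · rw [hp]; exact dvd_zero _
  · rw [← Polynomial.le_rootMultiplicity_iff hp]
    exact (Polynomial.one_lt_rootMultiplicity_iff_isRoot hp).mpr ⟨h1, h2⟩

lemma sum_pow_kill {A : Type} [CommRing A] {κ : Type} [DecidableEq κ] (J : Ideal A)
    (I : Finset κ) (x : κ → A) (e : κ → ℕ) (h : ∀ i ∈ I, 1 ≤ e i)
    (hx : ∀ i ∈ I, x i ^ e i ∈ J) : (∑ i ∈ I, x i) ^ (∑ i ∈ I, (e i - 1) + 1) ∈ J := by
  induction I using Finset.induction_on with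
  | empty => simp
  | insert a s ha ih =>
    rw [Finset.sum_insert ha, Finset.sum_insert ha]
    have h1 := ih (fun i hi => h i (Finset.mem_insert_of_mem hi))
      (fun i hi => hx i (Finset.mem_insert_of_mem hi))
    have h2 := h a (Finset.mem_insert_self _ _)
    exact Ideal.add_pow_mem_of_pow_mem_of_le J (hx a (Finset.mem_insert_self _ _)) h1 (by omega)

/-- Annihilator ideal of a functional. -/
def AnnI {A : Type} [CommRing A] [Algebra ℂ A] (f : A →ₗ[ℂ] ℂ) : Ideal A where
  carrier := {p | ∀ q, f (p * q) = 0}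
  zero_mem' := by simp
  add_mem' := by
    intro a b ha hb q
    rw [add_mul, map_add, ha q, hb q, add_zero]
  smul_mem' := by
    intro c a ha q
    rw [smul_eq_mul, mul_comm c a, mul_assoc]
    exact ha _

lemma deriv_step {A : Type} [CommRing A] [Algebra ℂ A] (f : A →ₗ[ℂ] ℂ) (p : Polynomial A) (a : ℕ)
    (B : Set ℂ) (hB : B.Finite)
    (h : ∀ c, c ∉ B → ∀ q, f ((p.eval (algebraMap ℂ A c)) ^ (a+1) * q) = 0) (c : ℂ) (q : A) :
    f ((p.eval (algebraMap ℂ A c)) ^ a * (Polynomial.derivative p).eval (algebraMap ℂ A c) * q)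
      = 0 := by
  have h0 : plift f (p ^ (a+1) * Polynomial.C q) = 0 :=
    plift_eq_zero_of_infinite f _ Bᶜ hB.infinite_compl fun c hc => by
      rw [Polynomial.eval_mul, Polynomial.eval_pow, Polynomial.eval_C]
      exact h c hc q
  have h1 := congrArg (fun P => (Polynomial.derivative P).eval c) h0
  simp only [plift_derivative, Polynomial.derivative_zero, Polynomial.eval_zero, plift_eval] at h1
  rw [Polynomial.derivative_mul, Polynomial.derivative_C, mul_zero, add_zero,
    Polynomial.derivative_pow_succ, Polynomial.eval_mul, Polynomial.eval_mul, Polynomial.eval_mul,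
    Polynomial.eval_C, Polynomial.eval_C, Polynomial.eval_pow] at h1
  have h2 : (algebraMap ℂ A ((a : ℂ) + 1)) = (a : A) + 1 := by simp
  have h3 : ((a : A) + 1) * (p.eval (algebraMap ℂ A c)) ^ a *
      (Polynomial.derivative p).eval (algebraMap ℂ A c) * q = ((a : ℂ) + 1) •
      ((p.eval (algebraMap ℂ A c)) ^ a * (Polynomial.derivative p).eval (algebraMap ℂ A c) * q) := by
    rw [Algebra.smul_def, h2]; ring
  rw [h3, map_smul, smul_eq_mul] at h1
  exact (mul_eq_zero.mp h1).resolve_left (by exact_mod_cast Nat.succ_ne_zero a)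

/-- The generic linear form in a join. -/
def phi {ι : Type} (n : ℕ) (tp : ι → ℂ) (I : Finset ι) (t : ℕ) (c : ι → ℂ) (μ u : Fin t → ℂ) :
    MvPolynomial (Fin (n+1)) ℂ :=
  ∑ i ∈ I, MvPolynomial.C (c i) * ell n (tp i) + ∑ j, MvPolynomial.C (μ j) * ell n (u j)

lemma phi_homog {ι : Type} (n : ℕ) (tp : ι → ℂ) (I : Finset ι) (t : ℕ) (c : ι → ℂ)
    (μ u : Fin t → ℂ) : (phi n tp I t c μ u).IsHomogeneous 1 := by
  refine MvPolynomial.IsHomogeneous.add ?_ ?_ <;>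
  · refine MvPolynomial.IsHomogeneous.sum _ _ _ fun j _ => ?_
    exact MvPolynomial.IsHomogeneous.C_mul (ell_homog _ _) _

lemma phi_upd_c {ι : Type} [DecidableEq ι] (n : ℕ) (tp : ι → ℂ) (I : Finset ι) (t : ℕ) (c : ι → ℂ)
    (μ u : Fin t → ℂ) (i : ι) (hi : i ∈ I) (x : ℂ) :
    phi n tp I t (Function.update c i (c i + x)) μ u =
      phi n tp I t c μ u + MvPolynomial.C x * ell n (tp i) := by
  rw [phi, phi, ← Finset.add_sum_erase I _ hi,
    ← Finset.add_sum_erase I (fun i => MvPolynomial.C (c i) * ell n (tp i)) hi,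
    Finset.sum_congr rfl fun j hj => by
      rw [Function.update_of_ne (Finset.ne_of_mem_erase hj)]]
  rw [Function.update_self, map_add]; ring

lemma phi_upd_mu {ι : Type} (n : ℕ) (tp : ι → ℂ) (I : Finset ι) (t : ℕ) (c : ι → ℂ)
    (μ u : Fin t → ℂ) (i : Fin t) (x : ℂ) :
    phi n tp I t c (Function.update μ i (μ i + x)) u =
      phi n tp I t c μ u + MvPolynomial.C x * ell n (u i) := by
  rw [phi, phi, ← Finset.add_sum_erase univ _ (Finset.mem_univ i),
    ← Finset.add_sum_erase univ (fun i => MvPolynomial.C (μ i) * ell n (u i)) (Finset.mem_univ i),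
    show ∑ j ∈ univ.erase i, MvPolynomial.C (Function.update μ i (μ i + x) j) * ell n (u j) =
      ∑ j ∈ univ.erase i, MvPolynomial.C (μ j) * ell n (u j) from
      Finset.sum_congr rfl fun j hj => by
        rw [Function.update_of_ne (Finset.ne_of_mem_erase hj)]]
  rw [Function.update_self, map_add]; ring

lemma phi_upd_u {ι : Type} (n : ℕ) (tp : ι → ℂ) (I : Finset ι) (t : ℕ) (c : ι → ℂ)
    (μ u : Fin t → ℂ) (i : Fin t) (x : ℂ) :
    phi n tp I t c μ (Function.update u i x) =
      phi n tp I t c μ u - MvPolynomial.C (μ i) * ell n (u i) +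
        MvPolynomial.C (μ i) * ell n x := by
  rw [phi, phi, ← Finset.add_sum_erase univ _ (Finset.mem_univ i),
    ← Finset.add_sum_erase univ (fun i => MvPolynomial.C (μ i) * ell n (u i)) (Finset.mem_univ i),
    show ∑ j ∈ univ.erase i, MvPolynomial.C (μ j) * ell n (Function.update u i x j) =
      ∑ j ∈ univ.erase i, MvPolynomial.C (μ j) * ell n (u j) from
      Finset.sum_congr rfl fun j hj => by
        rw [Function.update_of_ne (Finset.ne_of_mem_erase hj)]]
  rw [Function.update_self]; ring

lemma lin_step {n : ℕ} (f : MvPolynomial (Fin (n+1)) ℂ →ₗ[ℂ] ℂ)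
    (φ w : MvPolynomial (Fin (n+1)) ℂ) (a : ℕ) (B : Set ℂ) (hB : B.Finite)
    (h : ∀ x, x ∉ B → ∀ q, f ((φ + MvPolynomial.C x * w) ^ (a+1) * q) = 0)
    (q : MvPolynomial (Fin (n+1)) ℂ) : f (φ ^ a * w * q) = 0 := by
  have := deriv_step f (Polynomial.C φ + Polynomial.X * Polynomial.C w) a B hB
    (fun x hx q => by
      rw [MvPolynomial.algebraMap_eq, Polynomial.eval_add, Polynomial.eval_mul,
        Polynomial.eval_C, Polynomial.eval_C, Polynomial.eval_X]
      exact h x hx q) 0 q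
  rw [Polynomial.derivative_add, Polynomial.derivative_C, zero_add, Polynomial.derivative_mul,
    Polynomial.derivative_C, Polynomial.derivative_X, mul_zero, add_zero, one_mul, map_zero,
    Polynomial.eval_add, Polynomial.eval_mul, Polynomial.eval_C, Polynomial.eval_C,
    Polynomial.eval_X, zero_mul, add_zero] at this
  exact this

lemma curve_step {n : ℕ} (f : MvPolynomial (Fin (n+1)) ℂ →ₗ[ℂ] ℂ)
    (φ : MvPolynomial (Fin (n+1)) ℂ) (m v : ℂ) (hm : m ≠ 0) (a : ℕ) (B : Set ℂ) (hB : B.Finite)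
    (h : ∀ x, x ∉ B → ∀ q,
      f ((φ - MvPolynomial.C m * ell n v + MvPolynomial.C m * ell n x) ^ (a+1) * q) = 0)
    (q : MvPolynomial (Fin (n+1)) ℂ) :
    f (φ ^ a * (Polynomial.derivative (ellX n)).eval (MvPolynomial.C v) * q) = 0 := by
  have := deriv_step f (Polynomial.C (φ - MvPolynomial.C m * ell n v) +
        Polynomial.C (MvPolynomial.C m) * ellX n) a B hB
      (fun x hx q => by
        rw [MvPolynomial.algebraMap_eq, Polynomial.eval_add, Polynomial.eval_mul,
          Polynomial.eval_C, Polynomial.eval_C, ellX_eval]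
        exact h x hx q) v (MvPolynomial.C m⁻¹ * q)
  rw [MvPolynomial.algebraMap_eq, Polynomial.eval_add, Polynomial.eval_mul,
          Polynomial.eval_C, Polynomial.eval_C, ellX_eval, sub_add_cancel, Polynomial.derivative_add,
          Polynomial.derivative_C, zero_add, Polynomial.derivative_C_mul, Polynomial.eval_mul,
          Polynomial.eval_C] at this
  have h1 : MvPolynomial.C (σ := Fin (n+1)) m * MvPolynomial.C m⁻¹ = 1 := by
    rw [← map_mul, mul_inv_cancel₀ hm, map_one]
  generalize Polynomial.eval (MvPolynomial.C v) (Polynomial.derivative (ellX n)) = E at this ⊢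
  have h2 : φ ^ a * E * q = φ ^ a * (MvPolynomial.C m * E) * (MvPolynomial.C m⁻¹ * q) := by
    linear_combination (- φ ^ a * E * q) * h1
  rw [h2]
  exact this

lemma trunc_step {ι : Type} [DecidableEq ι] {n d : ℕ} {tp : ι → ℂ} (htp : Function.Injective tp)
    {f : MvPolynomial (Fin (n+1)) ℂ →ₗ[ℂ] ℂ}
    (hd : ∀ q k, MvPolynomial.IsHomogeneous q k → k ≠ d → f q = 0)
    {I : Finset ι} {t : ℕ} (hIt : n + 1 ≤ I.card + 2 * t) (a : ℕ) (had : a < d)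
    (h : ∀ (c : ι → ℂ) (μ u : Fin t → ℂ), (∀ j, μ j ≠ 0) → Function.Injective u →
      (∀ j, ∀ i ∈ I, u j ≠ tp i) → ∀ q, f (phi n tp I t c μ u ^ (a+1) * q) = 0)
    (c : ι → ℂ) (μ u : Fin t → ℂ) (hμ : ∀ j, μ j ≠ 0) (hu : Function.Injective u)
    (hut : ∀ j, ∀ i ∈ I, u j ≠ tp i) (q : MvPolynomial (Fin (n+1)) ℂ) :
    f (phi n tp I t c μ u ^ a * q) = 0 := by
  obtain ⟨φ, hφ⟩ : ∃ φ, φ = phi n tp I t c μ u := ⟨_, rfl⟩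
  have hφh : φ.IsHomogeneous 1 := by rw [hφ]; exact phi_homog n tp I t c μ u
  have k1 : ∀ i ∈ I, ∀ q, f (φ ^ a * ell n (tp i) * q) = 0 := by
    intro i hi q
    refine lin_step f φ _ a ∅ Set.finite_empty (fun x _ q => ?_) q
    have := h (Function.update c i (c i + x)) μ u hμ hu hut q
    rw [phi_upd_c _ _ _ _ _ _ _ _ hi, ← hφ] at this
    exact this
  have k2 : ∀ j, ∀ q, f (φ ^ a * ell n (u j) * q) = 0 := by
    intro j q
    refine lin_step f φ _ a {- μ j} (Set.finite_singleton _) (fun x hx q => ?_) q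
    have := h c (Function.update μ j (μ j + x)) u (fun k => by
          by_cases hk : k = j
          · subst hk
            rw [Function.update_self]
            intro h0
            exact hx (by rw [Set.mem_singleton_iff]; linear_combination h0)
          · rw [Function.update_of_ne hk]; exact hμ k) hu hut q
    rw [phi_upd_mu, ← hφ] at this
    exact this
  have k3 : ∀ j, ∀ q,
      f (φ ^ a * (Polynomial.derivative (ellX n)).eval (MvPolynomial.C (u j)) * q) = 0 := by
    intro j q
    refine curve_step f φ (μ j) (u j) (hμ j) a (Set.range u ∪ Set.image tp (I : Set ι))
      ((Set.finite_range u).union (I.finite_toSet.image _)) (fun x hx q => ?_) q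
    have hx1 : ∀ k, u k ≠ x := fun k hk => hx (Or.inl ⟨k, hk⟩)
    have hx2 : ∀ i ∈ I, x ≠ tp i := fun i hi hk => hx (Or.inr ⟨i, hi, hk.symm⟩)
    have := h c μ (Function.update u j x) hμ (by
          intro k l hkl
          by_cases hk : k = j <;> by_cases hl : l = j
          · rw [hk, hl]
          · subst hk
            rw [Function.update_self, Function.update_of_ne hl] at hkl
            exact absurd hkl.symm (hx1 l)
          · subst hl
            rw [Function.update_self, Function.update_of_ne hk] at hkl
            exact absurd hkl (hx1 k)
          · rw [Function.update_of_ne hk, Function.update_of_ne hl] at hkl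
            exact hu hkl) (by
          intro k i hi
          by_cases hk : k = j
          · subst hk
            rw [Function.update_self]; exact hx2 i hi
          · rw [Function.update_of_ne hk]; exact hut k i hi) q
    rw [phi_upd_u, ← hφ] at this
    exact this
  rw [← hφ]
  have k4 : ∀ (k : Fin (n+1)) q, f (φ ^ a * MvPolynomial.X k * q) = 0 := by
    intro k q
    let g : MvPolynomial (Fin (n+1)) ℂ →ₗ[ℂ] ℂ := f.comp (LinearMap.mulLeft ℂ (φ ^ a * q))
    have hg : ∀ w, g w = f (φ ^ a * w * q) := by
      intro w
      show f (φ ^ a * q * w) = _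
      congr 1; ring
    have h0 : plift g (ellX n) = 0 := by
      refine poly_eq_zero_of_roots (I.disjSum univ) (Sum.elim tp u) ?_
        (Sum.elim (fun _ => 1) (fun _ => 2)) _ ?_ n
        ((plift_natDegree _ _).trans (ellX_natDegree n)) ?_
      · rintro (x | x) hx (y | y) hy hxy
        · rw [htp hxy]
        · simp only [Sum.elim_inl, Sum.elim_inr] at hxy
          exact absurd hxy.symm (hut y x (by simpa using hx))
        · simp only [Sum.elim_inl, Sum.elim_inr] at hxy
          exact absurd hxy (hut x y (by simpa using hy))
        · rw [hu hxy]
      · rintro (x | x) hx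
        · simp only [Sum.elim_inl, pow_one]
          rw [Polynomial.dvd_iff_isRoot, Polynomial.IsRoot, plift_eval,
            MvPolynomial.algebraMap_eq, ellX_eval, hg]
          exact k1 x (by simpa using hx) q
        · simp only [Sum.elim_inr]
          refine sq_dvd_of_roots _ _ ?_ ?_
          · rw [plift_eval, MvPolynomial.algebraMap_eq, ellX_eval, hg]
            exact k2 x q
          · rw [plift_derivative, plift_eval, MvPolynomial.algebraMap_eq, hg]
            exact k3 x q
      · rw [Finset.sum_disjSum]
        simp
        omega
    rw [← hg, ← ellX_coeff, ← plift_coeff, h0, Polynomial.coeff_zero]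
  induction q using MvPolynomial.induction_on with
  | C x =>
    refine hd _ a ?_ (by omega)
    have h1 : (φ ^ a).IsHomogeneous a := by simpa using hφh.pow a
    simpa using h1.mul (MvPolynomial.isHomogeneous_C _ x)
  | add p q hp hq => rw [mul_add, map_add, hp, hq, add_zero]
  | mul_X p k _ =>
    rw [← k4 k p]
    congr 1; ring

lemma TRUNC {ι : Type} [DecidableEq ι] {n d F : ℕ} {tp : ι → ℂ} (htp : Function.Injective tp)
    {S : Finset ι} {e : ι → ℕ} {f : MvPolynomial (Fin (n+1)) ℂ →ₗ[ℂ] ℂ}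
    (hf : f ∈ KK n d tp S e) (hF : ∀ u q, f (ell n u ^ F * q) = 0) (hf0 : f ≠ 0)
    {I : Finset ι} (hI : I ⊆ S) {t : ℕ} (hIt : n + 1 ≤ I.card + 2 * t)
    (he : ∀ i ∈ I, 1 ≤ e i) (hF1 : 1 ≤ F) : d < ∑ i ∈ I, e i + t * (F + 1) := by
  by_contra hcon
  push Not at hcon
  apply hf0
  have key : ∀ b, b ≤ d → ∀ (c : ι → ℂ) (μ u : Fin t → ℂ), (∀ j, μ j ≠ 0) → Function.Injective u →
      (∀ j, ∀ i ∈ I, u j ≠ tp i) → ∀ q, f (phi n tp I t c μ u ^ (d - b) * q) = 0 := by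
    intro b
    induction b with
    | zero =>
      intro _ c μ u _ _ _ q
      have h1 := sum_pow_kill (AnnI f) (I.disjSum univ)
        (Sum.elim (fun i => MvPolynomial.C (c i) * ell n (tp i))
          (fun j : Fin t => MvPolynomial.C (μ j) * ell n (u j)))
        (Sum.elim e (fun _ => F)) (by
          rintro (x | x) hx
          · exact he x (by simpa using hx)
          · exact hF1) (by
          rintro (x | x) hx
          · intro q
            simp only [Sum.elim_inl]
            rw [mul_pow, mul_comm (MvPolynomial.C (c x) ^ _), mul_assoc]
            exact hf.2 x (hI (by simpa using hx)) _
          · intro q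
            simp only [Sum.elim_inr]
            rw [mul_pow, mul_comm (MvPolynomial.C (μ x) ^ _), mul_assoc]
            exact hF _ _)
      rw [Finset.sum_disjSum, Finset.sum_disjSum] at h1
      simp only [Sum.elim_inl, Sum.elim_inr, Finset.sum_const, Finset.card_univ, Fintype.card_fin,
        smul_eq_mul] at h1
      change phi n tp I t c μ u ^ _ ∈ AnnI f at h1
      have h2 : ∑ i ∈ I, (e i - 1) + I.card = ∑ i ∈ I, e i := by
        rw [Finset.card_eq_sum_ones, ← Finset.sum_add_distrib]
        exact Finset.sum_congr rfl fun i hi => Nat.sub_add_cancel (he i hi)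
      have h3 : t * (F - 1) + 2 * t = t * (F + 1) := by
        obtain ⟨G, rfl⟩ := Nat.exists_eq_add_of_le' hF1
        rw [Nat.add_sub_cancel]; ring
      exact Ideal.pow_mem_of_pow_mem (AnnI f) h1 (by omega : _ ≤ d - 0) q
    | succ b ih =>
      intro hb c μ u hμ hu hut q
      refine trunc_step htp hf.1 hIt (d - (b+1)) (by omega) ?_ c μ u hμ hu hut q
      rw [show d - (b+1) + 1 = d - b by omega]
      exact ih (by omega)
  obtain ⟨u, hu1, hu2⟩ : ∃ u : Fin t → ℂ, Function.Injective u ∧ ∀ j, ∀ i ∈ I, u j ≠ tp i := by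
    have hinf : ((Set.image tp (I : Set ι))ᶜ).Infinite := (I.finite_toSet.image tp).infinite_compl
    obtain ⟨s, hs, hcard⟩ := hinf.exists_subset_card_eq t
    refine ⟨fun j => (s.equivFinOfCardEq hcard).symm j, ?_, ?_⟩
    · intro a b hab
      exact (s.equivFinOfCardEq hcard).symm.injective (Subtype.ext hab)
    · intro j i hi h
      exact hs ((s.equivFinOfCardEq hcard).symm j).2 ⟨i, hi, h.symm⟩
  refine LinearMap.ext fun q => ?_
  have := key d le_rfl (fun _ => 0) (fun _ => 1) u (fun _ => one_ne_zero) hu1 hu2 q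
  simpa using this


/-- The power series `(1 - w z)^{-p}`. -/
def mcs {R : Type} [CommRing R] (w : R) (p : ℕ) : PowerSeries R :=
  PowerSeries.mk fun l => (Nat.multichoose p l : R) * w ^ l

lemma mcs_zero {R : Type} [CommRing R] (w : R) : mcs w 0 = 1 := by
  ext l
  rw [mcs, PowerSeries.coeff_mk, PowerSeries.coeff_one]
  cases l <;> simp

lemma mcs_succ {R : Type} [CommRing R] (w : R) (p : ℕ) :
    mcs w (p+1) * (1 - PowerSeries.C w * PowerSeries.X) = mcs w p := by
  ext l
  rw [mul_sub, mul_one, mul_comm (PowerSeries.C w), ← mul_assoc, map_sub,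
    PowerSeries.coeff_mul_C]
  cases l with
  | zero => simp [mcs]
  | succ l =>
    rw [PowerSeries.coeff_succ_mul_X]
    simp only [mcs, PowerSeries.coeff_mk]
    rw [Nat.multichoose_succ_succ]
    push_cast
    ring

lemma mcs_mul_pow {R : Type} [CommRing R] (w : R) (p q : ℕ) :
    mcs w (p+q) * (1 - PowerSeries.C w * PowerSeries.X) ^ q = mcs w p := by
  induction q with
  | zero => simp
  | succ q ih => rw [← ih, pow_succ', ← mul_assoc, ← add_assoc, mcs_succ]

lemma mcs_eq_pow {R : Type} [CommRing R] (w : R) (p : ℕ) : mcs w p = mcs w 1 ^ p := by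
  have h1 : mcs w 1 * (1 - PowerSeries.C w * PowerSeries.X) = 1 := by
    rw [mcs_succ, mcs_zero]
  have h2 := mcs_mul_pow w 0 p
  rw [zero_add, mcs_zero] at h2
  calc mcs w p = mcs w p * (mcs w 1 * (1 - PowerSeries.C w * PowerSeries.X)) ^ p := by
        rw [h1, one_pow, mul_one]
    _ = (mcs w p * (1 - PowerSeries.C w * PowerSeries.X) ^ p) * mcs w 1 ^ p := by
        rw [mul_pow]; ring
    _ = _ := by rw [h2, one_mul]

lemma mcs_identity {R : Type} [CommRing R] (y : R) (ε p : ℕ) :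
    ∑ i ∈ range (ε+1), ((ε.choose i : ℕ) : PowerSeries R) *
      ((PowerSeries.C y * PowerSeries.X) ^ i * (mcs (1+y) (p+i) * mcs 1 (ε+1))) =
      mcs (1+y) (ε+p) * mcs 1 1 := by
  have h1 : mcs (1+y) 1 * (1 - PowerSeries.C (1+y) * PowerSeries.X) = 1 := by
    rw [mcs_succ, mcs_zero]
  have h2 : mcs (1:R) 1 * (1 - PowerSeries.C 1 * PowerSeries.X) = 1 := by
    rw [mcs_succ, mcs_zero]
  have h3 : PowerSeries.C y * PowerSeries.X * mcs (1+y) 1 + 1 =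
      mcs (1+y) 1 * (1 - PowerSeries.X) := by
    rw [map_add, map_one] at h1
    linear_combination -h1
  rw [map_one, one_mul] at h2
  have h4 := add_pow (PowerSeries.C y * PowerSeries.X * mcs (1+y) 1) 1 ε
  rw [h3] at h4
  calc _ = (∑ i ∈ range (ε+1), (PowerSeries.C y * PowerSeries.X * mcs (1+y) 1) ^ i * 1 ^ (ε - i) *
        ((ε.choose i : ℕ) : PowerSeries R)) * (mcs (1+y) 1 ^ p * mcs 1 1 ^ (ε+1)) := by
        rw [Finset.sum_mul]
        refine Finset.sum_congr rfl fun i _ => ?_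
        rw [mcs_eq_pow (1+y) (p+i), mcs_eq_pow 1 (ε+1), one_pow, mul_pow _ (mcs (1+y) 1) i, pow_add]
        ring
    _ = mcs (1+y) 1 ^ (ε+p) * mcs 1 1 * (mcs 1 1 * (1 - PowerSeries.X)) ^ ε := by
        rw [← h4, mul_pow, mul_pow, pow_add, pow_succ]; ring
    _ = _ := by rw [h2, one_pow, mul_one, ← mcs_eq_pow]

lemma mcs_coeff {R : Type} [CommRing R] (y : R) (ε p t : ℕ) :
    ∑ i ∈ range (t+1), ∑ l ∈ range (t - i + 1),
      ((ε.choose i * (Nat.multichoose (p+i) l * Nat.multichoose (ε+1) (t-i-l)) : ℕ) : R) *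
        ((1+y) ^ l * y ^ i) =
    ∑ i ∈ range (t+1), (Nat.multichoose (ε+p) i : R) * (1+y) ^ i := by
  have h := congrArg (PowerSeries.coeff t) (mcs_identity y ε p)
  have hR : PowerSeries.coeff t (mcs (1+y) (ε+p) * mcs 1 1) =
      ∑ i ∈ range (t+1), (Nat.multichoose (ε+p) i : R) * (1+y) ^ i := by
    rw [PowerSeries.coeff_mul, Finset.Nat.sum_antidiagonal_eq_sum_range_succ_mk]
    refine Finset.sum_congr rfl fun i _ => ?_
    simp [mcs]
  rw [hR, map_sum] at h
  rw [← h]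
  have hT : ∀ i, PowerSeries.coeff t (((ε.choose i : ℕ) : PowerSeries R) *
      ((PowerSeries.C y * PowerSeries.X) ^ i * (mcs (1+y) (p+i) * mcs 1 (ε+1)))) =
      if i ≤ t then ∑ l ∈ range (t - i + 1),
      ((ε.choose i * (Nat.multichoose (p+i) l * Nat.multichoose (ε+1) (t-i-l)) : ℕ) : R) *
        ((1+y) ^ l * y ^ i) else 0 := by
    intro i
    rw [mul_pow, ← map_pow, mul_assoc, ← nsmul_eq_mul, map_nsmul, PowerSeries.coeff_C_mul,
      PowerSeries.coeff_X_pow_mul']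
    split_ifs with hi
    · rw [PowerSeries.coeff_mul, Finset.Nat.sum_antidiagonal_eq_sum_range_succ_mk, nsmul_eq_mul,
        Finset.mul_sum, Finset.mul_sum]
      refine Finset.sum_congr rfl fun l _ => ?_
      simp only [mcs, PowerSeries.coeff_mk, one_pow, mul_one]
      push_cast
      ring
    · simp
  rw [Finset.sum_congr rfl fun i _ => hT i]
  rw [← Finset.sum_filter]
  symm
  refine Finset.sum_subset_zero_on_sdiff ?_ ?_ ?_
  · intro i hi; simp only [mem_filter, mem_range] at hi ⊢; omega
  · intro i hi
    simp only [mem_sdiff, mem_filter, mem_range] at hi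
    have : ε.choose i = 0 := Nat.choose_eq_zero_of_lt (by omega)
    simp [this]
  · intro i hi; rfl

lemma Cb_pascal (b j : ℤ) (hj : 1 ≤ j) : Cb (b+1) j = Cb b j + Cb b (j-1) := by
  obtain ⟨k, rfl⟩ : ∃ k : ℕ, j = k + 1 := ⟨(j-1).toNat, by omega⟩
  rw [add_sub_cancel_right]
  by_cases hb : 0 ≤ b
  · obtain ⟨c, rfl⟩ := Int.eq_ofNat_of_zero_le hb
    unfold Cb
    have e1 : ((c:ℤ) + 1).toNat = c + 1 := by omega
    have e2 : ((k:ℤ) + 1).toNat = k + 1 := by omega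
    rw [e1, e2, Int.toNat_natCast, Int.toNat_natCast, Nat.choose_succ_succ]
    by_cases h1 : k + 1 ≤ c
    · rw [if_pos (by omega), if_pos (by omega), if_pos (by omega)]; push_cast; ring
    · rw [if_neg (show ¬ (0 ≤ (k:ℤ) + 1 ∧ (k:ℤ) + 1 ≤ c) by omega)]
      by_cases h2 : k ≤ c
      · rw [if_pos (by omega), if_pos (by omega), Nat.choose_eq_zero_of_lt (show c < k + 1 by omega)]
        push_cast; ring
      · rw [if_neg (by omega), if_neg (by omega)]; rfl
  · unfold Cb
    rw [if_neg (by omega), if_neg (by omega), if_neg (by omega)]; rfl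

lemma Cb_nat (a k : ℕ) : Cb a k = (a.choose k : ℤ) := by
  unfold Cb
  split_ifs with h
  · simp
  · rw [Nat.choose_eq_zero_of_lt (by omega)]; rfl

/-- The functional `y^r ↦ C(a, k-r)`. -/
def LamF (a k : ℤ) : Polynomial ℤ →ₗ[ℤ] ℤ :=
  Polynomial.lsum fun r => LinearMap.mulRight ℤ (Cb a (k - r))

lemma LamF_X (a k : ℤ) (r : ℕ) : LamF a k (Polynomial.X ^ r) = Cb a (k - r) := by
  rw [LamF, Polynomial.lsum_apply, Polynomial.X_pow_eq_monomial, Polynomial.sum_monomial_index]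
  · simp
  · simp

lemma LamF_w (a k : ℤ) (l : ℕ) : ∀ (i : ℕ), (i : ℤ) + l + 1 ≤ k →
    LamF a k ((1 + Polynomial.X) ^ l * Polynomial.X ^ i) = Cb (a + l) (k - i) := by
  induction l with
  | zero => intro i _; rw [pow_zero, one_mul, LamF_X]; simp
  | succ l ih =>
    intro i hi
    push_cast at hi
    have : (1 + Polynomial.X : Polynomial ℤ) ^ (l+1) * Polynomial.X ^ i =
      (1 + Polynomial.X) ^ l * Polynomial.X ^ i + (1 + Polynomial.X) ^ l * Polynomial.X ^ (i+1) := by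
      ring
    rw [this, map_add, ih i (by omega), ih (i+1) (by push_cast; omega)]
    have h := Cb_pascal (a + l) (k - i) (by omega)
    push_cast
    rw [show a + ((l:ℤ)+1) = a + l + 1 by ring, h, show k - ((i:ℤ)+1) = k - i - 1 by ring]

lemma Cb_identity (a k : ℤ) (ε p t : ℕ) (htk : (t : ℤ) + 1 ≤ k) :
    ∑ i ∈ range (t+1), (ε.choose i : ℤ) * ∑ l ∈ range (t - i + 1),
      (Nat.multichoose (p+i) l * Nat.multichoose (ε+1) (t-i-l) : ℤ) * Cb (a + l) (k - i) =
    ∑ i ∈ range (t+1), (Nat.multichoose (ε+p) i : ℤ) * Cb (a + i) k := by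
  have h := congrArg (LamF a k) (mcs_coeff (Polynomial.X : Polynomial ℤ) ε p t)
  simp only [map_sum, ← nsmul_eq_mul, map_nsmul] at h
  have h1 : ∀ i ∈ range (t+1), (Nat.multichoose (ε+p) i) • LamF a k ((1 + Polynomial.X) ^ i) =
      (Nat.multichoose (ε+p) i : ℤ) * Cb (a + i) k := by
    intro i hi
    rw [mem_range] at hi
    have := LamF_w a k i 0 (by push_cast; omega)
    rw [pow_zero, mul_one] at this
    rw [this, nsmul_eq_mul]; simp
  rw [Finset.sum_congr rfl h1] at h
  rw [← h]
  refine Finset.sum_congr rfl fun i hi => ?_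
  rw [Finset.mul_sum]
  refine Finset.sum_congr rfl fun l hl => ?_
  rw [mem_range] at hi hl
  rw [LamF_w a k l i (by omega), nsmul_eq_mul]
  push_cast; ring

lemma Fb_succ (t : ℕ) (a : ℤ) (s e : ℕ) (n : ℤ) (hn : 0 ≤ n) : Fb (t+1) a s e n =
      Cb a n
        + ∑ j ∈ Finset.range (t+1), Cb ((s : ℤ) - n - 4 + (j+1)) (j+1) * Cb (a + (j+1)) n
        - ∑ j ∈ Finset.range (t+1), Cb (e : ℤ) (j+1) * Fb (t - j) a s e (n - (j+1)) := by
  rw [Fb, if_neg (by omega)]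

lemma Fb_closed (n s ε : ℕ) (hs : s = n + 3 + ε) (a : ℤ) : ∀ (t p : ℕ), p + t + 1 ≤ n →
    Fb t a s ε ((n : ℤ) - p) = ∑ l ∈ range (t+1),
      (Nat.multichoose p l * Nat.multichoose (ε+1) (t-l) : ℤ) * Cb (a + l) ((n:ℤ) - p) := by
  intro t
  induction t using Nat.strong_induction_on with
  | _ t ih =>
  intro p hp
  cases t with
  | zero => simp [Fb]
  | succ t =>
    rw [Fb_succ _ _ _ _ _ (by omega)]
    have h := Cb_identity a ((n:ℤ) - p) ε p (t+1) (by push_cast; omega)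
    rw [Finset.sum_range_succ', Finset.sum_range_succ' (fun i : ℕ => (Nat.multichoose (ε+p) i : ℤ) *
      Cb (a + i) ((n:ℤ) - p))] at h
    have h1 : ∀ j ∈ range (t+1), Cb ((s : ℤ) - ((n:ℤ) - p) - 4 + (j+1)) (j+1) *
        Cb (a + (j+1)) ((n:ℤ) - p) = (Nat.multichoose (ε+p) (j+1) : ℤ) *
        Cb (a + (j+1 : ℕ)) ((n:ℤ) - p) := by
      intro j _
      have e1 : (s : ℤ) - ((n:ℤ) - p) - 4 + (j+1) = ((ε + p + j : ℕ) : ℤ) := by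
        subst hs; push_cast; ring
      have e2 : ((j:ℤ)+1) = ((j+1 : ℕ) : ℤ) := by push_cast; ring
      rw [e1, e2, Cb_nat, Nat.multichoose_eq]
      congr 3
    have h2 : ∀ j ∈ range (t+1), Cb (ε : ℤ) (j+1) * Fb (t - j) a s ε ((n:ℤ) - p - (j+1)) =
        (ε.choose (j+1) : ℤ) * ∑ l ∈ range (t + 1 - (j+1) + 1),
      (Nat.multichoose (p+(j+1)) l * Nat.multichoose (ε+1) (t+1-(j+1)-l) : ℤ) *
        Cb (a + l) ((n:ℤ) - p - (j+1 : ℕ)) := by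
      intro j hj
      rw [mem_range] at hj
      have e2 : ((j:ℤ)+1) = ((j+1 : ℕ) : ℤ) := by push_cast; ring
      have e3 : (n:ℤ) - p - ((j+1 : ℕ) : ℤ) = (n:ℤ) - ((p + (j+1) : ℕ) : ℤ) := by push_cast; ring
      rw [e2, Cb_nat, e3, ih (t - j) (by omega) (p + (j+1)) (by omega),
        show t + 1 - (j+1) = t - j by omega]
    rw [Finset.sum_congr rfl h1, Finset.sum_congr rfl h2]
    simp only [Nat.choose_zero_right, Nat.cast_one, one_mul, Nat.sub_zero, add_zero,
      Nat.cast_zero, sub_zero, Nat.multichoose_zero_right] at h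
    linarith

lemma Fb_eq (n s t : ℕ) (hn : 2 ≤ n) (hs : n + 3 ≤ s) (ht : 2 * t ≤ n) (a : ℤ) :
    Fb t a s (s - n - 3) n = (Nat.multichoose (s - n - 3 + 1) t : ℤ) * Cb a n := by
  have h := Fb_closed n s (s - n - 3) (by omega) a t 0 (by omega)
  rw [Nat.cast_zero, sub_zero] at h
  rw [h, Finset.sum_range_succ']
  simp


/-- The power series `(1 - X^k)^{-D}` given by coefficients. -/
def Wk (k D : ℕ) : PowerSeries ℚ :=
  PowerSeries.mk fun j => if k ∣ j then (Nat.multichoose D (j / k) : ℚ) else 0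

lemma Wk_succ (k D : ℕ) (hk : 1 ≤ k) : Wk k (D+1) * (1 - PowerSeries.X ^ k) = Wk k D := by
  ext j
  rw [mul_sub, mul_one, map_sub, PowerSeries.coeff_mul_X_pow']
  simp only [Wk, PowerSeries.coeff_mk]
  by_cases hkj : k ∣ j
  · obtain ⟨q, rfl⟩ := hkj
    cases q with
    | zero =>
      rw [if_neg (show ¬ k ≤ k * 0 by simp; omega)]
      simp
    | succ q =>
      have h1 : k * (q+1) - k = k * q := by rw [Nat.mul_succ, Nat.add_sub_cancel]
      rw [if_pos (Nat.le_mul_of_pos_right k (Nat.succ_pos q)), h1, if_pos (dvd_mul_right _ _),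
        if_pos (dvd_mul_right _ _), if_pos (dvd_mul_right _ _), Nat.mul_div_cancel_left _ hk,
        Nat.mul_div_cancel_left _ hk, Nat.multichoose_succ_succ]
      push_cast; ring
  · rw [if_neg hkj, if_neg hkj]
    split_ifs with h1 h2
    · exact absurd ((Nat.dvd_sub_iff_left h1 dvd_rfl).mp h2) hkj
    · simp
    · simp

lemma Wk_eq (k D : ℕ) (hk : 1 ≤ k) : Wk k D = Wp k ^ D := by
  induction D with
  | zero =>
    ext j
    rw [pow_zero, Wk, PowerSeries.coeff_mk, PowerSeries.coeff_one]
    by_cases hj : j = 0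
    · subst hj; simp
    · rw [if_neg hj]
      split_ifs with h
      · have h1 : j / k ≠ 0 := by
          have := Nat.div_pos (Nat.le_of_dvd (by omega) h) hk
          omega
        obtain ⟨b, hb⟩ := Nat.exists_eq_succ_of_ne_zero h1
        rw [hb]; simp
      · rfl
  | succ D ih =>
    have h1 := Wk_succ k D hk
    have h2 := Wp_mul k hk
    rw [pow_succ, ← ih, ← h1]
    linear_combination (- Wk k (D+1)) * h2

lemma coeff_mul_Wp_pow (P : PowerSeries ℚ) (k D d N : ℕ) (hk : 1 ≤ k) (hN : d < N) :
    PowerSeries.coeff d (P * Wp k ^ D) = ∑ t ∈ range N,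
      (Nat.multichoose D t : ℚ) * (if t * k ≤ d then PowerSeries.coeff (d - t * k) P else 0) := by
  rw [← Wk_eq k D hk, mul_comm, PowerSeries.coeff_mul,
    Finset.Nat.sum_antidiagonal_eq_sum_range_succ_mk]
  have h1 : ∀ j ∈ range (d+1), PowerSeries.coeff j (Wk k D) * PowerSeries.coeff (d - j) P =
      ∑ t ∈ range N, if t * k = j then
        (Nat.multichoose D t : ℚ) * PowerSeries.coeff (d - j) P else 0 := by
    intro j hj
    rw [mem_range] at hj
    rw [Wk, PowerSeries.coeff_mk]
    by_cases hkj : k ∣ j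
    · obtain ⟨q, rfl⟩ := hkj
      rw [if_pos (dvd_mul_right _ _), Nat.mul_div_cancel_left _ hk]
      have hq : q ≤ k * q := Nat.le_mul_of_pos_left q hk
      rw [Finset.sum_eq_single q]
      · rw [if_pos (mul_comm _ _)]
      · intro b _ hb
        rw [if_neg]
        intro h
        rw [mul_comm] at h
        exact hb (Nat.eq_of_mul_eq_mul_left hk h)
      · intro h
        exact absurd (mem_range.mpr (by omega)) h
    · rw [if_neg hkj, zero_mul]
      symm
      refine Finset.sum_eq_zero fun t _ => ?_
      rw [if_neg]
      intro h
      exact hkj (h ▸ dvd_mul_left k t)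
  rw [Finset.sum_congr rfl h1, Finset.sum_comm]
  refine Finset.sum_congr rfl fun t _ => ?_
  rw [Finset.sum_ite_eq]
  by_cases h : t * k ≤ d
  · rw [if_pos (mem_range.mpr (by omega)), if_pos h]
  · rw [if_neg (by rw [mem_range]; omega), if_neg h, mul_zero]

lemma coeff_prod_part {ι : Type} [DecidableEq ι] (n : ℕ) (S : Finset ι) (e : ι → ℕ) (c : ℕ) :
    PowerSeries.coeff c ((∏ i ∈ S, ((1 : PowerSeries ℚ) - PowerSeries.X ^ e i)) * Wp 1 ^ (n+1)) =
      ∑ I ∈ S.powerset, (-1 : ℚ) ^ I.card * (Cb ((n : ℤ) + c - ∑ i ∈ I, (e i : ℤ)) n : ℚ) := by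
  rw [Finset.prod_sub, Finset.sum_mul, map_sum]
  refine Finset.sum_congr rfl fun I _ => ?_
  rw [Finset.prod_const_one, mul_one, Finset.prod_pow_eq_pow_sum, mul_assoc]
  have h1 : ((-1 : PowerSeries ℚ) ^ I.card) = PowerSeries.C ((-1 : ℚ) ^ I.card) := by simp
  rw [h1, PowerSeries.coeff_C_mul, PowerSeries.coeff_X_pow_mul']
  congr 1
  have h2 : ∑ i ∈ I, (e i : ℤ) = ((∑ i ∈ I, e i : ℕ) : ℤ) := by push_cast; rfl
  rw [h2]
  split_ifs with h
  · rw [Wp_one_pow, show (n:ℤ) + c - ((∑ i ∈ I, e i : ℕ) : ℤ) =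
      ((n + (c - ∑ i ∈ I, e i) : ℕ) : ℤ) by omega, Cb_nat]
    simp
  · rw [Cb, if_neg (by omega)]; simp

lemma Hs_expand {ι : Type} [DecidableEq ι] (n D F d N : ℕ) (S : Finset ι) (e : ι → ℕ) (hN : d < N) :
    PowerSeries.coeff d (Hs n D 0 F S e) = ∑ t ∈ range N, ∑ I ∈ S.powerset,
      (-1 : ℚ) ^ I.card * ((Nat.multichoose D t : ℚ) *
        (Cb ((n : ℤ) + d - ∑ i ∈ I, (e i : ℤ) - t * (F + 1)) n : ℚ)) := by
  rw [Hs, pow_zero, mul_one, Nat.sub_zero, coeff_mul_Wp_pow _ _ _ _ _ (Nat.succ_pos F) hN]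
  refine Finset.sum_congr rfl fun t _ => ?_
  have h3 : ((t * (F+1) : ℕ) : ℤ) = (t:ℤ) * (F + 1) := by push_cast; ring
  have h4 : (Nat.multichoose D t : ℚ) * (if t * (F+1) ≤ d then PowerSeries.coeff (d - t * (F+1))
      ((∏ i ∈ S, ((1 : PowerSeries ℚ) - PowerSeries.X ^ e i)) * Wp 1 ^ (n+1)) else 0) =
      (Nat.multichoose D t : ℚ) * ∑ I ∈ S.powerset, (-1 : ℚ) ^ I.card *
        (Cb ((n : ℤ) + d - ∑ i ∈ I, (e i : ℤ) - t * (F + 1)) n : ℚ) := by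
    congr 1
    split_ifs with h
    · rw [coeff_prod_part]
      refine Finset.sum_congr rfl fun I _ => ?_
      rw [← h3]
      congr 3
      push_cast [h]
      ring
    · symm
      refine Finset.sum_eq_zero fun I _ => ?_
      have h2 : 0 ≤ ∑ i ∈ I, (e i : ℤ) := Finset.sum_nonneg fun i _ => by positivity
      rw [← h3, Cb, if_neg (by omega)]; simp
  rw [h4, Finset.mul_sum]
  refine Finset.sum_congr rfl fun I _ => ?_
  ring

lemma final_aux (n d s k : ℕ) (hn : 2 ≤ n) (hs : n + 3 ≤ s)
    (m : Fin s → ℕ) (tp : Fin s → ℂ) (htp : Function.Injective tp)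
    (heff : linSys n d s m tp ≠ ⊥)
    (hred : ∀ i : Fin s, k ≤ m i)
    (hkc : 1 ≤ k)
    (hεdef : ((s : ℤ) - n - 2) * k =
      (∑ i, (m i : ℤ)) - (n : ℤ) * d + ((s : ℤ) - n - 3)) :
    (Module.finrank ℂ (linSys n d s m tp) : ℤ) =
      ∑ t ∈ (Finset.range (n+1)).filter (fun t => 2 * t ≤ n),
        ∑ I ∈ Finset.univ.filter (fun I : Finset (Fin s) => I.card + 2 * t ≤ n),
          (-1 : ℤ) ^ I.card *
            Fb t ((n : ℤ) +
                ((∑ i ∈ I, (m i : ℤ)) + (t : ℤ) * k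
                  - ((t : ℤ) + I.card - 1) * d)
                - ((I.card : ℤ) + 2 * t - 1) - 1)
              s (s - n - 3) n := by
  have hKK : KK n d tp univ (fun i => d + 1 - m i) ≠ ⊥ := by
    rw [← linSys_map]
    intro h
    apply heff
    rw [eq_bot_iff]
    intro P hP
    have h1 : lam n P ∈ (linSys n d s m tp).map (lam n) := Submodule.mem_map_of_mem hP
    rw [h, Submodule.mem_bot] at h1
    rw [Submodule.mem_bot]
    exact lam_inj n (by rw [h1, map_zero])
  obtain ⟨f, hf, hf0⟩ := Submodule.exists_mem_ne_zero_of_ne_bot hKK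
  have hmd : ∀ i, m i ≤ d := by
    intro i
    by_contra hi
    apply hf0
    refine LinearMap.ext fun q => ?_
    have := hf.2 i (mem_univ i) q
    simpa [show d + 1 - m i = 0 by omega] using this
  have hkd : k ≤ d := (hred ⟨0, by omega⟩).trans (hmd _)
  obtain ⟨F, hF⟩ : ∃ F, F + k = d + 1 := ⟨d + 1 - k, by omega⟩
  obtain ⟨D, hD⟩ : ∃ D, s = D + n + 2 := ⟨s - n - 2, by omega⟩
  have hei : ∀ i, ((d + 1 - m i : ℕ) : ℤ) = d + 1 - m i := by
    intro i; have := hmd i; omega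
  have hsum : ∑ i : Fin s, (d + 1 - m i) + 0 = D * (F + 1) + 2 * d + n + 1 := by
    zify
    rw [Finset.sum_congr rfl fun i _ => hei i, Finset.sum_sub_distrib, Finset.sum_const,
      Finset.card_univ, Fintype.card_fin]
    have hFz : (F : ℤ) = d + 1 - k := by omega
    have hsz : (s : ℤ) = D + n + 2 := by omega
    rw [nsmul_eq_mul, hFz]
    rw [hsz] at hεdef ⊢
    linear_combination hεdef
  obtain ⟨n', rfl⟩ := Nat.exists_eq_add_of_le' (show 1 ≤ n by omega)
  have hcard : (univ : Finset (Fin s)).card = D + (n'+1) + 2 := by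
    rw [Finset.card_univ, Fintype.card_fin]; omega
  have hKL := KL' htp hcard hsum hf
  have hmain := MAIN htp (S := univ) (e := fun i => d + 1 - m i) (n := n') (D := D) (η := 0)
    (F := F) (d := d) ⟨hcard, by omega, hsum, fun i _ => by have := hred i; show d + 1 - m i ≤ F; omega⟩
  rw [← finrank_linSys, Hs_expand _ _ _ _ (n' + 2 + d) _ _ (by omega)] at hmain
  have hgoal : (Module.finrank ℂ (linSys (n'+1) d s m tp) : ℤ) = ∑ t ∈ range (n' + 2 + d),
      ∑ I : Finset (Fin s), (-1 : ℤ) ^ I.card * ((Nat.multichoose D t : ℤ) *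
        Cb (((n' + 1 : ℕ) : ℤ) + d - ∑ i ∈ I, ((d + 1 - m i : ℕ) : ℤ) - t * (F + 1))
          ((n'+1 : ℕ) : ℤ)) := by
    rw [Finset.powerset_univ] at hmain
    exact_mod_cast hmain
  rw [hgoal]
  symm
  refine Finset.sum_subset_zero_on_sdiff ?_ ?_ ?_
  · intro t ht
    simp only [mem_filter, mem_range] at ht ⊢
    omega
  · intro t ht
    simp only [mem_sdiff, mem_filter, mem_range, not_and] at ht
    refine Finset.sum_eq_zero fun I _ => ?_
    have h1 := TRUNC htp hf hKL hf0 (subset_univ I) (t := t) (by omega)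
      (fun i _ => by have := hmd i; omega) (by omega)
    have h3 : ((t * (F+1) : ℕ) : ℤ) = (t:ℤ) * (F + 1) := by push_cast; ring
    have h2 : ∑ i ∈ I, ((d + 1 - m i : ℕ) : ℤ) = ((∑ i ∈ I, (d + 1 - m i) : ℕ) : ℤ) :=
      (Nat.cast_sum _ _).symm
    rw [h2, ← h3, Cb, if_neg (by omega)]; simp
  · intro t ht
    simp only [mem_filter, mem_range] at ht
    refine Finset.sum_subset_zero_on_sdiff (Finset.subset_univ _) ?_ ?_
    · intro I hI
      simp only [mem_sdiff, mem_filter, mem_univ, true_and] at hI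
      have h1 := TRUNC htp hf hKL hf0 (subset_univ I) (t := t) (by omega)
        (fun i _ => by have := hmd i; omega) (by omega)
      have h3 : ((t * (F+1) : ℕ) : ℤ) = (t:ℤ) * (F + 1) := by push_cast; ring
      have h2 : ∑ i ∈ I, ((d + 1 - m i : ℕ) : ℤ) = ((∑ i ∈ I, (d + 1 - m i) : ℕ) : ℤ) :=
        (Nat.cast_sum _ _).symm
      rw [h2, ← h3, Cb, if_neg (by omega)]; simp
    · intro I _
      rw [Fb_eq _ _ _ hn hs ht.2, show s - (n'+1) - 3 + 1 = D by omega]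
      congr 3
      rw [Finset.sum_congr rfl fun i _ => hei i, Finset.sum_sub_distrib, Finset.sum_const,
        nsmul_eq_mul, show (F : ℤ) = d + 1 - k by omega]
      ring

/-- **The case `ε = s−n−3` (Proposition C).** If `L = L_{n,d}(m_1,…,m_s)` is effective
and non-redundant with `s ≥ n+3` points on a rational normal curve, `k_C ≥ 1`, and
exceeding number `ε = s−n−3`, then
`dim L = Σ (−1)^{|I|} F_t(n + k_{I,t} − r_{I,t} − 1, s, s−n−3, n)`. -/
theorem stmt_3 (n d s : ℕ) (hn : 2 ≤ n) (hs : n + 3 ≤ s)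
    (m : Fin s → ℕ) (tp : Fin s → ℂ) (htp : Function.Injective tp)
    (heff : linSys n d s m tp ≠ ⊥)
    (hred : ∀ i : Fin s, kC n d s m ≤ (m i : ℤ))
    (hkc : 1 ≤ kC n d s m)
    (hεdef : ((s : ℤ) - n - 2) * kC n d s m =
      (∑ i, (m i : ℤ)) - (n : ℤ) * d + ((s : ℤ) - n - 3)) :
    (Module.finrank ℂ (linSys n d s m tp) : ℤ) =
      ∑ t ∈ (Finset.range (n+1)).filter (fun t => 2 * t ≤ n),
        ∑ I ∈ Finset.univ.filter (fun I : Finset (Fin s) => I.card + 2 * t ≤ n),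
          (-1 : ℤ) ^ I.card *
            Fb t ((n : ℤ) +
                ((∑ i ∈ I, (m i : ℤ)) + (t : ℤ) * kC n d s m
                  - ((t : ℤ) + I.card - 1) * d)
                - ((I.card : ℤ) + 2 * t - 1) - 1)
              s (s - n - 3) n := by
  have hk : kC n d s m = ((kC n d s m).toNat : ℤ) := (Int.toNat_of_nonneg (by omega)).symm
  rw [hk] at hred hkc hεdef ⊢
  exact final_aux n d s _ hn hs m tp htp heff (fun i => by exact_mod_cast hred i)
    (by exact_mod_cast hkc) hεdef

end
end
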